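/- arXiv:2111.01361 — 7 statements merged into one kernel-verified Lean document; each statement's English description precedes it below -/
import Mathlib

section
/- Fix p ∈ [1,∞), q > p, and M > 0, and let D_q be the family of probability measures μ on a complete separable metric space (X,d) with ‖d(·,x)‖_{L^q(μ)} ≤ M for some x ∈ X. Then for every 0 ≤ ε ≤ 0.49, the minimax robust estimation risk satisfies R(D_q, ε) ≤ C · M · ε^{1/p − 1/q} for an absolute constant C. -/
open MeasureTheory ENNReal Filter Topology

noncomputable section

variable {X : Type*} [MetricSpace X] [MeasurableSpace X] [BorelSpace X]

/-- The set of couplings of `μ` and `ν`. -/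
def couplings (μ ν : Measure X) : Set (Measure (X × X)) :=
  {π | π.map Prod.fst = μ ∧ π.map Prod.snd = ν}

/-- The `p`-Wasserstein distance (`ℝ≥0∞`-valued); `p = ∞` uses the essential supremum. -/
def Wp (p : ℝ≥0∞) (μ ν : Measure X) : ℝ≥0∞ :=
  ⨅ π ∈ couplings μ ν, eLpNorm (fun z : X × X => dist z.1 z.2) p π

/-- The `ε`-outlier-robust `p`-Wasserstein distance. -/
def RWp (p : ℝ≥0∞) (ε : ℝ) (μ ν : Measure X) : ℝ≥0∞ :=
  ⨅ (μ' : Measure X) (ν' : Measure X) (_ : μ' ≤ μ) (_ : ν' ≤ ν)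
    (_ : (μ - μ') Set.univ ≤ ENNReal.ofReal ε)
    (_ : (ν - ν') Set.univ ≤ ENNReal.ofReal ε),
    Wp p ((μ' Set.univ)⁻¹ • μ') ((ν' Set.univ)⁻¹ • ν')

/-- The Huber `ε`-contamination ball around `μ`. -/
def huberBall (ε : ℝ) (μ : Measure X) : Set (Measure X) :=
  {μ' | ∃ α : Measure X, IsProbabilityMeasure α ∧
    μ' = ENNReal.ofReal (1 - ε) • μ + ENNReal.ofReal ε • α}

/-- The minimax robust estimation risk for estimating `W_p` under Huber `ε`-contamination,
with the infimum running over all (real-valued) estimators. -/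
def risk (p : ℝ) (D : Set (Measure X)) (ε : ℝ) : ℝ≥0∞ :=
  ⨅ West : Measure X → Measure X → ℝ,
    ⨆ (μ : Measure X) (_ : μ ∈ D) (ν : Measure X) (_ : ν ∈ D)
      (μt : Measure X) (_ : μt ∈ huberBall ε μ) (νt : Measure X) (_ : νt ∈ huberBall ε ν),
      ENNReal.ofReal |West μt νt - (Wp (ENNReal.ofReal p) μ ν).toReal|

/-- The family of probability measures with centered `q`-th moment at most `M`:
`‖d(·,x)‖_{L^q(μ)} ≤ M` for some `x`. -/
def Dq (q M : ℝ) : Set (Measure X) :=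
  {μ | IsProbabilityMeasure μ ∧
    ∃ x : X, eLpNorm (fun y => dist y x) (ENNReal.ofReal q) μ ≤ ENNReal.ofReal M}

open scoped ProbabilityTheory

lemma aux_decomp {Y : Type*} [MeasurableSpace Y] (μ ν : Measure Y) [IsProbabilityMeasure μ]
    [IsProbabilityMeasure ν] (c e : ℝ≥0∞) (hc : c ≠ ∞)
    (h : ∀ B, c * μ B ≤ c * ν B + e) :
    ∃ κ r r' : Measure Y, κ + r = μ ∧ κ + r' = ν ∧ r Set.univ = r' Set.univ ∧
      c * r Set.univ ≤ e := by
  obtain ⟨s, hs, h1, h2⟩ := hahn_decomposition μ ν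
  have l1 : ν.restrict s ≤ μ.restrict s := by
    refine Measure.le_iff.2 fun t ht => ?_
    rw [Measure.restrict_apply ht, Measure.restrict_apply ht]
    exact h1 _ (ht.inter hs) Set.inter_subset_right
  have l2 : μ.restrict sᶜ ≤ ν.restrict sᶜ := by
    refine Measure.le_iff.2 fun t ht => ?_
    rw [Measure.restrict_apply ht, Measure.restrict_apply ht]
    exact h2 _ (ht.inter hs.compl) Set.inter_subset_right
  have e1 := Measure.sub_add_cancel_of_le l1
  have e2 := Measure.sub_add_cancel_of_le l2
  set r := μ.restrict s - ν.restrict s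
  set r' := ν.restrict sᶜ - μ.restrict sᶜ
  have f1 : ν.restrict s + μ.restrict sᶜ + r = μ := by
    conv_rhs => rw [← Measure.restrict_add_restrict_compl (μ := μ) hs, ← e1]
    abel
  have f2 : ν.restrict s + μ.restrict sᶜ + r' = ν := by
    conv_rhs => rw [← Measure.restrict_add_restrict_compl (μ := ν) hs, ← e2]
    abel
  refine ⟨ν.restrict s + μ.restrict sᶜ, r, r', f1, f2, ?_, ?_⟩
  · have g1 := congrArg (fun m => m Set.univ) f1
    have g2 := congrArg (fun m => m Set.univ) f2
    simp only [Measure.add_apply _ r, Measure.add_apply _ r', measure_univ] at g1 g2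
    rw [← g2] at g1
    exact (ENNReal.add_right_inj (measure_ne_top _ _)).1 g1
  · have g := h s
    have g1 := congrArg (fun m => m Set.univ) e1
    simp only [Measure.add_apply, Measure.restrict_apply_univ] at g1
    rw [← g1, mul_add, add_comm] at g
    exact (ENNReal.add_le_add_iff_left (ENNReal.mul_ne_top hc (measure_ne_top _ _))).1 g

lemma aux_prob {Y Z : Type*} [MeasurableSpace Y] [MeasurableSpace Z] {π : Measure Y} {f : Y → Z}
    (hf : Measurable f) {μ : Measure Z} [IsProbabilityMeasure μ] (h : π.map f = μ) :
    IsProbabilityMeasure π := by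
  constructor
  have : (π.map f) Set.univ = 1 := by rw [h]; exact measure_univ
  rwa [Measure.map_apply hf MeasurableSet.univ, Set.preimage_univ] at this

lemma aux_glue {Y : Type*} [MeasurableSpace Y] [StandardBorelSpace Y] [Nonempty Y]
    (π₁ π₂ : Measure (Y × Y)) [IsProbabilityMeasure π₁] [IsProbabilityMeasure π₂]
    (h : π₁.map Prod.snd = π₂.map Prod.fst) :
    ∃ T : Measure (Y × (Y × Y)), T.map (fun t => (t.2.1, t.1)) = π₁ ∧
      T.map (fun t => (t.1, t.2.2)) = π₂ := by
  set σ := π₁.map Prod.swap with hσ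
  have : IsProbabilityMeasure σ := Measure.isProbabilityMeasure_map (by fun_prop)
  have hf : σ.fst = π₂.fst := by
    rw [Measure.fst, Measure.fst, hσ, Measure.map_map measurable_fst measurable_swap, ← h]
    rfl
  have k1 := σ.disintegrate σ.condKernel
  have k2 := π₂.disintegrate π₂.condKernel
  refine ⟨π₂.fst ⊗ₘ (σ.condKernel ×ₖ π₂.condKernel), ?_, ?_⟩
  · have : (π₂.fst ⊗ₘ (σ.condKernel ×ₖ π₂.condKernel)).map (Prod.map id Prod.fst) = σ := by
      rw [← Measure.compProd_map measurable_fst, ← ProbabilityTheory.Kernel.fst_eq,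
        ProbabilityTheory.Kernel.fst_prod, ← hf, k1]
    have h2 := congrArg (Measure.map Prod.swap) this
    have h3 : σ.map Prod.swap = π₁ := by
      rw [hσ, Measure.map_map (by fun_prop) (by fun_prop), Prod.swap_swap_eq, Measure.map_id]
    rw [Measure.map_map (by fun_prop) (by fun_prop), h3] at h2
    exact h2
  · have : (π₂.fst ⊗ₘ (σ.condKernel ×ₖ π₂.condKernel)).map (Prod.map id Prod.snd) = π₂ := by
      rw [← Measure.compProd_map measurable_snd, ← ProbabilityTheory.Kernel.snd_eq,
        ProbabilityTheory.Kernel.snd_prod, k2]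
    exact this

lemma aux_triangle {Y : Type*} [MetricSpace Y] [CompleteSpace Y]
    [TopologicalSpace.SeparableSpace Y] [MeasurableSpace Y] [BorelSpace Y]
    (p : ℝ≥0∞) (hp : 1 ≤ p) (μ ν ρ : Measure Y) [IsProbabilityMeasure μ]
    [IsProbabilityMeasure ν] [IsProbabilityMeasure ρ] :
    Wp p μ ρ ≤ Wp p μ ν + Wp p ν ρ := by
  have : SecondCountableTopology Y := UniformSpace.secondCountable_of_separable Y
  have : Nonempty Y := nonempty_of_isProbabilityMeasure μ
  unfold Wp
  refine ENNReal.le_of_forall_pos_le_add fun η hη hfin => ?_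
  have hη' : (0 : ℝ≥0∞) < (η : ℝ≥0∞) / 2 := by
    simpa using hη.ne'
  have hfin := ENNReal.add_lt_top.1 hfin
  have a1 := ENNReal.lt_add_right hfin.1.ne hη'.ne'
  have a2 := ENNReal.lt_add_right hfin.2.ne hη'.ne'
  simp only [iInf_lt_iff] at a1 a2
  obtain ⟨π₁, ⟨m1, m2⟩, b1⟩ := a1
  obtain ⟨π₂, ⟨m3, m4⟩, b2⟩ := a2
  have := aux_prob measurable_fst m1
  have := aux_prob measurable_fst m3
  obtain ⟨T, t1, t2⟩ := aux_glue π₁ π₂ (m2.trans m3.symm)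
  have hmem : T.map (fun t => (t.2.1, t.2.2)) ∈ couplings μ ρ := by
    refine ⟨?_, ?_⟩
    · rw [Measure.map_map (by fun_prop) (by fun_prop), ← m1, ← t1,
        Measure.map_map (by fun_prop) (by fun_prop)]
      rfl
    · rw [Measure.map_map (by fun_prop) (by fun_prop), ← m4, ← t2,
        Measure.map_map (by fun_prop) (by fun_prop)]
      rfl
  · refine (iInf₂_le _ hmem).trans ?_
    have hm : StronglyMeasurable (fun z : Y × Y => dist z.1 z.2) :=
      continuous_dist.stronglyMeasurable
    rw [eLpNorm_map_measure hm.aestronglyMeasurable (by fun_prop)]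
    rw [← t1, eLpNorm_map_measure hm.aestronglyMeasurable (by fun_prop)] at b1
    rw [← t2, eLpNorm_map_measure hm.aestronglyMeasurable (by fun_prop)] at b2
    calc _ ≤ eLpNorm (((fun z : Y × Y => dist z.1 z.2) ∘ fun t : Y × (Y × Y) => (t.2.1, t.1)) +
          ((fun z : Y × Y => dist z.1 z.2) ∘ fun t => (t.1, t.2.2))) p T := by
            refine eLpNorm_mono_real fun t => ?_
            simp only [Function.comp, Pi.add_apply, Real.norm_eq_abs, abs_of_nonneg dist_nonneg]
            exact dist_triangle _ _ _
      _ ≤ _ := eLpNorm_add_le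
            (hm.comp_measurable (by fun_prop)).aestronglyMeasurable
            (hm.comp_measurable (by fun_prop)).aestronglyMeasurable hp
      _ ≤ _ := add_le_add b1.le b2.le
      _ = _ := by
            rw [add_add_add_comm, ENNReal.add_halves]

lemma aux_modulus {Y : Type*} [MetricSpace Y]
    [TopologicalSpace.SeparableSpace Y] [MeasurableSpace Y] [BorelSpace Y]
    (p q M ε : ℝ) (hp : 1 ≤ p) (hpq : p < q) (hM : 0 < M) (h0 : 0 ≤ ε) (h1 : ε ≤ 0.49)
    (μ ν τ : Measure Y) (hμ : μ ∈ Dq q M) (hν : ν ∈ Dq q M)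
    (hμτ : τ ∈ huberBall ε μ) (hντ : τ ∈ huberBall ε ν) :
    Wp (ENNReal.ofReal p) μ ν ≤ ENNReal.ofReal (108 * M * ε ^ (1 / p - 1 / q)) := by
  have : SecondCountableTopology Y := UniformSpace.secondCountable_of_separable Y
  obtain ⟨iμ, x, hx⟩ := hμ
  obtain ⟨iν, y, hy⟩ := hν
  obtain ⟨α, iα, hα⟩ := hμτ
  obtain ⟨β, iβ, hβ⟩ := hντ
  have hp0 : ENNReal.ofReal p ≠ 0 := by simp; linarith
  have hq0 : ENNReal.ofReal q ≠ 0 := by simp; linarith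
  have hp1 : 1 ≤ ENNReal.ofReal p := by simpa using hp
  have hq1 : 1 ≤ ENNReal.ofReal q := by simpa using hp.trans hpq.le
  obtain ⟨κ, r, r', e1, e2, e3, e4⟩ := aux_decomp μ ν (ENNReal.ofReal (1 - ε)) (ENNReal.ofReal ε)
    ENNReal.ofReal_ne_top (by
      intro B
      have h := congrArg (fun m => m B) (hα.symm.trans hβ)
      simp only [Measure.add_apply, Measure.smul_apply, smul_eq_mul] at h
      calc _ ≤ _ := le_self_add
        _ = _ := h
        _ ≤ _ := by
          gcongr
          exact mul_le_of_le_one_right' prob_le_one)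
  have lκμ : κ ≤ μ := e1 ▸ Measure.le_add_right le_rfl
  have lκν : κ ≤ ν := e2 ▸ Measure.le_add_right le_rfl
  have lr : r ≤ μ := e1 ▸ Measure.le_add_left le_rfl
  have lr' : r' ≤ ν := e2 ▸ Measure.le_add_left le_rfl
  have : IsFiniteMeasure κ := isFiniteMeasure_of_le μ lκμ
  have : IsFiniteMeasure r := isFiniteMeasure_of_le μ lr
  have : IsFiniteMeasure r' := isFiniteMeasure_of_le ν lr'
  set δ := r Set.univ with hδ
  have δtop : δ ≠ ∞ := measure_ne_top _ _
  -- real version of delta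
  have hδr : δ.toReal ≤ ε / (1 - ε) := by
    have := ENNReal.toReal_mono ENNReal.ofReal_ne_top e4
    rw [ENNReal.toReal_mul, ENNReal.toReal_ofReal h0, ENNReal.toReal_ofReal (by linarith)] at this
    rw [le_div_iff₀ (by linarith)]
    linarith
  have hδ1 : δ.toReal ≤ 25 / 26 := hδr.trans (by rw [div_le_iff₀ (by linarith)]; linarith)
  have hδ2 : δ.toReal ≤ 2 * ε := hδr.trans (by rw [div_le_iff₀ (by linarith)]; nlinarith)
  have hκ : (1 / 26 : ℝ) ≤ (κ Set.univ).toReal := by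
    have h := congrArg (fun m => (m Set.univ).toReal) e1
    simp only [Measure.add_apply, measure_univ, ENNReal.toReal_one] at h
    rw [ENNReal.toReal_add (measure_ne_top _ _) δtop] at h
    linarith
  have mx : ∀ z : Y, StronglyMeasurable (fun w : Y => dist w z) := fun z =>
    (continuous_id.dist continuous_const).stronglyMeasurable
  -- distance between centers
  have hD : dist x y ≤ 52 * M := by
    have hb : eLpNorm (fun _ : Y => dist x y) (ENNReal.ofReal q) κ ≤
        ENNReal.ofReal M + ENNReal.ofReal M := by
      calc _ ≤ eLpNorm ((fun w => dist w x) + (fun w => dist w y)) (ENNReal.ofReal q) κ := by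
            refine eLpNorm_mono_real fun t => ?_
            simp only [Pi.add_apply, Real.norm_eq_abs, abs_of_nonneg dist_nonneg]
            exact dist_triangle_left _ _ _
        _ ≤ _ := eLpNorm_add_le (mx x).aestronglyMeasurable (mx y).aestronglyMeasurable hq1
        _ ≤ _ := add_le_add ((eLpNorm_mono_measure _ lκμ).trans hx)
            ((eLpNorm_mono_measure _ lκν).trans hy)
    rw [eLpNorm_const' _ hq0 ENNReal.ofReal_ne_top, ← ENNReal.ofReal_add hM.le hM.le] at hb
    have hb := ENNReal.toReal_mono ENNReal.ofReal_ne_top hb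
    rw [ENNReal.toReal_mul, ← ENNReal.toReal_rpow, ENNReal.toReal_ofReal (by linarith),
      ENNReal.toReal_ofReal (by linarith), toReal_enorm, Real.norm_eq_abs,
      abs_of_nonneg dist_nonneg] at hb
    have hk : (1 / 26 : ℝ) ≤ (κ Set.univ).toReal ^ (1 / q) := by
      calc (1 / 26 : ℝ) = (1 / 26 : ℝ) ^ (1 : ℝ) := by simp
        _ ≤ (1 / 26 : ℝ) ^ (1 / q) := by
            apply Real.rpow_le_rpow_of_exponent_ge (by norm_num) (by norm_num)
            rw [div_le_one (by linarith)]; linarith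
        _ ≤ _ := by
            apply Real.rpow_le_rpow (by norm_num) hκ
            have : 0 < q := by linarith
            positivity
    nlinarith [mul_le_mul_of_nonneg_left hk (dist_nonneg (x := x) (y := y))]
  -- the coupling
  set ρ : Measure (Y × Y) := δ⁻¹ • (r.prod r') with hρ
  have c1 : ρ.map Prod.fst = r := by
    rw [hρ, Measure.map_smul, Measure.map_fst_prod, ← e3, smul_smul]
    by_cases hz : δ = 0
    · rw [Measure.measure_univ_eq_zero.1 hz, smul_zero]
    · rw [ENNReal.inv_mul_cancel hz δtop, one_smul]
  have c2 : ρ.map Prod.snd = r' := by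
    rw [hρ, Measure.map_smul, Measure.map_snd_prod, smul_smul]
    by_cases hz : δ = 0
    · rw [Measure.measure_univ_eq_zero.1 (e3.symm.trans hz), smul_zero]
    · rw [ENNReal.inv_mul_cancel hz δtop, one_smul]
  have hs0 : 0 ≤ 1 / p - 1 / q := by
    rw [sub_nonneg]; exact one_div_le_one_div_of_le (by linarith) hpq.le
  have hs1 : 1 / p - 1 / q ≤ 1 := by
    have : 1 / p ≤ 1 := by rw [div_le_one (by linarith)]; exact hp
    have : 0 < 1 / q := one_div_pos.2 (by linarith)
    linarith
  have hm : StronglyMeasurable (fun z : Y × Y => dist z.1 z.2) :=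
      continuous_dist.stronglyMeasurable
  have hdiag : Measurable (fun z : Y => (z, z)) := by fun_prop
  have hρu : ρ Set.univ = δ := by
    rw [hδ, ← c1, Measure.map_apply measurable_fst MeasurableSet.univ, Set.preimage_univ]
  have hle : ENNReal.ofReal p ≤ ENNReal.ofReal q := ENNReal.ofReal_le_ofReal hpq.le
  have tp : (ENNReal.ofReal p).toReal = p := ENNReal.toReal_ofReal (by linarith)
  have tq : (ENNReal.ofReal q).toReal = q := ENNReal.toReal_ofReal (by linarith)
  have b1 : eLpNorm (fun w => dist w x) (ENNReal.ofReal p) r ≤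
      ENNReal.ofReal M * δ ^ (1 / p - 1 / q) := by
    have := eLpNorm_le_eLpNorm_mul_rpow_measure_univ hle (mx x).aestronglyMeasurable (μ := r)
    rw [tp, tq] at this
    refine this.trans ?_
    gcongr
    exact (eLpNorm_mono_measure _ lr).trans hx
  have b2 : eLpNorm (fun w => dist w y) (ENNReal.ofReal p) r' ≤
      ENNReal.ofReal M * δ ^ (1 / p - 1 / q) := by
    have := eLpNorm_le_eLpNorm_mul_rpow_measure_univ hle (mx y).aestronglyMeasurable (μ := r')
    rw [tp, tq, ← e3] at this
    refine this.trans ?_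
    gcongr
    exact (eLpNorm_mono_measure _ lr').trans hy
  have b3 : eLpNorm (fun _ : Y × Y => dist x y) (ENNReal.ofReal p) ρ ≤
      ENNReal.ofReal (52 * M) * δ ^ (1 / p - 1 / q) := by
    rw [eLpNorm_const' _ hp0 ENNReal.ofReal_ne_top, hρu, tp]
    refine mul_le_mul' ?_ ?_
    · rw [Real.enorm_eq_ofReal dist_nonneg]
      exact ENNReal.ofReal_le_ofReal hD
    · apply ENNReal.rpow_le_rpow_of_exponent_ge
      · rw [← ENNReal.ofReal_toReal δtop]
        exact ENNReal.ofReal_le_one.2 (by linarith)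
      · have : 0 < 1 / q := one_div_pos.2 (by linarith)
        linarith
  have hδs : δ ^ (1 / p - 1 / q) ≤ ENNReal.ofReal (2 * ε ^ (1 / p - 1 / q)) := by
    rw [← ENNReal.ofReal_toReal δtop, ENNReal.ofReal_rpow_of_nonneg ENNReal.toReal_nonneg hs0]
    apply ENNReal.ofReal_le_ofReal
    calc _ ≤ (2 * ε) ^ (1 / p - 1 / q) := Real.rpow_le_rpow ENNReal.toReal_nonneg hδ2 hs0
      _ = 2 ^ (1 / p - 1 / q) * ε ^ (1 / p - 1 / q) := Real.mul_rpow (by norm_num) h0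
      _ ≤ _ := by
        gcongr
        calc (2 : ℝ) ^ (1 / p - 1 / q) ≤ 2 ^ (1 : ℝ) :=
              Real.rpow_le_rpow_of_exponent_le (by norm_num) hs1
          _ = 2 := by simp
  have hcost : eLpNorm (fun z : Y × Y => dist z.1 z.2) (ENNReal.ofReal p)
      (κ.map (fun z => (z, z)) + ρ) =
      eLpNorm (fun z : Y × Y => dist z.1 z.2) (ENNReal.ofReal p) ρ := by
    rw [eLpNorm_eq_lintegral_rpow_enorm_toReal hp0 ENNReal.ofReal_ne_top,
      eLpNorm_eq_lintegral_rpow_enorm_toReal hp0 ENNReal.ofReal_ne_top, lintegral_add_measure,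
      lintegral_map (by fun_prop) hdiag]
    have : 0 < p := by linarith
    simp [tp, this]
  unfold Wp
  have hmem : κ.map (fun z => (z, z)) + ρ ∈ couplings μ ν := by
    refine ⟨?_, ?_⟩
    · rw [Measure.map_add _ _ measurable_fst, c1, Measure.map_map measurable_fst hdiag, ← e1]
      congr 1
      exact Measure.map_id
    · rw [Measure.map_add _ _ measurable_snd, c2, Measure.map_map measurable_snd hdiag, ← e2]
      congr 1
      exact Measure.map_id
  · refine (iInf₂_le _ hmem).trans ?_
    rw [hcost]
    rw [← c1, eLpNorm_map_measure (mx x).aestronglyMeasurable (by fun_prop)] at b1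
    rw [← c2, eLpNorm_map_measure (mx y).aestronglyMeasurable (by fun_prop)] at b2
    have s1 : AEStronglyMeasurable ((fun w => dist w x) ∘ Prod.fst) ρ :=
      ((mx x).comp_measurable measurable_fst).aestronglyMeasurable
    have s2 : AEStronglyMeasurable ((fun w => dist w y) ∘ Prod.snd) ρ :=
      ((mx y).comp_measurable measurable_snd).aestronglyMeasurable
    have s3 : AEStronglyMeasurable (fun _ : Y × Y => dist x y) ρ := aestronglyMeasurable_const
    calc _ ≤ eLpNorm ((((fun w => dist w x) ∘ Prod.fst) + (fun _ : Y × Y => dist x y)) +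
            ((fun w => dist w y) ∘ Prod.snd)) (ENNReal.ofReal p) ρ := by
            refine eLpNorm_mono_real fun t => ?_
            simp only [Function.comp, Pi.add_apply, Real.norm_eq_abs, abs_of_nonneg dist_nonneg]
            rw [dist_comm t.2 y]
            exact dist_triangle4 _ _ _ _
      _ ≤ _ := eLpNorm_add_le (s1.add s3) s2 hp1
      _ ≤ _ := add_le_add (eLpNorm_add_le s1 s3 hp1) le_rfl
      _ ≤ _ := add_le_add (add_le_add b1 b3) b2
      _ = ENNReal.ofReal (54 * M) * δ ^ (1 / p - 1 / q) := by
            rw [← add_mul, ← add_mul, ← ENNReal.ofReal_add (by positivity) (by positivity),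
              ← ENNReal.ofReal_add (by positivity) (by positivity)]
            congr 2; ring
      _ ≤ ENNReal.ofReal (54 * M) * ENNReal.ofReal (2 * ε ^ (1 / p - 1 / q)) := by gcongr
      _ = _ := by
            rw [← ENNReal.ofReal_mul (by positivity)]
            congr 1; ring

lemma aux_diff (a b : ℝ≥0∞) (t : ℝ) (ht : 0 ≤ t) (h1 : a ≤ b + ENNReal.ofReal t)
    (h2 : b ≤ a + ENNReal.ofReal t) : |a.toReal - b.toReal| ≤ t := by
  by_cases ha : a = ∞
  · have hb : b = ∞ := by
      by_contra hb
      exact (ENNReal.add_ne_top.2 ⟨hb, ENNReal.ofReal_ne_top⟩) (top_le_iff.1 (ha ▸ h1))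
    simpa [ha, hb] using ht
  · have hb : b ≠ ∞ := ne_top_of_le_ne_top (ENNReal.add_ne_top.2 ⟨ha, ENNReal.ofReal_ne_top⟩) h2
    have g1 := ENNReal.toReal_mono (ENNReal.add_ne_top.2 ⟨hb, ENNReal.ofReal_ne_top⟩) h1
    have g2 := ENNReal.toReal_mono (ENNReal.add_ne_top.2 ⟨ha, ENNReal.ofReal_ne_top⟩) h2
    rw [ENNReal.toReal_add ‹_› ENNReal.ofReal_ne_top, ENNReal.toReal_ofReal ht] at g1 g2
    rw [abs_le]; constructor <;> linarith

/-- minimax risk upper bound: for `1 ≤ p < q`, `M > 0`, and `0 ≤ ε ≤ 0.49`,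
the minimax robust estimation risk over `D_q` is at most `C · M · ε^(1/p - 1/q)` for an
absolute constant `C`. -/
theorem robust_estimation_risk_upper_bound :
    ∃ C : ℝ, 0 < C ∧
      ∀ (X : Type) [MetricSpace X] [CompleteSpace X] [TopologicalSpace.SeparableSpace X]
        [MeasurableSpace X] [BorelSpace X] (p q M ε : ℝ),
        1 ≤ p → p < q → 0 < M → 0 ≤ ε → ε ≤ 0.49 →
        risk (X := X) p (Dq q M) ε ≤ ENNReal.ofReal (C * M * ε ^ (1 / p - 1 / q)) := by
  classical
  refine ⟨216, by norm_num, ?_⟩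
  intro X _ _ _ _ _ p q M ε hp hpq hM h0 h1
  have hp1 : 1 ≤ ENNReal.ofReal p := by simpa using hp
  let S : Measure X → Measure X := fun τ =>
    if h : ∃ μ : Measure X, μ ∈ Dq q M ∧ τ ∈ huberBall ε μ then h.choose else 0
  have hS : ∀ τ μ : Measure X, μ ∈ Dq q M → τ ∈ huberBall ε μ →
      S τ ∈ Dq q M ∧ τ ∈ huberBall ε (S τ) := by
    intro τ μ h h'
    have hex : ∃ μ : Measure X, μ ∈ Dq q M ∧ τ ∈ huberBall ε μ := ⟨μ, h, h'⟩
    simp only [S, dif_pos hex]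
    exact hex.choose_spec
  unfold risk
  refine (iInf_le _ (fun a b => (Wp (ENNReal.ofReal p) (S a) (S b)).toReal)).trans ?_
  refine iSup_le fun μ => iSup_le fun hμ => iSup_le fun ν => iSup_le fun hν => iSup_le fun μt =>
    iSup_le fun hμt => iSup_le fun νt => iSup_le fun hνt => ENNReal.ofReal_le_ofReal ?_
  obtain ⟨a1, a2⟩ := hS μt μ hμ hμt
  obtain ⟨b1, b2⟩ := hS νt ν hν hνt
  have m1 := aux_modulus p q M ε hp hpq hM h0 h1 μ (S μt) μt hμ a1 hμt a2
  have m2 := aux_modulus p q M ε hp hpq hM h0 h1 (S μt) μ μt a1 hμ a2 hμt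
  have m3 := aux_modulus p q M ε hp hpq hM h0 h1 ν (S νt) νt hν b1 hνt b2
  have m4 := aux_modulus p q M ε hp hpq hM h0 h1 (S νt) ν νt b1 hν b2 hνt
  have := hμ.1
  have := hν.1
  have := a1.1
  have := b1.1
  have ht : 0 ≤ 108 * M * ε ^ (1 / p - 1 / q) := by positivity
  have hsum : ENNReal.ofReal (216 * M * ε ^ (1 / p - 1 / q)) =
      ENNReal.ofReal (108 * M * ε ^ (1 / p - 1 / q)) +
      ENNReal.ofReal (108 * M * ε ^ (1 / p - 1 / q)) := by
    rw [← ENNReal.ofReal_add ht ht]; congr 1; ring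
  apply aux_diff _ _ _ (by positivity)
  · rw [hsum]
    calc _ ≤ _ := aux_triangle _ hp1 (S μt) μ (S νt)
      _ ≤ _ := add_le_add m2 (aux_triangle _ hp1 μ ν (S νt))
      _ ≤ _ := add_le_add le_rfl (add_le_add le_rfl m3)
      _ = _ := by ring
  · rw [hsum]
    calc _ ≤ _ := aux_triangle _ hp1 μ (S μt) ν
      _ ≤ _ := add_le_add m1 (aux_triangle _ hp1 (S μt) (S νt) ν)
      _ ≤ _ := add_le_add le_rfl (add_le_add le_rfl m4)
      _ = _ := by ring

end
end

section
/- Fix p ∈ [1,∞), q > p, and M > 0, and let D_q be the family of probability measures μ on a complete separable metric space (X,d) with ‖d(·,x)‖_{L^q(μ)} ≤ M for some x ∈ X. Then for every 0 ≤ ε ≤ 0.99, the upper modulus of continuity satisfies m_+(D_q, ε) ≤ C · M · ε^{1/p − 1/q} for an absolute constant C. -/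
open MeasureTheory ENNReal Filter Topology

noncomputable section

variable {X : Type*} [MetricSpace X] [MeasurableSpace X] [BorelSpace X]

/-- The upper modulus of continuity `m₊(D, ε)`. -/
def upperMod (p : ℝ) (D : Set (Measure X)) (ε : ℝ) : ℝ≥0∞ :=
  ⨆ (κ : Measure X) (_ : κ ∈ D) (κ' : Measure X) (_ : IsProbabilityMeasure κ')
    (_ : κ ∈ huberBall ε κ'),
    Wp (ENNReal.ofReal p) κ κ'

theorem aux_marg {X : Type} [MetricSpace X] [MeasurableSpace X]
    (c q M K : ℝ) (hc : 0 < c) (hq : 0 < q) (hK : 0 ≤ K) (hcK : 1 ≤ c ^ (1 / q) * K) (hM : 0 ≤ M)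
    (β κ : Measure X) (f : X → ℝ)
    (hle : ENNReal.ofReal c • β ≤ κ)
    (h : eLpNorm f (ENNReal.ofReal q) κ ≤ ENNReal.ofReal M) :
    eLpNorm f (ENNReal.ofReal q) β ≤ ENNReal.ofReal (K * M) := by
  have h1 := (eLpNorm_mono_measure (p := ENNReal.ofReal q) f hle).trans h
  rw [eLpNorm_smul_measure_of_ne_top ENNReal.ofReal_ne_top, smul_eq_mul,
    ENNReal.toReal_div, ENNReal.toReal_one, ENNReal.toReal_ofReal hq.le, ENNReal.ofReal_rpow_of_pos hc] at h1
  calc eLpNorm f (ENNReal.ofReal q) β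
      ≤ ENNReal.ofReal (c ^ (1 / q) * K) * eLpNorm f (ENNReal.ofReal q) β := by
        have : (1 : ℝ≥0∞) ≤ ENNReal.ofReal (c ^ (1 / q) * K) := by
          simpa using ENNReal.ofReal_le_ofReal hcK
        exact le_mul_of_one_le_left zero_le this
    _ = ENNReal.ofReal K * (ENNReal.ofReal (c ^ (1 / q)) * eLpNorm f (ENNReal.ofReal q) β) := by
        rw [mul_comm (c ^ (1 / q)) K, ENNReal.ofReal_mul hK, mul_assoc]
    _ ≤ ENNReal.ofReal K * ENNReal.ofReal M := by gcongr
    _ = _ := (ENNReal.ofReal_mul hK).symm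

theorem aux_prod {X : Type} [MetricSpace X] [SecondCountableTopology X]
    [MeasurableSpace X] [BorelSpace X] (p q : ℝ) (hp : 1 ≤ p) (hpq : p < q) (x : X)
    (α κ' : Measure X) [IsProbabilityMeasure α] [IsProbabilityMeasure κ'] :
    eLpNorm (fun z : X × X => dist z.1 z.2) (ENNReal.ofReal p) (α.prod κ')
      ≤ eLpNorm (fun y => dist y x) (ENNReal.ofReal q) α
        + eLpNorm (fun y => dist y x) (ENNReal.ofReal q) κ' := by
  have hm : Measurable (fun y : X => dist y x) := by fun_prop
  have hp' : (1 : ℝ≥0∞) ≤ ENNReal.ofReal p := by simpa using ENNReal.ofReal_le_ofReal hp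
  have hpq' : ENNReal.ofReal p ≤ ENNReal.ofReal q := ENNReal.ofReal_le_ofReal hpq.le
  calc _ ≤ eLpNorm ((fun y => dist y x) ∘ Prod.fst + (fun y => dist y x) ∘ Prod.snd)
            (ENNReal.ofReal p) (α.prod κ') := by
        apply eLpNorm_mono_real
        intro z
        simp only [Real.norm_eq_abs, abs_dist, Pi.add_apply, Function.comp]
        exact dist_triangle_right _ _ _
    _ ≤ _ := eLpNorm_add_le (hm.comp measurable_fst).aestronglyMeasurable
            (hm.comp measurable_snd).aestronglyMeasurable hp'
    _ = eLpNorm (fun y => dist y x) (ENNReal.ofReal p) α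
        + eLpNorm (fun y => dist y x) (ENNReal.ofReal p) κ' := by
        rw [eLpNorm_comp_measurePreserving hm.aestronglyMeasurable measurePreserving_fst,
          eLpNorm_comp_measurePreserving hm.aestronglyMeasurable measurePreserving_snd]
    _ ≤ _ := by
        gcongr
        · exact eLpNorm_le_eLpNorm_of_exponent_le hpq' hm.aestronglyMeasurable
        · exact eLpNorm_le_eLpNorm_of_exponent_le hpq' hm.aestronglyMeasurable

theorem aux_Wp {X : Type} [MetricSpace X] [SecondCountableTopology X]
    [MeasurableSpace X] [BorelSpace X] (p ε : ℝ) (hp : 1 ≤ p) (h0 : 0 ≤ ε) (h1 : ε ≤ 1)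
    (α κ' : Measure X) [IsProbabilityMeasure α] [IsProbabilityMeasure κ'] :
    Wp (ENNReal.ofReal p) (ENNReal.ofReal (1 - ε) • κ' + ENNReal.ofReal ε • α) κ'
      ≤ ENNReal.ofReal (ε ^ (1 / p)) *
        eLpNorm (fun z : X × X => dist z.1 z.2) (ENNReal.ofReal p) (α.prod κ') := by
  have hd : Measurable (fun y : X => (y, y)) := by fun_prop
  have hp0 : 0 < p := by linarith
  have hpn : ENNReal.ofReal p ≠ 0 := by simpa using hp0
  refine (iInf₂_le (ENNReal.ofReal (1 - ε) • κ'.map (fun y => (y, y))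
    + ENNReal.ofReal ε • α.prod κ') ?_).trans ?_
  · constructor
    · rw [Measure.map_add _ _ measurable_fst, Measure.map_smul, Measure.map_smul,
        Measure.map_map measurable_fst hd, measurePreserving_fst.map_eq]
      congr 2
      exact Measure.map_id
    · rw [Measure.map_add _ _ measurable_snd, Measure.map_smul, Measure.map_smul,
        Measure.map_map measurable_snd hd, measurePreserving_snd.map_eq]
      have : Prod.snd ∘ (fun y : X => (y, y)) = id := rfl
      rw [this, Measure.map_id, ← add_smul, ← ENNReal.ofReal_add (by linarith) h0]
      simp
  · have hz : ∫⁻ z, ‖dist z.1 z.2‖ₑ ^ p ∂(κ'.map (fun y : X => (y, y))) = 0 := by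
      rw [lintegral_map (by fun_prop) hd]
      simp [hp0]
    have := eLpNorm_smul_measure_of_ne_top (p := ENNReal.ofReal p) ENNReal.ofReal_ne_top
      (fun z : X × X => dist z.1 z.2) (ENNReal.ofReal ε) (μ := α.prod κ')
    rw [ENNReal.toReal_div, ENNReal.toReal_one, ENNReal.toReal_ofReal hp0.le, ENNReal.ofReal_rpow_of_nonneg h0 (by positivity),
      smul_eq_mul] at this
    rw [← this, eLpNorm_eq_lintegral_rpow_enorm_toReal hpn ENNReal.ofReal_ne_top,
      eLpNorm_eq_lintegral_rpow_enorm_toReal hpn ENNReal.ofReal_ne_top,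
      ENNReal.toReal_ofReal hp0.le, lintegral_add_measure, lintegral_smul_measure, hz]
    simp

/-- upper modulus bound: for `1 ≤ p < q`, `M > 0`, and `0 ≤ ε ≤ 0.99`,
`m₊(D_q, ε) ≤ C · M · ε^(1/p - 1/q)` for an absolute constant `C`. -/
theorem upper_modulus_bound :
    ∃ C : ℝ, 0 < C ∧
      ∀ (X : Type) [MetricSpace X] [CompleteSpace X] [TopologicalSpace.SeparableSpace X]
        [MeasurableSpace X] [BorelSpace X] (p q M ε : ℝ),
        1 ≤ p → p < q → 0 < M → 0 ≤ ε → ε ≤ 0.99 →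
        upperMod (X := X) p (Dq q M) ε ≤ ENNReal.ofReal (C * M * ε ^ (1 / p - 1 / q)) := by
  refine ⟨101, by norm_num, ?_⟩
  intro X _ _ _ _ _ p q M ε hp hpq hM h0 h1
  have : SecondCountableTopology X := UniformSpace.secondCountable_of_separable X
  have hp0 : 0 < p := by linarith
  have hq0 : 0 < q := by linarith
  unfold upperMod
  refine iSup_le fun κ => iSup_le fun hκ => iSup_le fun κ' => iSup_le fun hκ' => iSup_le fun hh => ?_
  obtain ⟨_, x, hx⟩ := hκ
  obtain ⟨α, hα, rfl⟩ := hh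
  refine (aux_Wp p ε hp h0 (by linarith) α κ').trans ?_
  rcases h0.eq_or_lt with rfl | hε
  · have : (1 / p) ≠ 0 := by positivity
    rw [Real.zero_rpow this]
    simp
  have hA := aux_marg ε q M (ε ^ (-(1 / q))) hε hq0 (by positivity)
    (by rw [← Real.rpow_add hε]; simp) hM.le α _ _ (Measure.le_add_left le_rfl) hx
  have hq1 : 1 / q ≤ 1 := by rw [div_le_one hq0]; linarith
  have hB := aux_marg (1 - ε) q M 100 (by linarith) hq0 (by positivity)
    (by
      have : (1 - ε) ^ (1 : ℝ) ≤ (1 - ε) ^ (1 / q) :=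
        Real.rpow_le_rpow_of_exponent_ge (by linarith) (by linarith) hq1
      rw [Real.rpow_one] at this
      linarith) hM.le κ' _ _ (Measure.le_add_right le_rfl) hx
  have hone : 1 ≤ ε ^ (-(1 / q)) :=
    Real.one_le_rpow_of_pos_of_le_one_of_nonpos hε (by linarith)
      (by have : 0 < 1 / q := by positivity
          linarith)
  calc _ ≤ ENNReal.ofReal (ε ^ (1 / p)) *
        (ENNReal.ofReal (ε ^ (-(1 / q)) * M) + ENNReal.ofReal (100 * M)) := by
        gcongr
        exact (aux_prod p q hp hpq x α κ').trans (add_le_add hA hB)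
    _ = ENNReal.ofReal (ε ^ (1 / p) * (ε ^ (-(1 / q)) * M + 100 * M)) := by
        rw [← ENNReal.ofReal_add (by positivity) (by positivity),
          ← ENNReal.ofReal_mul (by positivity)]
    _ ≤ _ := by
        apply ENNReal.ofReal_le_ofReal
        rw [sub_eq_add_neg, Real.rpow_add hε]
        have h2 : 0 ≤ ε ^ (1 / p) := by positivity
        have h3 : 0 ≤ (ε ^ (-(1 / q)) - 1) * M := mul_nonneg (by linarith) hM.le
        nlinarith [mul_nonneg h2 h3]

end
end

section
/- Fix p ∈ [1,∞] and 0 ≤ ε ≤ 1/4. For any probability measures μ, ν on a complete separable metric space (X,d) and any contaminated versions μ̃ ∈ B_ε(μ), ν̃ ∈ B_ε(ν), the ε-outlier-robust Wasserstein distance satisfies (1 − 3ε)·W_p^{3ε}(μ,ν) ≤ W_p^{ε}(μ̃,ν̃) ≤ W_p(μ,ν). -/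
open MeasureTheory ENNReal Filter Topology

noncomputable section

variable {X : Type*} [MetricSpace X] [MeasurableSpace X] [BorelSpace X]

lemma exists_sub_lift {Z Y : Type*} [MeasurableSpace Z] [MeasurableSpace Y] (π : Measure Z)
    [IsFiniteMeasure π] (f : Z → Y) (hf : Measurable f) (A : Measure Y) (hA : A ≤ π.map f) :
    ∃ π₁ : Measure Z, π₁ ≤ π ∧ π₁.map f = A := by
  have : IsFiniteMeasure (π.map f) := inferInstance
  have : IsFiniteMeasure A := isFiniteMeasure_of_le _ hA
  have hg := Measure.measurable_rnDeriv A (π.map f)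
  refine ⟨π.withDensity (fun z => A.rnDeriv (π.map f) (f z)), ?_, ?_⟩
  · have h1 := Measure.rnDeriv_le_one_of_le hA
    have h2 : ∀ᵐ z ∂π, A.rnDeriv (π.map f) (f z) ≤ 1 :=
      ae_of_ae_map hf.aemeasurable h1
    calc _ ≤ π.withDensity 1 := withDensity_mono h2
      _ = π := withDensity_one
  · ext s hs
    rw [Measure.map_apply hf hs, withDensity_apply _ (hf hs)]
    conv_rhs => rw [← Measure.withDensity_rnDeriv_eq A (π.map f) hA.absolutelyContinuous]
    rw [withDensity_apply _ hs, setLIntegral_map hs hg hf]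

lemma exists_part {X : Type*} [MeasurableSpace X] (ε : ℝ) (hε0 : 0 ≤ ε) (hε1 : ε ≤ 1 / 4)
    (μ α μ' : Measure X) [IsProbabilityMeasure μ] [IsProbabilityMeasure α]
    (h : μ' ≤ ENNReal.ofReal (1 - ε) • μ + ENNReal.ofReal ε • α)
    (hm : ((ENNReal.ofReal (1 - ε) • μ + ENNReal.ofReal ε • α) - μ') Set.univ
      ≤ ENNReal.ofReal ε) :
    ((μ' Set.univ)⁻¹ • μ') Set.univ = 1 ∧
    ∃ A : Measure X, A ≤ (μ' Set.univ)⁻¹ • μ' ∧ A ≤ μ ∧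
      1 ≤ A Set.univ + ENNReal.ofReal (3 * ε / 2) := by
  have hfa : IsFiniteMeasure (ENNReal.ofReal ε • α) := Measure.smul_finite _ ofReal_ne_top
  have hfm : IsFiniteMeasure (ENNReal.ofReal (1 - ε) • μ) := Measure.smul_finite _ ofReal_ne_top
  have hf' : IsFiniteMeasure μ' := isFiniteMeasure_of_le _ h
  have htot : (ENNReal.ofReal (1 - ε) • μ + ENNReal.ofReal ε • α) Set.univ = 1 := by
    simp only [Measure.add_apply, Measure.smul_apply, measure_univ, smul_eq_mul, mul_one]
    rw [← ENNReal.ofReal_add (by linarith) hε0]; simp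
  rw [Measure.sub_apply MeasurableSet.univ h, htot] at hm
  have hlow : ENNReal.ofReal (1 - ε) ≤ μ' Set.univ := by
    rw [ENNReal.ofReal_sub _ hε0, ENNReal.ofReal_one]
    rw [tsub_le_iff_right] at hm ⊢
    rwa [add_comm]
  have hne : μ' Set.univ ≠ 0 := by
    have : 0 < ENNReal.ofReal (1 - ε) := ENNReal.ofReal_pos.2 (by linarith)
    exact (this.trans_le hlow).ne'
  have hnt : μ' Set.univ ≠ ∞ := measure_ne_top _ _
  have hone : ((μ' Set.univ)⁻¹ • μ') Set.univ = 1 := by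
    simp [ENNReal.inv_mul_cancel hne hnt]
  refine ⟨hone, (μ' Set.univ)⁻¹ • (μ' - ENNReal.ofReal ε • α), ?_, ?_, ?_⟩
  · intro s
    simp only [Measure.smul_apply, smul_eq_mul]
    gcongr
    exact Measure.sub_le
  · have h1 : μ' - ENNReal.ofReal ε • α ≤ ENNReal.ofReal (1 - ε) • μ :=
      Measure.sub_le_of_le_add h
    intro s
    calc _ = (μ' Set.univ)⁻¹ * (μ' - ENNReal.ofReal ε • α) s := rfl
      _ ≤ (μ' Set.univ)⁻¹ * (ENNReal.ofReal (1 - ε) * μ s) := by gcongr; exact h1 s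
      _ ≤ (μ' Set.univ)⁻¹ * (μ' Set.univ * μ s) := by gcongr
      _ = μ s := by rw [← mul_assoc, ENNReal.inv_mul_cancel hne hnt, one_mul]
  · have h2 : μ' ≤ (μ' - ENNReal.ofReal ε • α) + ENNReal.ofReal ε • α :=
      Measure.sub_le_iff_le_add.1 le_rfl
    have h3 : μ' Set.univ ≤ (μ' - ENNReal.ofReal ε • α) Set.univ + ENNReal.ofReal ε := by
      simpa using h2 Set.univ
    have h4 : (μ' Set.univ)⁻¹ * ENNReal.ofReal ε ≤ ENNReal.ofReal (3 * ε / 2) := by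
      rw [ENNReal.inv_mul_le_iff hne hnt]
      calc ENNReal.ofReal ε ≤ ENNReal.ofReal ((1 - ε) * (3 * ε / 2)) := by
            apply ENNReal.ofReal_le_ofReal; nlinarith
        _ = ENNReal.ofReal (1 - ε) * ENNReal.ofReal (3 * ε / 2) :=
            ENNReal.ofReal_mul (by linarith)
        _ ≤ _ := by gcongr
    calc (1 : ℝ≥0∞) = (μ' Set.univ)⁻¹ * μ' Set.univ := (ENNReal.inv_mul_cancel hne hnt).symm
      _ ≤ (μ' Set.univ)⁻¹ * ((μ' - ENNReal.ofReal ε • α) Set.univ + ENNReal.ofReal ε) := by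
        gcongr
      _ = (μ' Set.univ)⁻¹ * (μ' - ENNReal.ofReal ε • α) Set.univ
          + (μ' Set.univ)⁻¹ * ENNReal.ofReal ε := mul_add _ _ _
      _ ≤ _ := by gcongr; exact le_of_eq rfl

lemma deficit {X : Type*} [MeasurableSpace X] (δ : ℝ) (hδ : 0 ≤ δ) (μ μ' : Measure X)
    [IsProbabilityMeasure μ] (h : μ' ≤ μ) (hm : 1 ≤ μ' Set.univ + ENNReal.ofReal δ) :
    (μ - μ') Set.univ ≤ ENNReal.ofReal δ := by
  have hf' : IsFiniteMeasure μ' := isFiniteMeasure_of_le _ h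
  rw [Measure.sub_apply MeasurableSet.univ h, measure_univ, tsub_le_iff_right, add_comm]
  exact hm

/-- sandwich bound under Huber contamination: for `p ∈ [1,∞]` and
`0 ≤ ε ≤ 1/4`, if `μ̃ ∈ B_ε(μ)` and `ν̃ ∈ B_ε(ν)` then
`(1 - 3ε)·W_p^{3ε}(μ,ν) ≤ W_p^ε(μ̃,ν̃) ≤ W_p(μ,ν)`. -/
theorem robust_Wp_sandwich {X : Type*} [MetricSpace X] [CompleteSpace X]
    [TopologicalSpace.SeparableSpace X] [MeasurableSpace X] [BorelSpace X]
    (p : ℝ≥0∞) (hp : 1 ≤ p) (ε : ℝ) (hε0 : 0 ≤ ε) (hε1 : ε ≤ 1 / 4)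
    (μ ν : Measure X) [IsProbabilityMeasure μ] [IsProbabilityMeasure ν]
    (μt νt : Measure X) (hμt : μt ∈ huberBall ε μ) (hνt : νt ∈ huberBall ε ν) :
    ENNReal.ofReal (1 - 3 * ε) * RWp p (3 * ε) μ ν ≤ RWp p ε μt νt ∧
    RWp p ε μt νt ≤ Wp p μ ν := by
  obtain ⟨α, hα, rfl⟩ := hμt
  obtain ⟨β, hβ, rfl⟩ := hνt
  have key : ∀ (μ α : Measure X) [IsProbabilityMeasure μ] [IsProbabilityMeasure α],
      ENNReal.ofReal (1 - ε) • μ ≤ ENNReal.ofReal (1 - ε) • μ + ENNReal.ofReal ε • α ∧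
      ((ENNReal.ofReal (1 - ε) • μ + ENNReal.ofReal ε • α) - ENNReal.ofReal (1 - ε) • μ) Set.univ
        ≤ ENNReal.ofReal ε ∧
      ((ENNReal.ofReal (1 - ε) • μ) Set.univ)⁻¹ • (ENNReal.ofReal (1 - ε) • μ) = μ := by
    intro μ α _ _
    refine ⟨Measure.le_add_right le_rfl, ?_, ?_⟩
    · have h : (ENNReal.ofReal (1 - ε) • μ + ENNReal.ofReal ε • α)
          - ENNReal.ofReal (1 - ε) • μ ≤ ENNReal.ofReal ε • α :=
        Measure.sub_le_of_le_add (by rw [add_comm])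
      simpa using h Set.univ
    · have h0 : ENNReal.ofReal (1 - ε) ≠ 0 := (ENNReal.ofReal_pos.2 (by linarith)).ne'
      simp only [Measure.smul_apply, measure_univ, smul_eq_mul, mul_one, smul_smul]
      rw [ENNReal.inv_mul_cancel h0 ofReal_ne_top, one_smul]
  constructor
  · unfold RWp
    refine le_iInf fun μ' => le_iInf fun ν' => le_iInf fun hμ' => le_iInf fun hν' =>
      le_iInf fun hmμ => le_iInf fun hmν => ?_
    obtain ⟨hP, A, hAP, hAμ, hAm⟩ := exists_part ε hε0 hε1 μ α μ' hμ' hmμ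
    obtain ⟨hQ, B, hBQ, hBν, hBm⟩ := exists_part ε hε0 hε1 ν β ν' hν' hmν
    refine le_iInf₂ fun π hπ => ?_
    obtain ⟨hπ1, hπ2⟩ := hπ
    have hπu : π Set.univ = 1 := by
      rw [← hP, ← hπ1, Measure.map_apply measurable_fst MeasurableSet.univ, Set.preimage_univ]
    have : IsProbabilityMeasure π := ⟨hπu⟩
    obtain ⟨π₁, hπ₁, hπ₁A⟩ := exists_sub_lift π Prod.fst measurable_fst A (hπ1 ▸ hAP)
    obtain ⟨π₂, hπ₂, hπ₂B⟩ := exists_sub_lift π Prod.snd measurable_snd B (hπ2 ▸ hBQ)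
    have : IsFiniteMeasure π₁ := isFiniteMeasure_of_le _ hπ₁
    have : IsFiniteMeasure π₂ := isFiniteMeasure_of_le _ hπ₂
    have hu₁ : π₁ Set.univ = A Set.univ := by
      rw [← hπ₁A, Measure.map_apply measurable_fst MeasurableSet.univ, Set.preimage_univ]
    have hu₂ : π₂ Set.univ = B Set.univ := by
      rw [← hπ₂B, Measure.map_apply measurable_snd MeasurableSet.univ, Set.preimage_univ]
    obtain ⟨ρ, hρdef⟩ : ∃ ρ, ρ = π₁ - (π - π₂) := ⟨_, rfl⟩
    have hρ₁ : ρ ≤ π₁ := hρdef ▸ Measure.sub_le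
    have hρ₂ : ρ ≤ π₂ := by
      rw [hρdef]
      apply Measure.sub_le_of_le_add
      rw [add_comm, Measure.sub_add_cancel_of_le hπ₂]
      exact hπ₁
    have hρπ : ρ ≤ π := hρ₁.trans hπ₁
    have hρm : 1 ≤ ρ Set.univ + ENNReal.ofReal (3 * ε) := by
      have h1 : π₁ ≤ ρ + (π - π₂) := by
        rw [hρdef]; exact Measure.sub_le_iff_le_add.1 le_rfl
      have h2 : (π - π₂) Set.univ ≤ ENNReal.ofReal (3 * ε / 2) :=
        deficit _ (by positivity) π π₂ hπ₂ (by rw [hu₂]; exact hBm)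
      calc (1 : ℝ≥0∞) ≤ π₁ Set.univ + ENNReal.ofReal (3 * ε / 2) := by rw [hu₁]; exact hAm
        _ ≤ (ρ Set.univ + ENNReal.ofReal (3 * ε / 2)) + ENNReal.ofReal (3 * ε / 2) := by
            gcongr
            exact (h1 Set.univ).trans (by rw [Measure.add_apply]; gcongr)
        _ = _ := by
            rw [add_assoc, ← ENNReal.ofReal_add (by positivity) (by positivity)]
            congr 2; ring
    have hM1 : ρ Set.univ ≤ 1 := hπu ▸ hρπ Set.univ
    have hMlow : ENNReal.ofReal (1 - 3 * ε) ≤ ρ Set.univ := by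
      rw [ENNReal.ofReal_sub _ (by positivity), ENNReal.ofReal_one, tsub_le_iff_right]
      exact hρm
    have hM0 : ρ Set.univ ≠ 0 :=
      ((ENNReal.ofReal_pos.2 (by linarith : (0:ℝ) < 1 - 3 * ε)).trans_le hMlow).ne'
    have hMt : ρ Set.univ ≠ ∞ := (hM1.trans_lt one_lt_top).ne
    have hua : (ρ.map Prod.fst) Set.univ = ρ Set.univ := by
      rw [Measure.map_apply measurable_fst MeasurableSet.univ, Set.preimage_univ]
    have hub : (ρ.map Prod.snd) Set.univ = ρ Set.univ := by
      rw [Measure.map_apply measurable_snd MeasurableSet.univ, Set.preimage_univ]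
    have ha : ρ.map Prod.fst ≤ μ := by
      refine le_trans ?_ hAμ
      rw [← hπ₁A]; exact Measure.map_mono hρ₁ measurable_fst
    have hb : ρ.map Prod.snd ≤ ν := by
      refine le_trans ?_ hBν
      rw [← hπ₂B]; exact Measure.map_mono hρ₂ measurable_snd
    have hR : RWp p (3 * ε) μ ν ≤
        eLpNorm (fun z : X × X => dist z.1 z.2) p ((ρ Set.univ)⁻¹ • ρ) := by
      refine (iInf_le_of_le (ρ.map Prod.fst) <| iInf_le_of_le (ρ.map Prod.snd) <|
        iInf_le_of_le ha <| iInf_le_of_le hb <|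
        iInf_le_of_le (deficit _ (by positivity) _ _ ha (by rw [hua]; exact hρm)) <|
        iInf_le_of_le (deficit _ (by positivity) _ _ hb (by rw [hub]; exact hρm)) le_rfl).trans ?_
      rw [hua, hub]
      exact iInf₂_le _ ⟨by rw [Measure.map_smul], by rw [Measure.map_smul]⟩
    have hinv : (1 : ℝ≥0∞) ≤ (ρ Set.univ)⁻¹ := ENNReal.one_le_inv.2 hM1
    have hexp : (1 / p).toReal ≤ 1 := by
      have : 1 / p ≤ 1 := by rw [one_div]; exact ENNReal.inv_le_one.2 hp
      simpa using ENNReal.toReal_mono one_ne_top this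
    calc ENNReal.ofReal (1 - 3 * ε) * RWp p (3 * ε) μ ν
        ≤ ρ Set.univ * eLpNorm (fun z : X × X => dist z.1 z.2) p ((ρ Set.univ)⁻¹ • ρ) := by
          gcongr
      _ = ρ Set.univ * ((ρ Set.univ)⁻¹ ^ (1 / p).toReal *
            eLpNorm (fun z : X × X => dist z.1 z.2) p ρ) := by
          rw [eLpNorm_smul_measure_of_ne_zero (ENNReal.inv_ne_zero.2 hMt), smul_eq_mul]
      _ ≤ ρ Set.univ * ((ρ Set.univ)⁻¹ ^ (1 : ℝ) *
            eLpNorm (fun z : X × X => dist z.1 z.2) p π) := by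
          gcongr
      _ = _ := by
          rw [ENNReal.rpow_one, ← mul_assoc, ENNReal.mul_inv_cancel hM0 hMt, one_mul]
  · obtain ⟨h1, h2, h3⟩ := key μ α
    obtain ⟨k1, k2, k3⟩ := key ν β
    refine iInf_le_of_le _ <| iInf_le_of_le _ <| iInf_le_of_le h1 <| iInf_le_of_le k1 <|
      iInf_le_of_le h2 <| iInf_le_of_le k2 ?_
    rw [h3, k3]

end
end

section
/- Fix p ∈ [1,∞), q > p, M > 0, and 0 ≤ ε ≤ 0.33, and let D_q be the family of probability measures μ on a complete separable metric space (X,d) with ‖d(·,x)‖_{L^q(μ)} ≤ M for some x ∈ X. Then for any μ, ν ∈ D_q with corrupted versions μ̃ ∈ B_ε(μ), ν̃ ∈ B_ε(ν), we have |W_p^ε(μ̃,ν̃) − W_p(μ,ν)| ≤ [1 − (1−3ε)^{1/p}]·W_p(μ,ν) + C·M·ε^{1/p − 1/q} for an absolute constant C. -/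
open MeasureTheory ENNReal Filter Topology

noncomputable section

variable {X : Type*} [MetricSpace X] [MeasurableSpace X] [BorelSpace X]

lemma rdr_real {p q M ε A W D r s : ℝ} (hp : 1 ≤ p) (hpq : p < q) (hM : 0 < M) (hε0 : 0 ≤ ε)
    (hε : ε ≤ 0.33) (hA : 0 ≤ A) (hW : 0 ≤ W) (hD : 0 ≤ D) (hr : 0 ≤ r) (hs : 0 ≤ s)
    (hrs : s + r = 1) (hr3 : r ≤ 3 * ε)
    (H1 : W ^ p ≤ A ^ p + (2 * M * r ^ (1 / p - 1 / q) + D * r ^ (1 / p)) ^ p)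
    (H2 : D ≤ W + 2 * M) (H3 : D * s ^ (1 / p) ≤ A + 2 * M) (H4 : W ≤ D + 2 * M) :
    (1 - 3 * ε) ^ (1 / p) * W ≤ A + 48 * M * ε ^ (1 / p - 1 / q) := by
  have hp0 : 0 < p := by linarith
  have hq0 : 0 < q := by linarith
  have hip : 0 < 1 / p := by positivity
  have hip1 : 1 / p ≤ 1 := by rw [div_le_one hp0]; exact hp
  have hiq : 0 < 1 / q := by positivity
  have hipq : 0 < 1 / p - 1 / q := by
    have := one_div_lt_one_div_of_lt hp0 hpq
    linarith
  set θ := 1 / p - 1 / q with hθ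
  have hE0 : 0 ≤ ε ^ θ := Real.rpow_nonneg hε0 _
  have hr1 : r ≤ 1 := by linarith
  have hs1 : s ≤ 1 := by linarith
  have hε1 : ε ≤ 1 := by norm_num at hε ⊢; linarith
  have h3ε : 0 ≤ 1 - 3 * ε := by norm_num at hε ⊢; linarith
  have hLs : (1 - 3 * ε) ^ (1 / p) ≤ s ^ (1 / p) := Real.rpow_le_rpow h3ε (by linarith) hip.le
  have hs01 : s ^ (1 / p) ≤ 1 := Real.rpow_le_one hs hs1 hip.le
  have hs00 : 0 ≤ s ^ (1 / p) := Real.rpow_nonneg hs _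
  have hr00 : 0 ≤ r ^ (1 / p) := Real.rpow_nonneg hr _
  have hL0 : 0 ≤ (1 - 3 * ε) ^ (1 / p) := Real.rpow_nonneg h3ε _
  have hrθ : r ^ θ ≤ 3 * ε ^ θ := by
    calc r ^ θ ≤ (3 * ε) ^ θ := Real.rpow_le_rpow hr hr3 hipq.le
      _ = 3 ^ θ * ε ^ θ := Real.mul_rpow (by norm_num) hε0
      _ ≤ 3 * ε ^ θ := by
        gcongr
        calc (3 : ℝ) ^ θ ≤ 3 ^ (1 : ℝ) := Real.rpow_le_rpow_of_exponent_le (by norm_num) (by linarith)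
          _ = 3 := by simp
  have hrp : r ^ (1 / p) ≤ 3 * ε ^ (1 / p) := by
    calc r ^ (1 / p) ≤ (3 * ε) ^ (1 / p) := Real.rpow_le_rpow hr hr3 hip.le
      _ = 3 ^ (1 / p) * ε ^ (1 / p) := Real.mul_rpow (by norm_num) hε0
      _ ≤ 3 * ε ^ (1 / p) := by
        gcongr
        calc (3 : ℝ) ^ (1 / p) ≤ 3 ^ (1 : ℝ) := Real.rpow_le_rpow_of_exponent_le (by norm_num) (by linarith)
          _ = 3 := by simp
  have hrr : r ^ (1 / p) ≤ r ^ θ := by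
    rcases hr.eq_or_lt with h | h
    · rw [← h, Real.zero_rpow hip.ne', Real.zero_rpow hipq.ne']
    · exact Real.rpow_le_rpow_of_exponent_ge h hr1 (by linarith)
  rcases le_or_gt (1 / 12) (ε ^ (1 / p)) with hc | hc
  · have hεpos : 0 < ε := by
      rcases hε0.eq_or_lt with h | h
      · rw [← h, Real.zero_rpow hip.ne'] at hc; norm_num at hc
      · exact h
    have : ε ^ (1 / p) ≤ ε ^ θ := Real.rpow_le_rpow_of_exponent_ge hεpos hε1 (by linarith)
    have h1 : (1 - 3 * ε) ^ (1 / p) * W ≤ s ^ (1 / p) * (D + 2 * M) := by gcongr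
    have h2 : s ^ (1 / p) * M ≤ 1 * M := by gcongr
    have h3 : M * (1 / 12) ≤ M * ε ^ θ := by gcongr; linarith
    nlinarith
  · -- small case
    set a := 12 * M * ε ^ θ with ha
    set b := r ^ (1 / p) * W with hb
    have ha0 : 0 ≤ a := by positivity
    have hb0 : 0 ≤ b := by positivity
    have hab : 2 * M * r ^ θ + D * r ^ (1 / p) ≤ a + b := by
      have h1 : D * r ^ (1 / p) ≤ (W + 2 * M) * r ^ (1 / p) := by gcongr
      have h2 : M * r ^ (1 / p) ≤ M * r ^ θ := by gcongr
      have h3 : M * r ^ θ ≤ M * (3 * ε ^ θ) := by gcongr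
      nlinarith
    have hW1 : W ^ p ≤ A ^ p + (a + b) ^ p := by
      refine H1.trans ?_
      gcongr
    have hbp : b ^ p = r * W ^ p := by
      rw [hb, Real.mul_rpow hr00 hW, ← Real.rpow_mul hr, one_div_mul_cancel hp0.ne', Real.rpow_one]
    have hSp : (s ^ (1 / p) * W) ^ p = s * W ^ p := by
      rw [Real.mul_rpow hs00 hW, ← Real.rpow_mul hs, one_div_mul_cancel hp0.ne', Real.rpow_one]
    have hsplit : s * W ^ p + r * W ^ p = W ^ p := by rw [← add_mul, hrs, one_mul]
    rcases le_or_gt b A with hbA | hbA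
    · have key : A ^ p + (a + b) ^ p ≤ (A + a) ^ p + b ^ p := by
        have hconv := convexOn_rpow hp
        rcases eq_or_lt_of_le (show b ≤ A + a by linarith) with h | h
        · have : a = 0 := by linarith
          rw [show a + b = b by linarith, show A + a = b by linarith, show A = b by linarith]
        · have hd : 0 < A + a - b := by linarith
          have e1 : (a / (A + a - b)) + ((A - b) / (A + a - b)) = 1 := by
            field_simp; ring
          have n1 : 0 ≤ a / (A + a - b) := by positivity
          have n2 : 0 ≤ (A - b) / (A + a - b) := div_nonneg (by linarith) hd.le
          have mA : A + a ∈ Set.Ici (0:ℝ) := by simp; linarith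
          have mb : b ∈ Set.Ici (0:ℝ) := hb0
          have c1 := hconv.2 mA mb n1 n2 e1
          have c2 := hconv.2 mb mA n1 n2 e1
          have v1 : (a / (A + a - b)) • (A + a) + ((A - b) / (A + a - b)) • b = a + b := by
            simp only [smul_eq_mul]; field_simp; ring
          have v2 : (a / (A + a - b)) • b + ((A - b) / (A + a - b)) • (A + a) = A := by
            simp only [smul_eq_mul]; field_simp; ring
          rw [v1] at c1; rw [v2] at c2
          simp only [smul_eq_mul] at c1 c2
          calc A ^ p + (a + b) ^ p ≤ _ := add_le_add c2 c1
            _ = ((a / (A + a - b)) + ((A - b) / (A + a - b))) * ((A + a) ^ p + b ^ p) := by ring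
            _ = _ := by rw [e1, one_mul]
      have : (s ^ (1 / p) * W) ^ p ≤ (A + a) ^ p := by rw [hSp]; linarith
      have := (Real.rpow_le_rpow_iff (by positivity) (by positivity) hp0).1 this
      have h2 : (1 - 3 * ε) ^ (1 / p) * W ≤ s ^ (1 / p) * W := by gcongr
      have : 0 ≤ M * ε ^ θ := by positivity
      linarith
    · have hAb : A ^ p ≤ b ^ p := Real.rpow_le_rpow hA hbA.le hp0.le
      have : (s ^ (1 / p) * W) ^ p ≤ (a + b) ^ p := by rw [hSp]; linarith
      have h1 := (Real.rpow_le_rpow_iff (by positivity) (by positivity) hp0).1 this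
      have hεp : ε ≤ ε ^ (1 / p) := by
        rcases hε0.eq_or_lt with h | h
        · rw [← h, Real.zero_rpow hip.ne']
        · calc ε = ε ^ (1 : ℝ) := by simp
            _ ≤ _ := Real.rpow_le_rpow_of_exponent_ge h hε1 hip1
      have hsp : s ≤ s ^ (1 / p) := by
        rcases hs.eq_or_lt with h | h
        · rw [← h, Real.zero_rpow hip.ne']
        · calc s = s ^ (1 : ℝ) := by simp
            _ ≤ _ := Real.rpow_le_rpow_of_exponent_ge h hs1 hip1
      have h3 : 3 / 4 * W ≤ s ^ (1 / p) * W := by gcongr; linarith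
      have h4 : b ≤ 1 / 4 * W := by rw [hb]; gcongr; linarith
      have h5 : (1 - 3 * ε) ^ (1 / p) * W ≤ 1 * W := by gcongr; linarith
      have : 0 ≤ M * ε ^ θ := by positivity
      linarith

lemma rdr_split {Y : Type*} [MeasurableSpace Y] (κ a : Measure Y) [IsFiniteMeasure κ]
    (h : a ≤ κ) : ∃ g : Y → ℝ≥0∞, Measurable g ∧ (∀ y, g y ≤ 1) ∧ κ.withDensity g = a := by
  have : IsFiniteMeasure a := isFiniteMeasure_of_le κ h
  refine ⟨fun y => min (a.rnDeriv κ y) 1, (Measure.measurable_rnDeriv a κ).min measurable_const,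
    fun y => min_le_right _ _, ?_⟩
  rw [← Measure.withDensity_rnDeriv_eq a κ (Measure.absolutelyContinuous_of_le h)]
  have h1 : a.rnDeriv κ ≤ᵐ[κ] 1 := Measure.rnDeriv_le_one_of_le h
  rw [Measure.withDensity_rnDeriv_eq a κ (Measure.absolutelyContinuous_of_le h)]
  conv_rhs => rw [← Measure.withDensity_rnDeriv_eq a κ (Measure.absolutelyContinuous_of_le h)]
  apply withDensity_congr_ae
  filter_upwards [h1] with y hy
  exact min_eq_left hy

lemma rdr_wd_mono {Y : Type*} [MeasurableSpace Y] {κ a : Measure Y} (h : a ≤ κ) (g : Y → ℝ≥0∞) :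
    a.withDensity g ≤ κ.withDensity g := by
  refine Measure.le_iff.2 fun s hs => ?_
  rw [withDensity_apply _ hs, withDensity_apply _ hs]
  exact lintegral_mono' (Measure.restrict_mono le_rfl h) le_rfl

lemma rdr_side (μ μt μ' : Measure X) [IsProbabilityMeasure μ] {ε : ℝ} (hε0 : 0 ≤ ε)
    (hε : ε ≤ 0.33) (hμt : ∃ α : Measure X, IsProbabilityMeasure α ∧
    μt = ENNReal.ofReal (1 - ε) • μ + ENNReal.ofReal ε • α) (hle : μ' ≤ μt)
    (hm : (μt - μ') Set.univ ≤ ENNReal.ofReal ε) :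
    (μ' Set.univ ≠ 0 ∧ μ' Set.univ ≠ ∞) ∧ ∃ g : X → ℝ≥0∞, Measurable g ∧ (∀ y, g y ≤ 1) ∧
      ((μ' Set.univ)⁻¹ • μ').withDensity g ≤ μ ∧
      ∫⁻ y, (1 - g y) ∂((μ' Set.univ)⁻¹ • μ') ≤ ENNReal.ofReal (3 / 2 * ε) := by
  obtain ⟨α, hα, rfl⟩ := hμt
  have hε' : ε ≤ 1 / 3 := by norm_num at hε ⊢; linarith
  set κ := ENNReal.ofReal (1 - ε) • μ + ENNReal.ofReal ε • α with hκ
  have hκ1 : κ Set.univ = 1 := by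
    simp only [hκ, Measure.add_apply, Measure.smul_apply, measure_univ, smul_eq_mul, mul_one]
    rw [← ENNReal.ofReal_add (by linarith) hε0]; simp
  have : IsFiniteMeasure κ := ⟨by rw [hκ1]; simp⟩
  have : IsFiniteMeasure μ' := isFiniteMeasure_of_le κ hle
  have hmass : ENNReal.ofReal (1 - ε) ≤ μ' Set.univ := by
    rw [Measure.sub_apply MeasurableSet.univ hle, hκ1, tsub_le_iff_right] at hm
    rw [ENNReal.ofReal_sub _ hε0, ENNReal.ofReal_one, tsub_le_iff_left]
    exact hm
  have hpos : 0 < ENNReal.ofReal (1 - ε) := by rw [ENNReal.ofReal_pos]; linarith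
  have hne0 : μ' Set.univ ≠ 0 := (hpos.trans_le hmass).ne'
  have hinv : (μ' Set.univ)⁻¹ ≤ (ENNReal.ofReal (1 - ε))⁻¹ := ENNReal.inv_le_inv.2 hmass
  refine ⟨⟨hne0, measure_ne_top _ _⟩, ?_⟩
  obtain ⟨g, hg, hg1, hgκ⟩ := rdr_split κ (ENNReal.ofReal (1 - ε) • μ) (Measure.le_add_right le_rfl)
  refine ⟨g, hg, hg1, ?_, ?_⟩
  · rw [withDensity_smul_measure]
    refine Measure.le_iff.2 fun s hs => ?_
    have h1 : μ'.withDensity g s ≤ ENNReal.ofReal (1 - ε) * μ s := by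
      have := rdr_wd_mono hle g s
      rwa [hgκ] at this
    rw [Measure.smul_apply, smul_eq_mul]
    calc (μ' Set.univ)⁻¹ * μ'.withDensity g s
        ≤ (ENNReal.ofReal (1 - ε))⁻¹ * (ENNReal.ofReal (1 - ε) * μ s) := by gcongr
      _ = μ s := by
        rw [← mul_assoc, ENNReal.inv_mul_cancel hpos.ne' ENNReal.ofReal_ne_top, one_mul]
  · rw [lintegral_smul_measure, smul_eq_mul]
    have h2 : ∫⁻ y, (1 - g y) ∂κ = ENNReal.ofReal ε := by
      have hgi : ∫⁻ y, g y ∂κ = ENNReal.ofReal (1 - ε) := by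
        have := congrArg (fun m : Measure X => m Set.univ) hgκ
        simpa [withDensity_apply] using this
      rw [lintegral_sub hg (by rw [hgi]; exact ENNReal.ofReal_ne_top) (Eventually.of_forall hg1),
        hgi, lintegral_one, hκ1, ← ENNReal.ofReal_one, ← ENNReal.ofReal_sub _ (by linarith)]
      congr 1; ring
    calc (μ' Set.univ)⁻¹ * ∫⁻ y, (1 - g y) ∂μ'
        ≤ (ENNReal.ofReal (1 - ε))⁻¹ * ∫⁻ y, (1 - g y) ∂κ := by
          gcongr
      _ = ENNReal.ofReal ((1 - ε)⁻¹ * ε) := by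
          rw [h2, ENNReal.ofReal_mul (by rw [inv_nonneg]; linarith), ENNReal.ofReal_inv_of_pos (by linarith)]
      _ ≤ _ := by
          apply ENNReal.ofReal_le_ofReal
          gcongr
          rw [inv_le_comm₀ (by linarith) (by norm_num)]
          norm_num; linarith

lemma rdr_sub (μ ν μ' ν' : Measure X) (π : Measure (X × X)) [IsProbabilityMeasure π]
    {ε : ℝ} (hε0 : 0 ≤ ε)
    (h1 : π.map Prod.fst = μ') (h2 : π.map Prod.snd = ν') {g h : X → ℝ≥0∞}
    (hg : Measurable g) (hg1 : ∀ y, g y ≤ 1) (hgμ : μ'.withDensity g ≤ μ)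
    (hgi : ∫⁻ y, (1 - g y) ∂μ' ≤ ENNReal.ofReal (3 / 2 * ε))
    (hh : Measurable h) (hh1 : ∀ y, h y ≤ 1) (hhν : ν'.withDensity h ≤ ν)
    (hhi : ∫⁻ y, (1 - h y) ∂ν' ≤ ENNReal.ofReal (3 / 2 * ε)) :
    ∃ σ : Measure (X × X), σ ≤ π ∧ σ.map Prod.fst ≤ μ ∧ σ.map Prod.snd ≤ ν ∧
      1 ≤ σ Set.univ + ENNReal.ofReal (3 * ε) := by
  have hgm : Measurable fun z : X × X => g z.1 := hg.comp measurable_fst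
  have hhm : Measurable fun z : X × X => h z.2 := hh.comp measurable_snd
  refine ⟨π.withDensity fun z => g z.1 * h z.2, ?_, ?_, ?_, ?_⟩
  · conv_rhs => rw [← withDensity_one (μ := π)]
    exact withDensity_mono (Eventually.of_forall fun z => mul_le_one' (hg1 _) (hh1 _))
  · refine le_trans (Measure.le_iff.2 fun s hs => ?_) hgμ
    rw [Measure.map_apply measurable_fst hs, withDensity_apply _ (measurable_fst hs),
      withDensity_apply _ hs, ← h1, setLIntegral_map hs hg measurable_fst]
    exact lintegral_mono fun z => mul_le_of_le_one_right' (hh1 _)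
  · refine le_trans (Measure.le_iff.2 fun s hs => ?_) hhν
    rw [Measure.map_apply measurable_snd hs, withDensity_apply _ (measurable_snd hs),
      withDensity_apply _ hs, ← h2, setLIntegral_map hs hh measurable_snd]
    exact lintegral_mono fun z => mul_le_of_le_one_left' (hg1 _)
  · rw [withDensity_apply _ MeasurableSet.univ, Measure.restrict_univ]
    rw [← h1, lintegral_map (f := fun y => 1 - g y) (measurable_const.sub hg) measurable_fst] at hgi
    rw [← h2, lintegral_map (f := fun y => 1 - h y) (measurable_const.sub hh) measurable_snd] at hhi
    have hpt : ∀ z : X × X, 1 ≤ g z.1 * h z.2 + ((1 - g z.1) + (1 - h z.2)) := by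
      intro z
      have a1 := hg1 z.1
      have a2 := hh1 z.2
      lift g z.1 to NNReal using ne_top_of_le_ne_top ENNReal.one_ne_top a1 with x
      lift h z.2 to NNReal using ne_top_of_le_ne_top ENNReal.one_ne_top a2 with y
      norm_cast at a1 a2 ⊢
      rw [← NNReal.coe_le_coe]
      push_cast [NNReal.coe_sub a1, NNReal.coe_sub a2]
      have b1 : (x : ℝ) ≤ 1 := a1
      have b2 : (y : ℝ) ≤ 1 := a2
      nlinarith [mul_nonneg (sub_nonneg.2 b1) (sub_nonneg.2 b2)]
    calc (1 : ℝ≥0∞) = ∫⁻ z, 1 ∂π := by simp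
      _ ≤ ∫⁻ z, (g z.1 * h z.2 + ((1 - g z.1) + (1 - h z.2))) ∂π := lintegral_mono hpt
      _ = ∫⁻ z, g z.1 * h z.2 ∂π + (∫⁻ z, (1 - g z.1) ∂π + ∫⁻ z, (1 - h z.2) ∂π) := by
        rw [lintegral_add_left (f := fun z : X × X => g z.1 * h z.2) (hgm.mul hhm),
          lintegral_add_left (f := fun z : X × X => 1 - g z.1) (measurable_const.sub hgm)]
      _ ≤ _ := by
        gcongr
        refine (add_le_add hgi hhi).trans ?_
        rw [← ENNReal.ofReal_add (by positivity) (by positivity)]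
        apply ENNReal.ofReal_le_ofReal; linarith

lemma rdr_elp_add {Y : Type*} [MeasurableSpace Y] (f : Y → ℝ) (σ ρ : Measure Y) {p : ℝ}
    (hp : 0 < p) : (eLpNorm f (ENNReal.ofReal p) (σ + ρ)) ^ p =
      (eLpNorm f (ENNReal.ofReal p) σ) ^ p + (eLpNorm f (ENNReal.ofReal p) ρ) ^ p := by
  have h0 : ENNReal.ofReal p ≠ 0 := by simpa using hp
  simp only [eLpNorm_eq_lintegral_rpow_enorm_toReal h0 ENNReal.ofReal_ne_top,
    ENNReal.toReal_ofReal hp.le, ← ENNReal.rpow_mul, one_div_mul_cancel hp.ne', ENNReal.rpow_one,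
    lintegral_add_measure]

lemma rdr_tri [SecondCountableTopology X] (σ : Measure (X × X)) {p : ℝ} (hp : 1 ≤ p) (x y : X) :
    eLpNorm (fun z : X × X => dist z.1 z.2) (ENNReal.ofReal p) σ ≤
      eLpNorm (fun w => dist w x) (ENNReal.ofReal p) (σ.map Prod.fst) +
      ENNReal.ofReal (dist x y) * σ Set.univ ^ (1 / p) +
      eLpNorm (fun w => dist w y) (ENNReal.ofReal p) (σ.map Prod.snd) ∧
    ENNReal.ofReal (dist x y) * σ Set.univ ^ (1 / p) ≤
      eLpNorm (fun w => dist w x) (ENNReal.ofReal p) (σ.map Prod.fst) +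
      eLpNorm (fun z : X × X => dist z.1 z.2) (ENNReal.ofReal p) σ +
      eLpNorm (fun w => dist w y) (ENNReal.ofReal p) (σ.map Prod.snd) := by
  have hp0 : 0 < p := by linarith
  have h0 : ENNReal.ofReal p ≠ 0 := by simpa using hp0
  have h1 : 1 ≤ ENNReal.ofReal p := by simpa using hp
  have mx : ∀ x : X, Measurable fun w : X => dist w x := fun x => measurable_id.dist measurable_const
  have m1 : AEStronglyMeasurable (fun z : X × X => dist z.1 x) σ :=
    ((mx x).comp measurable_fst).aestronglyMeasurable
  have m2 : AEStronglyMeasurable (fun z : X × X => dist z.2 y) σ :=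
    ((mx y).comp measurable_snd).aestronglyMeasurable
  have m3 : AEStronglyMeasurable (fun z : X × X => dist z.1 z.2) σ :=
    measurable_dist.aestronglyMeasurable
  have m4 : AEStronglyMeasurable (fun _ : X × X => dist x y) σ := aestronglyMeasurable_const
  have hc : eLpNorm (fun _ : X × X => dist x y) (ENNReal.ofReal p) σ =
      ENNReal.ofReal (dist x y) * σ Set.univ ^ (1 / p) := by
    rw [eLpNorm_const' _ h0 ENNReal.ofReal_ne_top, ENNReal.toReal_ofReal hp0.le,
      Real.enorm_of_nonneg dist_nonneg]
  rw [eLpNorm_map_measure (mx x).aestronglyMeasurable measurable_fst.aemeasurable,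
    eLpNorm_map_measure (mx y).aestronglyMeasurable measurable_snd.aemeasurable, ← hc]
  constructor
  · refine le_trans ?_ ((eLpNorm_add_le (m1.add m4) m2 h1).trans
      (add_le_add (eLpNorm_add_le m1 m4 h1) le_rfl))
    refine eLpNorm_mono_real fun z => ?_
    rw [Real.norm_of_nonneg dist_nonneg]
    simp only [Pi.add_apply]
    have := dist_triangle4 z.1 x y z.2
    rw [dist_comm y z.2] at this
    exact this
  · refine le_trans ?_ ((eLpNorm_add_le (m1.add m3) m2 h1).trans
      (add_le_add (eLpNorm_add_le m1 m3 h1) le_rfl))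
    refine eLpNorm_mono_real fun z => ?_
    rw [Real.norm_of_nonneg dist_nonneg]
    simp only [Pi.add_apply]
    have := dist_triangle4 x z.1 z.2 y
    rw [dist_comm x z.1] at this
    exact this


lemma rdr_wp_rpow_le [SecondCountableTopology X] (μ ν : Measure X) {p : ℝ} (hp : 1 ≤ p)
    {x y : X} {K : ℝ≥0∞}
    (hx : eLpNorm (fun w => dist w x) (ENNReal.ofReal p) μ ≤ K)
    (hy : eLpNorm (fun w => dist w y) (ENNReal.ofReal p) ν ≤ K)
    (τ : Measure (X × X)) (h1 : τ.map Prod.fst ≤ μ) (h2 : τ.map Prod.snd ≤ ν) :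
    eLpNorm (fun z : X × X => dist z.1 z.2) (ENNReal.ofReal p) τ ≤
      K + ENNReal.ofReal (dist x y) * τ Set.univ ^ (1 / p) + K ∧
    ENNReal.ofReal (dist x y) * τ Set.univ ^ (1 / p) ≤
      K + eLpNorm (fun z : X × X => dist z.1 z.2) (ENNReal.ofReal p) τ + K := by
  have h := rdr_tri τ hp x y
  have k1 := (eLpNorm_mono_measure (p := ENNReal.ofReal p) (fun w => dist w x) h1).trans hx
  have k2 := (eLpNorm_mono_measure (p := ENNReal.ofReal p) (fun w => dist w y) h2).trans hy
  constructor
  · refine h.1.trans ?_; gcongr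
  · refine h.2.trans ?_; gcongr

lemma rdr_holder [SecondCountableTopology X] (μ μ' : Measure X) {p q : ℝ} (hp : 1 ≤ p)
    (hpq : p < q) {x : X} {K : ℝ≥0∞}
    (hx : eLpNorm (fun w => dist w x) (ENNReal.ofReal q) μ ≤ K) (h : μ' ≤ μ) :
    eLpNorm (fun w => dist w x) (ENNReal.ofReal p) μ' ≤ K * μ' Set.univ ^ (1 / p - 1 / q) := by
  have mx : Measurable fun w : X => dist w x := measurable_id.dist measurable_const
  have := eLpNorm_le_eLpNorm_mul_rpow_measure_univ (μ := μ') (ENNReal.ofReal_le_ofReal hpq.le)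
    mx.aestronglyMeasurable
  rw [ENNReal.toReal_ofReal (by linarith), ENNReal.toReal_ofReal (by linarith)] at this
  refine this.trans ?_
  gcongr
  exact (eLpNorm_mono_measure _ h).trans hx

lemma rdr_bound [SecondCountableTopology X] (μ ν : Measure X) [IsProbabilityMeasure μ]
    [IsProbabilityMeasure ν] {p q M ε : ℝ} (hp : 1 ≤ p) (hpq : p < q) (hM : 0 < M)
    (hε0 : 0 ≤ ε) (hε : ε ≤ 0.33) {x y : X}
    (hx : eLpNorm (fun w => dist w x) (ENNReal.ofReal q) μ ≤ ENNReal.ofReal M)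
    (hy : eLpNorm (fun w => dist w y) (ENNReal.ofReal q) ν ≤ ENNReal.ofReal M)
    (σ : Measure (X × X)) (h1 : σ.map Prod.fst ≤ μ) (h2 : σ.map Prod.snd ≤ ν)
    (hσ : 1 ≤ σ Set.univ + ENNReal.ofReal (3 * ε)) :
    Wp (ENNReal.ofReal p) μ ν ≠ ∞ ∧
    ENNReal.ofReal ((1 - 3 * ε) ^ (1 / p)) * Wp (ENNReal.ofReal p) μ ν ≤
      eLpNorm (fun z : X × X => dist z.1 z.2) (ENNReal.ofReal p) σ +
        ENNReal.ofReal (48 * M * ε ^ (1 / p - 1 / q)) := by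
  have hp0 : 0 < p := by linarith
  have hip : 0 < 1 / p := by positivity
  have hipq : 0 < 1 / p - 1 / q := by
    have := one_div_lt_one_div_of_lt hp0 hpq
    linarith
  have hxp : eLpNorm (fun w => dist w x) (ENNReal.ofReal p) μ ≤ ENNReal.ofReal M := by
    simpa using rdr_holder μ μ hp hpq hx le_rfl
  have hyp : eLpNorm (fun w => dist w y) (ENNReal.ofReal p) ν ≤ ENNReal.ofReal M := by
    simpa using rdr_holder ν ν hp hpq hy le_rfl
  set W := Wp (ENNReal.ofReal p) μ ν with hWdef
  set A := eLpNorm (fun z : X × X => dist z.1 z.2) (ENNReal.ofReal p) σ with hAdef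
  set K := ENNReal.ofReal M with hK
  set D := ENNReal.ofReal (dist x y) with hD
  have hm1 : σ.map Prod.fst Set.univ = σ Set.univ := by
    rw [Measure.map_apply measurable_fst MeasurableSet.univ]; simp
  have hm2 : σ.map Prod.snd Set.univ = σ Set.univ := by
    rw [Measure.map_apply measurable_snd MeasurableSet.univ]; simp
  have hs1 : σ Set.univ ≤ 1 := by
    rw [← hm1, ← measure_univ (μ := μ)]; exact h1 _
  set s := σ Set.univ with hs
  have hsf : s ≠ ∞ := ne_top_of_le_ne_top ENNReal.one_ne_top hs1
  have : IsFiniteMeasure (σ.map Prod.fst) := isFiniteMeasure_of_le μ h1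
  have : IsFiniteMeasure (σ.map Prod.snd) := isFiniteMeasure_of_le ν h2
  set μr := μ - σ.map Prod.fst with hμr
  set νr := ν - σ.map Prod.snd with hνr
  set r := 1 - s with hr
  have hr1 : r ≤ 1 := tsub_le_self
  have hrf : r ≠ ∞ := ne_top_of_le_ne_top ENNReal.one_ne_top hr1
  have hμru : μr Set.univ = r := by
    rw [hμr, Measure.sub_apply MeasurableSet.univ h1, hm1, measure_univ]
  have hνru : νr Set.univ = r := by
    rw [hνr, Measure.sub_apply MeasurableSet.univ h2, hm2, measure_univ]
  set ρ := r⁻¹ • μr.prod νr with hρ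
  have hcanc : ∀ m : Measure X, m Set.univ = r → r⁻¹ • r • m = m := by
    intro m hm
    by_cases h0 : r = 0
    · rw [h0, Measure.measure_univ_eq_zero] at hm
      simp [hm]
    · rw [smul_smul, ENNReal.inv_mul_cancel h0 hrf, one_smul]
  have hρ1 : ρ.map Prod.fst = μr := by
    rw [hρ, Measure.map_smul, Measure.map_fst_prod, hνru, hcanc μr hμru]
  have hρ2 : ρ.map Prod.snd = νr := by
    rw [hρ, Measure.map_smul, Measure.map_snd_prod, hμru, hcanc νr hνru]
  have hρu : ρ Set.univ = r := by
    rw [← hμru, ← hρ1, Measure.map_apply measurable_fst MeasurableSet.univ]; simp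
  have hτ : σ + ρ ∈ couplings μ ν := by
    constructor
    · rw [Measure.map_add _ _ measurable_fst, hρ1, add_comm, hμr, Measure.sub_add_cancel_of_le h1]
    · rw [Measure.map_add _ _ measurable_snd, hρ2, add_comm, hνr, Measure.sub_add_cancel_of_le h2]
  have hWle : ∀ τ ∈ couplings μ ν,
      W ≤ eLpNorm (fun z : X × X => dist z.1 z.2) (ENNReal.ofReal p) τ :=
    fun τ hτ => iInf₂_le τ hτ
  have hu : ∀ τ ∈ couplings μ ν, τ Set.univ = 1 := by
    intro τ hτ
    rw [← measure_univ (μ := μ), ← hτ.1, Measure.map_apply measurable_fst MeasurableSet.univ]; simp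
  have H4 : W ≤ K + D + K := by
    have := (rdr_wp_rpow_le μ ν hp hxp hyp _ hτ.1.le hτ.2.le).1
    rw [hu _ hτ, ENNReal.one_rpow, mul_one] at this
    exact (hWle _ hτ).trans this
  have H2 : D ≤ W + (K + K) := by
    rw [← tsub_le_iff_right]
    refine le_iInf₂ fun τ hτ' => ?_
    have := (rdr_wp_rpow_le μ ν hp hxp hyp _ hτ'.1.le hτ'.2.le).2
    rw [hu _ hτ', ENNReal.one_rpow, mul_one] at this
    rw [tsub_le_iff_right]
    exact this.trans_eq (by ring)
  have H3 : D * s ^ (1 / p) ≤ K + A + K := (rdr_wp_rpow_le μ ν hp hxp hyp σ h1 h2).2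
  have H1 : W ^ p ≤ A ^ p + (K * r ^ (1 / p - 1 / q) + D * r ^ (1 / p) +
      K * r ^ (1 / p - 1 / q)) ^ p := by
    calc W ^ p ≤ (eLpNorm (fun z : X × X => dist z.1 z.2) (ENNReal.ofReal p) (σ + ρ)) ^ p :=
          ENNReal.rpow_le_rpow (hWle _ hτ) hp0.le
      _ = A ^ p + (eLpNorm (fun z : X × X => dist z.1 z.2) (ENNReal.ofReal p) ρ) ^ p :=
          rdr_elp_add _ _ _ hp0
      _ ≤ _ := by
          gcongr
          have a1 := rdr_holder μ μr hp hpq hx Measure.sub_le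
          have a2 := rdr_holder ν νr hp hpq hy Measure.sub_le
          have a3 := (rdr_tri ρ hp x y).1
          rw [hμru] at a1; rw [hνru] at a2; rw [hρ1, hρ2, hρu] at a3
          refine a3.trans ?_
          gcongr
  have hWf : W ≠ ∞ := ne_top_of_le_ne_top (by simp [hK, hD]) H4
  refine ⟨hWf, ?_⟩
  by_cases hAf : A = ∞
  · rw [hAf]; simp
  have hrs : s.toReal + r.toReal = 1 := by
    rw [← ENNReal.toReal_add hsf hrf, hr, add_tsub_cancel_of_le hs1, ENNReal.toReal_one]
  have hr3 : r.toReal ≤ 3 * ε := by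
    apply ENNReal.toReal_le_of_le_ofReal (by positivity)
    rw [hr, tsub_le_iff_left]; exact hσ
  have hsp : s ^ (1 / p) ≠ ∞ := ENNReal.rpow_ne_top_of_nonneg hip.le hsf
  have hrp : r ^ (1 / p) ≠ ∞ := ENNReal.rpow_ne_top_of_nonneg hip.le hrf
  have hrq : r ^ (1 / p - 1 / q) ≠ ∞ := ENNReal.rpow_ne_top_of_nonneg hipq.le hrf
  have hKf : K ≠ ∞ := ENNReal.ofReal_ne_top
  have hDf : D ≠ ∞ := ENNReal.ofReal_ne_top
  have hKr : K.toReal = M := ENNReal.toReal_ofReal hM.le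
  have eW : W = ENNReal.ofReal W.toReal := (ENNReal.ofReal_toReal hWf).symm
  have eA : A = ENNReal.ofReal A.toReal := (ENNReal.ofReal_toReal hAf).symm
  have hin1 : K * r ^ (1 / p - 1 / q) + D * r ^ (1 / p) + K * r ^ (1 / p - 1 / q) ≠ ∞ := by
    finiteness
  have key := rdr_real (A := A.toReal) (W := W.toReal) (D := D.toReal) (r := r.toReal)
    (s := s.toReal) hp hpq hM hε0 hε toReal_nonneg toReal_nonneg toReal_nonneg toReal_nonneg
    toReal_nonneg hrs hr3 ?_ ?_ ?_ ?_
  · have hL : 0 ≤ (1 - 3 * ε) ^ (1 / p) := Real.rpow_nonneg (by norm_num at hε ⊢; linarith) _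
    rw [eW, eA, ← ENNReal.ofReal_mul hL, ← ENNReal.ofReal_add toReal_nonneg (by positivity)]
    exact ENNReal.ofReal_le_ofReal key
  · have := ENNReal.toReal_mono (by finiteness) H1
    rw [ENNReal.toReal_add (by finiteness) (by finiteness), ← ENNReal.toReal_rpow,
      ← ENNReal.toReal_rpow, ← ENNReal.toReal_rpow, ENNReal.toReal_add (by finiteness) (by finiteness),
      ENNReal.toReal_add (by finiteness) (by finiteness), ENNReal.toReal_mul, ENNReal.toReal_mul,
      ← ENNReal.toReal_rpow, ← ENNReal.toReal_rpow, hKr] at this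
    refine this.trans_eq ?_
    congr 2; ring
  · have := ENNReal.toReal_mono (by finiteness) H2
    rw [ENNReal.toReal_add hWf (by finiteness), ENNReal.toReal_add hKf hKf, hKr] at this
    linarith
  · have := ENNReal.toReal_mono (by finiteness) H3
    rw [ENNReal.toReal_add (by finiteness) (by finiteness), ENNReal.toReal_add hKf hAf, hKr,
      ENNReal.toReal_mul, ← ENNReal.toReal_rpow] at this
    linarith
  · have := ENNReal.toReal_mono (by finiteness) H4
    rw [ENNReal.toReal_add (by finiteness) (by finiteness), ENNReal.toReal_add hKf hDf, hKr] at this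
    linarith

/-- robust estimation with `RWp`: for `1 ≤ p < q`, `M > 0`, and
`0 ≤ ε ≤ 0.33`, for `μ, ν ∈ D_q` and corrupted versions `μ̃ ∈ B_ε(μ)`, `ν̃ ∈ B_ε(ν)`,
`|W_p^ε(μ̃,ν̃) − W_p(μ,ν)| ≤ [1 − (1−3ε)^{1/p}]·W_p(μ,ν) + C·M·ε^{1/p − 1/q}` for an
absolute constant `C`. -/
theorem RWp_achieves_risk :
    ∃ C : ℝ, 0 < C ∧
      ∀ (X : Type) [MetricSpace X] [CompleteSpace X] [TopologicalSpace.SeparableSpace X]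
        [MeasurableSpace X] [BorelSpace X] (p q M ε : ℝ),
        1 ≤ p → p < q → 0 < M → 0 ≤ ε → ε ≤ 0.33 →
        ∀ μ ν : Measure X, μ ∈ Dq (X := X) q M → ν ∈ Dq (X := X) q M →
        ∀ μt νt : Measure X, μt ∈ huberBall ε μ → νt ∈ huberBall ε ν →
        |(RWp (ENNReal.ofReal p) ε μt νt).toReal - (Wp (ENNReal.ofReal p) μ ν).toReal|
          ≤ (1 - (1 - 3 * ε) ^ (1 / p)) * (Wp (ENNReal.ofReal p) μ ν).toReal
            + C * M * ε ^ (1 / p - 1 / q) := by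
  refine ⟨48, by norm_num, ?_⟩
  intro X _ _ _ _ _ p q M ε hp hpq hM hε0 hε μ ν hμ hν μt νt hμt hνt
  have : SecondCountableTopology X := UniformSpace.secondCountable_of_separable X
  obtain ⟨hμP, x, hx⟩ := hμ
  obtain ⟨hνP, y, hy⟩ := hν
  have hp0 : 0 < p := by linarith
  have h1ε : 0 < 1 - ε := by norm_num at hε ⊢; linarith
  have h3ε : 0 ≤ 1 - 3 * ε := by norm_num at hε ⊢; linarith
  have hW : Wp (ENNReal.ofReal p) μ ν ≠ ∞ := by
    refine (rdr_bound μ ν hp hpq hM hε0 hε hx hy (μ.prod ν) ?_ ?_ ?_).1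
    · simp
    · simp
    · simp
  have hup : RWp (ENNReal.ofReal p) ε μt νt ≤ Wp (ENNReal.ofReal p) μ ν := by
    have aux : ∀ m mt : Measure X, IsProbabilityMeasure m → mt ∈ huberBall ε m →
        ENNReal.ofReal (1 - ε) • m ≤ mt ∧
        (mt - ENNReal.ofReal (1 - ε) • m) Set.univ ≤ ENNReal.ofReal ε ∧
        ((ENNReal.ofReal (1 - ε) • m) Set.univ)⁻¹ • (ENNReal.ofReal (1 - ε) • m) = m := by
      rintro m mt hm ⟨α, hα, rfl⟩
      have hc : ENNReal.ofReal (1 - ε) ≠ 0 := by simpa using h1ε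
      refine ⟨Measure.le_add_right le_rfl, ?_, ?_⟩
      · refine (Measure.sub_le_of_le_add (d := ENNReal.ofReal ε • α) (add_comm _ _).le _).trans ?_
        simp
      · rw [Measure.smul_apply, measure_univ, smul_eq_mul, mul_one, smul_smul,
          ENNReal.inv_mul_cancel hc ENNReal.ofReal_ne_top, one_smul]
    obtain ⟨a1, a2, a3⟩ := aux μ μt hμP hμt
    obtain ⟨b1, b2, b3⟩ := aux ν νt hνP hνt
    have : RWp (ENNReal.ofReal p) ε μt νt ≤ _ :=
      iInf₂_le_of_le (ENNReal.ofReal (1 - ε) • μ) (ENNReal.ofReal (1 - ε) • ν)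
      (iInf₂_le_of_le a1 b1 (iInf₂_le a2 b2))
    rwa [a3, b3] at this
  have hlow : ENNReal.ofReal ((1 - 3 * ε) ^ (1 / p)) * Wp (ENNReal.ofReal p) μ ν ≤
      RWp (ENNReal.ofReal p) ε μt νt + ENNReal.ofReal (48 * M * ε ^ (1 / p - 1 / q)) := by
    rw [← tsub_le_iff_right]
    refine le_iInf₂ fun μ' ν' => le_iInf₂ fun hμ' hν' => le_iInf₂ fun hμm hνm => ?_
    refine le_iInf₂ fun π hπ => ?_
    rw [tsub_le_iff_right]
    obtain ⟨⟨n0, nt⟩, g, hg, hg1, hgμ, hgi⟩ := rdr_side μ μt μ' hε0 hε hμt hμ' hμm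
    obtain ⟨-, h, hh, hh1, hhν, hhi⟩ := rdr_side ν νt ν' hε0 hε hνt hν' hνm
    have hπP : IsProbabilityMeasure π := by
      constructor
      have := congrArg (fun m : Measure X => m Set.univ) hπ.1
      simp only [Measure.smul_apply, smul_eq_mul, ENNReal.inv_mul_cancel n0 nt] at this
      rw [Measure.map_apply measurable_fst MeasurableSet.univ] at this
      simpa using this
    obtain ⟨σ, hσπ, hσ1, hσ2, hσ⟩ :=
      rdr_sub μ ν _ _ π hε0 hπ.1 hπ.2 hg hg1 hgμ hgi hh hh1 hhν hhi
    refine (rdr_bound μ ν hp hpq hM hε0 hε hx hy σ hσ1 hσ2 hσ).2.trans ?_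
    gcongr
  have hR : RWp (ENNReal.ofReal p) ε μt νt ≠ ∞ := ne_top_of_le_ne_top hW hup
  have hE : 0 ≤ 48 * M * ε ^ (1 / p - 1 / q) := by positivity
  have hL : 0 ≤ (1 - 3 * ε) ^ (1 / p) := Real.rpow_nonneg h3ε _
  have hL1 : (1 - 3 * ε) ^ (1 / p) ≤ 1 := Real.rpow_le_one h3ε (by linarith) (by positivity)
  have up := ENNReal.toReal_mono hW hup
  have low := ENNReal.toReal_mono (by finiteness) hlow
  rw [ENNReal.toReal_mul, ENNReal.toReal_add hR ENNReal.ofReal_ne_top, ENNReal.toReal_ofReal hL,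
    ENNReal.toReal_ofReal hE] at low
  rw [abs_of_nonpos (by linarith)]
  linarith

end
end

section
/- (Mass addition.) Let (X,d) be a compact metric space, p ∈ [1,∞], ε ∈ [0,1), and μ, ν probability measures on X. Then W_p^ε(μ,ν) = (1 − 2δ)^{−1/p} · inf{W_p(μ',ν') : μ' ∈ B_δ(μ), ν' ∈ B_δ(ν)}, where δ = ε/(1+ε). -/
open MeasureTheory ENNReal Filter Topology

noncomputable section

variable {X : Type*} [MetricSpace X] [MeasurableSpace X] [BorelSpace X]

lemma aux_diag [SecondCountableTopology X] (p : ℝ≥0∞) (A : Measure (X × X)) (B : Measure X) :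
    eLpNorm (fun z : X × X => dist z.1 z.2) p (A + B.map (fun x => (x, x))) =
      eLpNorm (fun z : X × X => dist z.1 z.2) p A := by
  have hD : MeasurableSet {z : X × X | z.1 ≠ z.2} :=
    (measurableSet_eq_fun measurable_fst measurable_snd).compl
  have hf : (fun z : X × X => dist z.1 z.2) =
      Set.indicator {z : X × X | z.1 ≠ z.2} (fun z : X × X => dist z.1 z.2) := by
    ext z
    by_cases h : z.1 = z.2 <;> simp [Set.indicator, h]
  have hB : (B.map (fun x => (x, x))).restrict {z : X × X | z.1 ≠ z.2} = 0 := by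
    rw [Measure.restrict_eq_zero, Measure.map_apply (by fun_prop) hD]
    simp
  rw [hf, eLpNorm_indicator_eq_eLpNorm_restrict hD, eLpNorm_indicator_eq_eLpNorm_restrict hD,
    Measure.restrict_add, hB, add_zero]

lemma aux_alpha (ε : ℝ) (hε0 : 0 ≤ ε) (μ r : Measure X) [IsProbabilityMeasure μ]
    (hr : r Set.univ = ENNReal.ofReal ε) :
    ∃ α : Measure X, IsProbabilityMeasure α ∧ r = ENNReal.ofReal ε • α := by
  rcases hε0.eq_or_lt with h | h
  · refine ⟨μ, inferInstance, ?_⟩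
    subst h
    simpa using hr
  · have h0 : ENNReal.ofReal ε ≠ 0 := by simpa using h
    refine ⟨(ENNReal.ofReal ε)⁻¹ • r, ⟨?_⟩, ?_⟩
    · simp [hr, ENNReal.inv_mul_cancel h0]
    · rw [smul_smul, ENNReal.mul_inv_cancel h0 ofReal_ne_top, one_smul]

lemma aux_rem (ε : ℝ) (hε0 : 0 ≤ ε) (hε1 : ε < 1) (μ μ' : Measure X) [IsProbabilityMeasure μ]
    (h : μ' ≤ μ) (hm : (μ - μ') Set.univ ≤ ENNReal.ofReal ε) :
    ∃ r : Measure X, r Set.univ = ENNReal.ofReal ε ∧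
      ENNReal.ofReal (1 - ε) • ((μ' Set.univ)⁻¹ • μ') + r = μ := by
  have : IsFiniteMeasure μ' := isFiniteMeasure_of_le μ h
  rw [Measure.sub_apply MeasurableSet.univ h, measure_univ] at hm
  have hs : ENNReal.ofReal (1 - ε) ≤ μ' Set.univ := by
    rw [ENNReal.ofReal_sub _ hε0, ENNReal.ofReal_one, tsub_le_iff_right]
    rw [tsub_le_iff_right] at hm
    rwa [add_comm]
  have hs0 : ENNReal.ofReal (1 - ε) ≠ 0 := by simpa using hε1
  have h0 : μ' Set.univ ≠ 0 := fun h => hs0 (by simpa [h] using hs)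
  have hle : ENNReal.ofReal (1 - ε) • ((μ' Set.univ)⁻¹ • μ') ≤ μ := by
    refine le_trans ?_ h
    rw [smul_smul]
    have : ENNReal.ofReal (1 - ε) * (μ' Set.univ)⁻¹ ≤ 1 := by
      rw [← div_eq_mul_inv]
      exact ENNReal.div_le_of_le_mul (by simpa using hs)
    intro s
    simp only [Measure.smul_apply, smul_eq_mul]
    exact mul_le_of_le_one_left zero_le this
  have : IsFiniteMeasure (ENNReal.ofReal (1 - ε) • ((μ' Set.univ)⁻¹ • μ')) :=
    isFiniteMeasure_of_le μ hle
  refine ⟨μ - ENNReal.ofReal (1 - ε) • ((μ' Set.univ)⁻¹ • μ'), ?_, ?_⟩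
  · rw [Measure.sub_apply MeasurableSet.univ hle]
    simp only [Measure.smul_apply, smul_eq_mul, measure_univ]
    rw [ENNReal.inv_mul_cancel h0 (measure_ne_top _ _), mul_one, ← ENNReal.ofReal_one,
      ← ENNReal.ofReal_sub _ (by linarith)]
    congr 1; ring
  · rw [add_comm]; exact Measure.sub_add_cancel_of_le hle

lemma aux_dens (k : ℝ≥0∞) (hk : k ≠ ∞) (μ μ'' : Measure X) [IsProbabilityMeasure μ]
    [IsFiniteMeasure μ''] (h : k • μ ≤ μ'') :
    ∃ f : X → ℝ≥0∞, Measurable f ∧ (∀ x, f x ≤ 1) ∧ μ''.withDensity f = k • μ := by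
  have : IsFiniteMeasure (k • μ) := isFiniteMeasure_of_le _ h
  refine ⟨fun x => min ((k • μ).rnDeriv μ'' x) 1, by fun_prop, fun x => min_le_right _ _, ?_⟩
  have h1 : (fun x => min ((k • μ).rnDeriv μ'' x) 1) =ᵐ[μ''] (k • μ).rnDeriv μ'' := by
    filter_upwards [Measure.rnDeriv_le_one_of_le h] with x hx
    exact min_eq_left hx
  rw [withDensity_congr_ae h1]
  exact Measure.withDensity_rnDeriv_eq _ _ (Measure.absolutelyContinuous_of_le h)

lemma aux_marg_s7 {Z : Type*} [MeasurableSpace Z] (π : Measure Z) (T : Z → X) (hT : Measurable T)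
    (f : X → ℝ≥0∞) (hf : Measurable f) (g : Z → ℝ≥0∞) (hg : ∀ z, g z ≤ f (T z)) :
    (π.withDensity g).map T ≤ (π.map T).withDensity f := by
  refine Measure.le_iff.2 fun s hs => ?_
  rw [Measure.map_apply hT hs, withDensity_apply _ (hT hs), withDensity_apply _ hs,
    setLIntegral_map hs hf hT]
  exact lintegral_mono hg

lemma aux_arith (a b : ℝ≥0∞) (ha : a ≤ 1) (hb : b ≤ 1) : a + b ≤ 1 + a * b := by
  lift a to NNReal using ne_top_of_le_ne_top one_ne_top ha
  lift b to NNReal using ne_top_of_le_ne_top one_ne_top hb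
  norm_cast at *
  rw [← NNReal.coe_le_coe] at *
  push_cast at *
  nlinarith

lemma aux_norm (p c : ℝ≥0∞) (hc : c ≠ 0) (π : Measure (X × X)) :
    eLpNorm (fun z : X × X => dist z.1 z.2) p (c • π) =
      c ^ (1 / p.toReal) * eLpNorm (fun z : X × X => dist z.1 z.2) p π := by
  rw [eLpNorm_smul_measure_of_ne_zero hc, smul_eq_mul, one_div, one_div, ENNReal.toReal_inv]

lemma aux_lower (p : ℝ≥0∞) (ε : ℝ) (hε0 : 0 ≤ ε) (μ μ' : Measure X) [IsProbabilityMeasure μ]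
    (k t m : ℝ≥0∞) (hk0 : k ≠ 0) (hk : k ≠ ∞) (hm : t ≤ m)
    (hks : t = k * ENNReal.ofReal (1 - ε)) (hle : μ' ≤ k • μ) (hmu : μ' Set.univ = m) :
    k⁻¹ • μ' ≤ μ ∧ (μ - k⁻¹ • μ') Set.univ ≤ ENNReal.ofReal ε ∧
      ((k⁻¹ • μ') Set.univ)⁻¹ • k⁻¹ • μ' = m⁻¹ • μ' := by
  have h1 : k⁻¹ • μ' ≤ μ := by
    intro s
    have := hle s
    simp only [Measure.smul_apply, smul_eq_mul] at *
    calc k⁻¹ * μ' s ≤ k⁻¹ * (k * μ s) := by gcongr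
      _ = μ s := by rw [← mul_assoc, ENNReal.inv_mul_cancel hk0 hk, one_mul]
  have : IsFiniteMeasure (k⁻¹ • μ') := isFiniteMeasure_of_le μ h1
  refine ⟨h1, ?_, ?_⟩
  · rw [Measure.sub_apply MeasurableSet.univ h1]
    simp only [Measure.smul_apply, smul_eq_mul, measure_univ, hmu]
    have : ENNReal.ofReal (1 - ε) ≤ k⁻¹ * m := by
      calc ENNReal.ofReal (1 - ε) = k⁻¹ * t := by
            rw [hks, ← mul_assoc, ENNReal.inv_mul_cancel hk0 hk, one_mul]
        _ ≤ _ := by gcongr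
    rw [ENNReal.ofReal_sub _ hε0, ENNReal.ofReal_one, tsub_le_iff_right] at this
    rw [tsub_le_iff_right]
    rwa [add_comm]
  · simp only [Measure.smul_apply, smul_eq_mul, hmu]
    rw [smul_smul, ENNReal.mul_inv (by simp [hk]) (by simp [hk0]), inv_inv, mul_right_comm,
      ENNReal.mul_inv_cancel hk0 hk, one_mul]

/-- mass addition: on a compact metric space, for `p ∈ [1,∞]`,
`ε ∈ [0,1)`, and probability measures `μ, ν`,
`W_p^ε(μ,ν) = (1 − 2δ)^{−1/p} · inf {W_p(μ',ν') : μ' ∈ B_δ(μ), ν' ∈ B_δ(ν)}` with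
`δ = ε/(1+ε)`. -/
theorem mass_addition {X : Type*} [MetricSpace X] [CompactSpace X]
    [MeasurableSpace X] [BorelSpace X]
    (p : ℝ≥0∞) (hp : 1 ≤ p) (ε : ℝ) (hε0 : 0 ≤ ε) (hε1 : ε < 1)
    (μ ν : Measure X) [IsProbabilityMeasure μ] [IsProbabilityMeasure ν]
    (δ : ℝ) (hδ : δ = ε / (1 + ε)) :
    RWp p ε μ ν =
      ENNReal.ofReal (1 - 2 * δ) ^ (-(1 / p.toReal)) *
        ⨅ (μ' : Measure X) (_ : μ' ∈ huberBall δ μ) (ν' : Measure X) (_ : ν' ∈ huberBall δ ν),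
          Wp p μ' ν' := by
  have : SecondCountableTopology X := inferInstance
  have e1 : (0:ℝ) < 1 + ε := by linarith
  set k : ℝ≥0∞ := ENNReal.ofReal (1 - δ) with hkdef
  set t : ℝ≥0∞ := ENNReal.ofReal (1 - 2 * δ) with htdef
  have hδ1 : 1 - δ = 1 / (1 + ε) := by rw [hδ]; field_simp; ring
  have hδ2 : 1 - 2 * δ = (1 - ε) / (1 + ε) := by rw [hδ]; field_simp; ring
  have hδ0 : 0 ≤ δ := by rw [hδ]; positivity
  have hδp : 0 < 1 - δ := by rw [hδ1]; positivity
  have htp : 0 < 1 - 2 * δ := by rw [hδ2]; apply div_pos <;> linarith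
  have hk0 : k ≠ 0 := by simpa [hkdef] using hδp
  have hk : k ≠ ∞ := ofReal_ne_top
  have ht0 : t ≠ 0 := by simpa [htdef] using htp
  have ht : t ≠ ∞ := ofReal_ne_top
  have hks : t = k * ENNReal.ofReal (1 - ε) := by
    rw [hkdef, htdef, ← ENNReal.ofReal_mul hδp.le, hδ1, hδ2]
    congr 1; ring
  have hke : k * ENNReal.ofReal ε = ENNReal.ofReal δ := by
    rw [hkdef, ← ENNReal.ofReal_mul hδp.le, hδ1, hδ]
    congr 1; ring
  have hkk : k + k = 1 + t := by
    rw [hkdef, htdef, ← ENNReal.ofReal_add hδp.le hδp.le, ← ENNReal.ofReal_one,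
      ← ENNReal.ofReal_add zero_le_one htp.le]
    congr 1; ring
  have hk1 : k + ENNReal.ofReal δ = 1 := by
    rw [hkdef, ← ENNReal.ofReal_add hδp.le hδ0]; simp
  have hq : (0:ℝ) ≤ 1 / p.toReal := by positivity
  have htt0 : t ^ (1 / p.toReal) ≠ 0 := by
    simp [ENNReal.rpow_eq_zero_iff, ht0, ht]
  have htt : t ^ (1 / p.toReal) ≠ ∞ := ENNReal.rpow_ne_top_of_nonneg hq ht
  rw [ENNReal.rpow_neg]
  apply le_antisymm
  · rw [mul_comm, ← div_eq_mul_inv, ENNReal.le_div_iff_mul_le (Or.inl htt0) (Or.inl htt), mul_comm]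
    refine le_iInf fun μ'' => le_iInf fun hμ => le_iInf fun ν'' => le_iInf fun hν => ?_
    refine le_iInf fun π => le_iInf fun hπ => ?_
    obtain ⟨α, hα, hμ⟩ := hμ
    obtain ⟨β, hβ, hν⟩ := hν
    obtain ⟨hπ1, hπ2⟩ := hπ
    have hμle : k • μ ≤ μ'' := by rw [hμ]; exact Measure.le_add_right le_rfl
    have hνle : k • ν ≤ ν'' := by rw [hν]; exact Measure.le_add_right le_rfl
    have hμP : IsProbabilityMeasure μ'' := ⟨by rw [hμ]; simpa using hk1⟩
    have hνP : IsProbabilityMeasure ν'' := ⟨by rw [hν]; simpa using hk1⟩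
    have hπu : π Set.univ = 1 := by
      have h := measure_univ (μ := μ'')
      rwa [← hπ1, Measure.map_apply measurable_fst MeasurableSet.univ, Set.preimage_univ] at h
    obtain ⟨f, hfm, hf1, hfd⟩ := aux_dens k hk μ μ'' hμle
    obtain ⟨g, hgm, hg1, hgd⟩ := aux_dens k hk ν ν'' hνle
    set P := π.withDensity (fun z => f z.1 * g z.2) with hP
    have hPle : P ≤ π := by
      calc P ≤ π.withDensity 1 := withDensity_mono (ae_of_all _ fun z => mul_le_one' (hf1 _) (hg1 _))
        _ = π := withDensity_one
    have hP1 : P.map Prod.fst ≤ k • μ := by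
      rw [← hfd, ← hπ1]
      exact aux_marg_s7 π _ measurable_fst f hfm _ fun z => mul_le_of_le_one_right zero_le (hg1 _)
    have hP2 : P.map Prod.snd ≤ k • ν := by
      rw [← hgd, ← hπ2]
      exact aux_marg_s7 π _ measurable_snd g hgm _ fun z => mul_le_of_le_one_left zero_le (hf1 _)
    have hm : t ≤ P Set.univ := by
      have hF : ∫⁻ z, f z.1 ∂π = k := by
        rw [← lintegral_map hfm measurable_fst, hπ1, ← setLIntegral_univ,
          ← withDensity_apply _ MeasurableSet.univ, hfd]
        simp
      have hG : ∫⁻ z, g z.2 ∂π = k := by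
        rw [← lintegral_map hgm measurable_snd, hπ2, ← setLIntegral_univ,
          ← withDensity_apply _ MeasurableSet.univ, hgd]
        simp
      have hI : ∫⁻ z, (f z.1 + g z.2) ∂π ≤ ∫⁻ z, (1 + f z.1 * g z.2) ∂π :=
        lintegral_mono fun z => aux_arith _ _ (hf1 _) (hg1 _)
      rw [lintegral_add_left (by fun_prop), lintegral_add_left (by fun_prop), hF, hG, hkk,
        lintegral_one, hπu] at hI
      rw [hP, withDensity_apply _ MeasurableSet.univ, setLIntegral_univ]
      exact (ENNReal.add_le_add_iff_left one_ne_top).1 hI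
    obtain ⟨a1, a2, a3⟩ := aux_lower p ε hε0 μ (P.map Prod.fst) k t (P Set.univ) hk0 hk hm hks hP1
      (by rw [Measure.map_apply measurable_fst MeasurableSet.univ, Set.preimage_univ])
    obtain ⟨b1, b2, b3⟩ := aux_lower p ε hε0 ν (P.map Prod.snd) k t (P Set.univ) hk0 hk hm hks hP2
      (by rw [Measure.map_apply measurable_snd MeasurableSet.univ, Set.preimage_univ])
    have hm1 : P Set.univ ≤ 1 := hπu ▸ hPle Set.univ
    have hmt : P Set.univ ≠ ∞ := ne_top_of_le_ne_top one_ne_top hm1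
    have hm0 : P Set.univ ≠ 0 := fun h => ht0 (by simpa [h] using hm)
    have key : RWp p ε μ ν ≤ eLpNorm (fun z : X × X => dist z.1 z.2) p ((P Set.univ)⁻¹ • P) := by
      refine iInf_le_of_le _ (iInf_le_of_le _ (iInf_le_of_le a1 (iInf_le_of_le b1
        (iInf_le_of_le a2 (iInf_le_of_le b2 ?_)))))
      rw [a3, b3]
      refine iInf₂_le _ ⟨?_, ?_⟩ <;> rw [Measure.map_smul]
    calc t ^ (1 / p.toReal) * RWp p ε μ ν
        ≤ t ^ (1 / p.toReal) * ((P Set.univ)⁻¹ ^ (1 / p.toReal) *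
          eLpNorm (fun z : X × X => dist z.1 z.2) p P) := by
          rw [← aux_norm p _ (by simpa using hmt)]; gcongr
      _ = (t * (P Set.univ)⁻¹) ^ (1 / p.toReal) * eLpNorm (fun z : X × X => dist z.1 z.2) p P := by
          rw [ENNReal.mul_rpow_of_nonneg _ _ hq, mul_assoc]
      _ ≤ 1 * eLpNorm (fun z : X × X => dist z.1 z.2) p π := by
          gcongr
          · refine ENNReal.rpow_le_one ?_ hq
            rw [← div_eq_mul_inv]
            exact ENNReal.div_le_of_le_mul (by simpa using hm)
      _ = _ := one_mul _
  · refine le_iInf fun μ' => le_iInf fun ν' => le_iInf fun hμ => le_iInf fun hν =>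
      le_iInf fun hμm => le_iInf fun hνm => le_iInf fun π => le_iInf fun hπ => ?_
    obtain ⟨hπ1, hπ2⟩ := hπ
    obtain ⟨r, hr, hrμ⟩ := aux_rem ε hε0 hε1 μ μ' hμ hμm
    obtain ⟨q, hq', hqν⟩ := aux_rem ε hε0 hε1 ν ν' hν hνm
    obtain ⟨α, hα, hrα⟩ := aux_alpha ε hε0 μ r hr
    obtain ⟨β, hβ, hqβ⟩ := aux_alpha ε hε0 μ q hq'
    have hdiag : Measurable (fun x : X => (x, x)) := by fun_prop
    have key : (⨅ (μ' : Measure X) (_ : μ' ∈ huberBall δ μ) (ν' : Measure X)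
        (_ : ν' ∈ huberBall δ ν), Wp p μ' ν') ≤ eLpNorm (fun z : X × X => dist z.1 z.2) p
          (t • π + (k • r + k • q).map (fun x => (x, x))) := by
      refine iInf_le_of_le (k • μ + k • q) (iInf_le_of_le ⟨β, hβ, ?_⟩
        (iInf_le_of_le (k • ν + k • r) (iInf_le_of_le ⟨α, hα, ?_⟩ (iInf₂_le _ ⟨?_, ?_⟩))))
      · rw [← hke, ← smul_smul, ← hqβ]
      · rw [← hke, ← smul_smul, ← hrα]
      · rw [Measure.map_add _ _ measurable_fst, Measure.map_map measurable_fst hdiag,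
          Measure.map_smul, hπ1, hks, ← smul_smul]
        conv_rhs => rw [← hrμ]
        rw [show (Prod.fst ∘ fun x : X => (x, x)) = id from rfl, Measure.map_id, smul_add,
          add_assoc]
      · rw [Measure.map_add _ _ measurable_snd, Measure.map_map measurable_snd hdiag,
          Measure.map_smul, hπ2, hks, ← smul_smul]
        conv_rhs => rw [← hqν]
        rw [show (Prod.snd ∘ fun x : X => (x, x)) = id from rfl, Measure.map_id, smul_add,
          add_assoc, add_comm (k • r)]
    rw [aux_diag, aux_norm p t ht0] at key
    rw [mul_comm, ← div_eq_mul_inv]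
    exact ENNReal.div_le_of_le_mul (by rwa [mul_comm])

end
end

section
/- (Dual form.) Let (X,d) be a compact metric space, p ∈ [1,∞), ε ∈ [0,1], and μ, ν probability measures on X. Then (1 − ε)·W_p^ε(μ,ν)^p = sup over continuous bounded f : X → ℝ of [∫ f dμ + ∫ f^c dν − 2ε‖f‖_∞] = sup over continuous bounded f of [∫ f dμ + ∫ f^c dν − ε·(sup_X f − inf_X f)], where f^c(y) = inf_{x∈X}(d(x,y)^p − f(x)); moreover the suprema are achieved by some f ∈ C_b(X) with f = (f^c)^c. -/
open MeasureTheory ENNReal Filter Topology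

noncomputable section

variable {X : Type*} [MetricSpace X] [MeasurableSpace X] [BorelSpace X]

/-- The `c`-transform of `f` with respect to the cost `c(x,y) = d(x,y)^p`:
`f^c(y) = inf_x (d(x,y)^p − f(x))`. -/
def ctrans (p : ℝ) (f : X → ℝ) : X → ℝ := fun y => ⨅ x : X, (dist x y ^ p - f x)

section aux

set_option linter.unusedSectionVars false
set_option linter.style.haveILetI false

variable [CompactSpace X] [Nonempty X]

def costC (p : ℝ) (hp : 1 ≤ p) : C(X × X, ℝ) :=
  ⟨fun z => dist z.1 z.2 ^ p,
    (continuous_fst.dist continuous_snd).rpow_const (fun _ => Or.inr (by linarith))⟩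


lemma bdd_above_C (f : C(X, ℝ)) : BddAbove (Set.range f) :=
  (isCompact_range f.continuous).bddAbove

lemma bdd_below_C (f : C(X, ℝ)) : BddBelow (Set.range f) :=
  (isCompact_range f.continuous).bddBelow

lemma ct_bdd (p : ℝ) (f : C(X, ℝ)) (y : X) :
    BddBelow (Set.range fun x : X => dist x y ^ p - f x) := by
  refine ⟨-‖f‖, ?_⟩
  rintro _ ⟨x, rfl⟩
  have h1 : 0 ≤ dist x y ^ p := Real.rpow_nonneg dist_nonneg _
  have h2 := (abs_le.1 (f.norm_coe_le_norm x)).2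
  simp only
  linarith

lemma ct_le (p : ℝ) (f : C(X, ℝ)) (x y : X) : ctrans p f y ≤ dist x y ^ p - f x :=
  ciInf_le (ct_bdd p f y) x

lemma le_ct (p : ℝ) (f : X → ℝ) (y : X) (a : ℝ) (h : ∀ x, a ≤ dist x y ^ p - f x) :
    a ≤ ctrans p f y := le_ciInf h

def modF (p : ℝ) (hp : 1 ≤ p) : C(X, C(X, ℝ)) := (costC p hp).curry

lemma modF_bd (p : ℝ) (hp : 1 ≤ p) (x y y' : X) :
    dist x y' ^ p ≤ dist x y ^ p + dist (modF p hp y) (modF p hp y') := by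
  have h := ContinuousMap.dist_apply_le_dist (f := modF p hp y) (g := modF p hp y') x
  have e1 : modF p hp y x = dist y x ^ p := rfl
  have e2 : modF p hp y' x = dist y' x ^ p := rfl
  rw [e1, e2, Real.dist_eq, dist_comm y, dist_comm y'] at h
  linarith [(abs_le.1 h).1]

lemma ct_mod (p : ℝ) (hp : 1 ≤ p) (f : C(X, ℝ)) (y y' : X) :
    ctrans p f y' ≤ ctrans p f y + dist (modF p hp y) (modF p hp y') := by
  have : ctrans p f y' - dist (modF p hp y) (modF p hp y') ≤ ctrans p f y := by
    apply le_ct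
    intro x
    linarith [ct_le p f x y', modF_bd p hp x y y']
  linarith

lemma ct_mod' (p : ℝ) (hp : 1 ≤ p) (f : C(X, ℝ)) (y y' : X) :
    dist (ctrans p f y) (ctrans p f y') ≤ dist (modF p hp y) (modF p hp y') := by
  rw [Real.dist_eq, abs_le]
  have h1 := ct_mod p hp f y y'
  have h2 := ct_mod p hp f y' y
  rw [dist_comm (modF p hp y')] at h2
  constructor <;> linarith

lemma cont_of_mod (p : ℝ) (hp : 1 ≤ p) (g : X → ℝ)
    (h : ∀ y y', dist (g y) (g y') ≤ dist (modF p hp y) (modF p hp y')) : Continuous g := by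
  rw [continuous_iff_continuousAt]
  intro x
  rw [ContinuousAt, tendsto_iff_dist_tendsto_zero]
  have : Tendsto (fun y => dist (modF p hp y) (modF p hp x)) (𝓝 x) (𝓝 0) :=
    tendsto_iff_dist_tendsto_zero.1 ((modF p hp).continuous.tendsto x)
  exact squeeze_zero (fun _ => dist_nonneg) (fun y => h y x) this

def ctC (p : ℝ) (hp : 1 ≤ p) (f : C(X, ℝ)) : C(X, ℝ) :=
  ⟨ctrans p f, cont_of_mod p hp _ (ct_mod' p hp f)⟩

lemma ctC_le (p : ℝ) (hp : 1 ≤ p) (f : C(X, ℝ)) (x y : X) :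
    ctC p hp f y ≤ dist x y ^ p - f x := ct_le p f x y

lemma le_ctC (p : ℝ) (hp : 1 ≤ p) (f : C(X, ℝ)) (y : X) (a : ℝ)
    (h : ∀ x, a ≤ dist x y ^ p - f x) : a ≤ ctC p hp f y := le_ct p f y a h

lemma ctC_le_neg (p : ℝ) (hp : 1 ≤ p) (f : C(X, ℝ)) (y : X) : ctC p hp f y ≤ - f y := by
  have := ctC_le p hp f y y
  rw [dist_self, Real.zero_rpow (by linarith)] at this
  linarith

lemma le_ctcc (p : ℝ) (hp : 1 ≤ p) (f : C(X, ℝ)) (y : X) :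
    f y ≤ ctC p hp (ctC p hp f) y := by
  apply le_ctC
  intro x
  have := ctC_le p hp f y x
  rw [dist_comm] at this
  linarith

lemma ctC_anti (p : ℝ) (hp : 1 ≤ p) (f g : C(X, ℝ)) (h : ∀ x, f x ≤ g x) (y : X) :
    ctC p hp g y ≤ ctC p hp f y := by
  apply le_ctC
  intro x
  linarith [ctC_le p hp g x y, h x]

lemma ctccc (p : ℝ) (hp : 1 ≤ p) (f : C(X, ℝ)) :
    ctC p hp (ctC p hp (ctC p hp f)) = ctC p hp f := by
  ext y
  exact le_antisymm (ctC_anti p hp _ _ (le_ctcc p hp f) y) (le_ctcc p hp _ y)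

lemma integrable_C {Y : Type*} [TopologicalSpace Y] [CompactSpace Y] [MeasurableSpace Y]
    [BorelSpace Y] (m : Measure Y) [IsFiniteMeasure m] (f : C(Y, ℝ)) : Integrable f m :=
  f.continuous.integrable_of_hasCompactSupport (HasCompactSupport.of_compactSpace f)

def osc (f : C(X, ℝ)) : ℝ := (⨆ x, f x) - ⨅ x, f x

lemma le_sup_C (f : C(X, ℝ)) (x : X) : f x ≤ ⨆ x, f x := le_ciSup (bdd_above_C f) x
lemma inf_le_C (f : C(X, ℝ)) (x : X) : ⨅ x, f x ≤ f x := ciInf_le (bdd_below_C f) x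

lemma osc_le (f : C(X, ℝ)) (a b : ℝ) (ha : ∀ x, a ≤ f x) (hb : ∀ x, f x ≤ b) :
    osc f ≤ b - a := by
  have h1 : (⨆ x, f x) ≤ b := ciSup_le hb
  have h2 : a ≤ ⨅ x, f x := le_ciInf ha
  unfold osc; linarith

def Jf (p : ℝ) (hp : 1 ≤ p) (ε : ℝ) (μ ν : Measure X) (f : C(X, ℝ)) : ℝ :=
  ∫ x, f x ∂μ + ∫ y, ctC p hp f y ∂ν - ε * osc f

variable (μ ν : Measure X) [IsProbabilityMeasure μ] [IsProbabilityMeasure ν]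

lemma integral_mono_C (f g : C(X, ℝ)) (h : ∀ x, f x ≤ g x) : ∫ x, f x ∂μ ≤ ∫ x, g x ∂μ :=
  integral_mono (integrable_C μ f) (integrable_C μ g) h

lemma integral_le_add_C (f g : C(X, ℝ)) (a : ℝ) (h : ∀ x, f x ≤ g x + a) :
    ∫ x, f x ∂μ ≤ ∫ x, g x ∂μ + a := by
  have := integral_mono (integrable_C μ f) ((integrable_C μ g).add (integrable_const a)) h
  simpa [integral_add (integrable_C μ g) (integrable_const a)] using this

lemma J_cc (p : ℝ) (hp : 1 ≤ p) (ε : ℝ) (hε : 0 ≤ ε) (f : C(X, ℝ)) :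
    Jf p hp ε μ ν f ≤ Jf p hp ε μ ν (ctC p hp (ctC p hp f)) := by
  unfold Jf
  rw [ctccc]
  have h1 := integral_mono_C μ _ _ (le_ctcc p hp f)
  have h2 : osc (ctC p hp (ctC p hp f)) ≤ osc f := by
    apply osc_le
    · intro x; exact (inf_le_C f x).trans (le_ctcc p hp f x)
    · intro x
      refine (ctC_le_neg p hp _ x).trans ?_
      have : -(⨆ x, f x) ≤ ctC p hp f x := by
        apply le_ctC
        intro z
        have h1 : 0 ≤ dist z x ^ p := Real.rpow_nonneg dist_nonneg _
        linarith [le_sup_C f z]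
      linarith
  have := mul_le_mul_of_nonneg_left h2 hε
  linarith

lemma J_lip (p : ℝ) (hp : 1 ≤ p) (ε : ℝ) (hε : 0 ≤ ε) (f g : C(X, ℝ)) (a b : ℝ)
    (hfg : ∀ x, f x ≤ g x + a) (hgf : ∀ x, g x ≤ f x + b) :
    Jf p hp ε μ ν f ≤ Jf p hp ε μ ν g + (1 + ε) * (a + b) := by
  have h1 := integral_le_add_C μ f g a hfg
  have h2 : ∫ x, ctC p hp f x ∂ν ≤ ∫ x, ctC p hp g x ∂ν + b := by
    apply integral_le_add_C
    intro y
    have : ctC p hp f y - b ≤ ctC p hp g y := by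
      apply le_ctC
      intro x
      linarith [ctC_le p hp f x y, hgf x]
    linarith
  have h3 : osc g ≤ osc f + (a + b) := by
    have := osc_le g ((⨅ x, f x) - a) ((⨆ x, f x) + b)
      (fun x => by linarith [inf_le_C f x, hfg x]) (fun x => by linarith [le_sup_C f x, hgf x])
    unfold osc at *
    linarith
  have := mul_le_mul_of_nonneg_left h3 hε
  unfold Jf
  linarith

lemma J_const (p : ℝ) (hp : 1 ≤ p) (ε : ℝ) (hε : 0 ≤ ε) (f : C(X, ℝ)) (a : ℝ) :
    Jf p hp ε μ ν (f + ContinuousMap.const X a) = Jf p hp ε μ ν f := by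
  apply le_antisymm
  · have := J_lip μ ν p hp ε hε (f + ContinuousMap.const X a) f a (-a) (by simp) (by simp)
    simpa using this
  · have := J_lip μ ν p hp ε hε f (f + ContinuousMap.const X a) (-a) a (by simp) (by simp)
    simpa using this

lemma J_cont (p : ℝ) (hp : 1 ≤ p) (ε : ℝ) (hε : 0 ≤ ε) : Continuous (Jf p hp ε μ ν) := by
  refine (LipschitzWith.of_le_add_mul (Real.toNNReal ((1 + ε) * 2)) ?_).continuous
  intro f g
  rw [Real.coe_toNNReal _ (by positivity)]
  have key : ∀ f g : C(X, ℝ), ∀ x, f x ≤ g x + dist f g := by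
    intro f g x
    have := ContinuousMap.dist_apply_le_dist (f := f) (g := g) x
    rw [Real.dist_eq] at this
    linarith [(abs_le.1 this).2]
  have := J_lip μ ν p hp ε hε f g _ _ (key f g) (key g f)
  rw [dist_comm g f] at this
  linarith

lemma J_zero (p : ℝ) (hp : 1 ≤ p) (ε : ℝ) : Jf p hp ε μ ν 0 = 0 := by
  have : ctC p hp (0 : C(X, ℝ)) = 0 := by
    ext y
    apply le_antisymm
    · simpa using ctC_le_neg p hp (0 : C(X, ℝ)) y
    · apply le_ctC
      intro x
      simpa using Real.rpow_nonneg dist_nonneg _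
  simp [Jf, this, osc]

lemma exists_max (p : ℝ) (hp : 1 ≤ p) (ε : ℝ) (hε : 0 ≤ ε) :
    ∃ f : C(X, ℝ), ctC p hp (ctC p hp f) = f ∧ ∀ g, Jf p hp ε μ ν g ≤ Jf p hp ε μ ν f := by
  obtain ⟨x0⟩ := ‹Nonempty X›
  haveI : Nonempty X := ⟨x0⟩
  let T : Set (X → ℝ) := {g | g x0 = 0 ∧
    ∀ y y', dist (g y) (g y') ≤ dist (modF p hp y) (modF p hp y')}
  let K : Set C(X, ℝ) := {f | (f : X → ℝ) ∈ T}
  have hT : IsCompact T := by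
    have hsub : T ⊆ Set.univ.pi fun y => Metric.closedBall (0 : ℝ) (dist (modF p hp y) (modF p hp x0)) := by
      intro g hg y _
      have := hg.2 y x0
      rw [hg.1] at this
      exact this
    refine (isCompact_univ_pi fun y => isCompact_closedBall _ _).of_isClosed_subset ?_ hsub
    have : T = {g | g x0 = 0} ∩ ⋂ y, ⋂ y', {g | dist (g y) (g y') ≤ dist (modF p hp y) (modF p hp y')} := by
      ext g; simp [T]
    rw [this]
    refine (isClosed_eq (continuous_apply _) continuous_const).inter
      (isClosed_iInter fun y => isClosed_iInter fun y' =>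
        isClosed_le ((continuous_apply _).dist (continuous_apply _)) continuous_const)
  have hK : IsCompact K := by
    apply ArzelaAscoli.isCompact_of_equicontinuous
    · convert hT
      ext g
      constructor
      · rintro ⟨f, hf, rfl⟩; exact hf
      · intro hg
        exact ⟨⟨g, cont_of_mod p hp g hg.2⟩, hg, rfl⟩
    · intro x
      refine Metric.equicontinuousAt_of_continuity_modulus
        (fun y => dist (modF p hp x) (modF p hp y)) ?_ _ ?_
      · have := (continuous_const.dist (modF p hp).continuous :
          Continuous fun y => dist (modF p hp x) (modF p hp y)).tendsto x
        simpa using this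
      · exact Eventually.of_forall fun y i => i.2.2 x y
  have hne : K.Nonempty := ⟨0, by simp [K, T]⟩
  obtain ⟨f0, -, hf0⟩ := hK.exists_isMaxOn hne (J_cont μ ν p hp ε hε).continuousOn
  refine ⟨ctC p hp (ctC p hp f0), by rw [ctccc], fun g => ?_⟩
  refine le_trans ?_ (J_cc μ ν p hp ε hε f0)
  refine (J_cc μ ν p hp ε hε g).trans ?_
  rw [← J_const μ ν p hp ε hε (ctC p hp (ctC p hp g)) (- ctC p hp (ctC p hp g) x0)]
  apply hf0
  refine ⟨by simp, fun y y' => ?_⟩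
  have : dist (ctC p hp (ctC p hp g) y) (ctC p hp (ctC p hp g) y') ≤ _ :=
    ct_mod' p hp (ctC p hp g) y y'
  simpa using this

lemma exists_le_integral (f : C(X, ℝ)) : ∃ x, f x ≤ ∫ x, f x ∂μ := by
  obtain ⟨x, hx⟩ := isCompact_univ.exists_isMinOn (Set.univ_nonempty) f.continuous.continuousOn
  refine ⟨x, ?_⟩
  have := integral_mono_C μ (ContinuousMap.const X (f x)) f (fun y => hx.2 (Set.mem_univ y))
  simpa using this

lemma dual_key (p : ℝ) (hp : 1 ≤ p) (ε : ℝ) (hε : 0 ≤ ε) (hε1 : ε ≤ 1) (S : ℝ)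
    (hS : ∀ g, Jf p hp ε μ ν g ≤ S) (φ ψ : C(X, ℝ)) (hφ : ∀ x, 0 ≤ φ x) (hψ : ∀ x, 0 ≤ ψ x)
    (l t : ℝ) (ht : 0 ≤ t) (h : ∀ x y, 0 ≤ φ x + ψ y + l + t * dist x y ^ p) :
    0 ≤ ∫ x, φ x ∂μ + ∫ x, ψ x ∂ν + (1 - ε) * l + t * S := by
  have hS0 : 0 ≤ S := by rw [← J_zero μ ν p hp ε]; exact hS 0
  have i1 : 0 ≤ ∫ x, φ x ∂μ := integral_nonneg hφ
  have i2 : 0 ≤ ∫ x, ψ x ∂ν := integral_nonneg hψ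
  have i3 : 0 ≤ t * S := mul_nonneg ht hS0
  rcases le_total 0 l with hl | hl
  · have : 0 ≤ (1 - ε) * l := mul_nonneg (by linarith) hl
    linarith
  rcases ht.eq_or_lt with rfl | ht
  · obtain ⟨x, hx⟩ := exists_le_integral μ φ
    obtain ⟨y, hy⟩ := exists_le_integral ν ψ
    have := h x y
    nlinarith
  let f : C(X, ℝ) := (-(t⁻¹ • φ)) ⊔ ContinuousMap.const X (t⁻¹ * l)
  have hf : ∀ x, f x = max (-(t⁻¹ * φ x)) (t⁻¹ * l) := fun x => rfl
  have ti : 0 < t⁻¹ := inv_pos.2 ht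
  have h1 : -(t⁻¹ * ∫ x, φ x ∂μ) ≤ ∫ x, f x ∂μ := by
    have := integral_mono_C μ (-(t⁻¹ • φ)) f (fun x => by rw [hf]; exact le_max_left _ _)
    simpa [integral_neg, integral_const_mul] using this
  have h2 : -(t⁻¹ * ∫ x, ψ x ∂ν) - t⁻¹ * l ≤ ∫ x, ctC p hp f x ∂ν := by
    have := integral_le_add_C ν (-(t⁻¹ • ψ)) (ctC p hp f) (t⁻¹ * l) (fun y => by
      have : - (t⁻¹ * ψ y) - t⁻¹ * l ≤ ctC p hp f y := by
        apply le_ctC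
        intro x
        rw [hf]
        have a1 : 0 ≤ dist x y ^ p := Real.rpow_nonneg dist_nonneg _
        have a2 : 0 ≤ t⁻¹ * ψ y := mul_nonneg ti.le (hψ y)
        have a3 : 0 ≤ t⁻¹ * (φ x + ψ y + l + t * dist x y ^ p) := mul_nonneg ti.le (h x y)
        have a4 : t⁻¹ * (φ x + ψ y + l + t * dist x y ^ p)
          = t⁻¹ * φ x + t⁻¹ * ψ y + t⁻¹ * l + dist x y ^ p := by field_simp
        rcases max_cases (-(t⁻¹ * φ x)) (t⁻¹ * l) with ⟨e, _⟩ | ⟨e, _⟩ <;> rw [e] <;> linarith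
      simpa using (by linarith : - (t⁻¹ * ψ y) ≤ ctC p hp f y + t⁻¹ * l))
    have e : ∫ x, (-(t⁻¹ • ψ)) x ∂ν = -(t⁻¹ * ∫ x, ψ x ∂ν) := by
      simp [integral_neg, integral_const_mul]
    rw [e] at this
    linarith
  have h3 : osc f ≤ 0 - t⁻¹ * l := by
    apply osc_le
    · intro x; rw [hf]; exact le_max_right _ _
    · intro x; rw [hf]
      exact max_le (by have := mul_nonneg ti.le (hφ x); linarith)
        (mul_nonpos_of_nonneg_of_nonpos ti.le hl)
  have h4 := mul_le_mul_of_nonneg_left h3 hε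
  have h5 := hS f
  unfold Jf at h5
  have h6 : -(t⁻¹ * ∫ x, φ x ∂μ) + (-(t⁻¹ * ∫ x, ψ x ∂ν) - t⁻¹ * l) - ε * (0 - t⁻¹ * l) ≤ S := by
    linarith
  have h7 := mul_le_mul_of_nonneg_left h6 ht.le
  have e : t * (-(t⁻¹ * ∫ x, φ x ∂μ) + (-(t⁻¹ * ∫ x, ψ x ∂ν) - t⁻¹ * l) - ε * (0 - t⁻¹ * l))
    = -(∫ x, φ x ∂μ) - (∫ x, ψ x ∂ν) - l + ε * l := by field_simp; ring
  rw [e] at h7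
  linarith

/-- prices of super-hedging strategies -/
def prices (p ε S : ℝ) (h : C(X × X, ℝ)) : Set ℝ :=
  {v | ∃ (φ ψ : C(X, ℝ)) (l t : ℝ), (∀ x, 0 ≤ φ x) ∧ (∀ x, 0 ≤ ψ x) ∧ 0 ≤ t ∧
    (∀ x y, h (x, y) ≤ φ x + ψ y + l + t * dist x y ^ p) ∧
    v = ∫ x, φ x ∂μ + ∫ x, ψ x ∂ν + (1 - ε) * l + t * S}

lemma exists_lin (p : ℝ) (hp : 1 ≤ p) (ε : ℝ) (hε : 0 ≤ ε) (hε1 : ε ≤ 1) (S : ℝ)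
    (hS : ∀ g, Jf p hp ε μ ν g ≤ S) :
    ∃ L : C(X × X, ℝ) →ₗ[ℝ] ℝ, ∀ h, ∀ v ∈ prices μ ν p ε S h, L h ≤ v := by
  have hb : ∀ h, ∀ v ∈ prices μ ν p ε S h, -((1 - ε) * ‖h‖) ≤ v := by
    rintro h v ⟨φ, ψ, l, t, hφ, hψ, ht, H, rfl⟩
    have := dual_key μ ν p hp ε hε hε1 S hS φ ψ hφ hψ (l + ‖h‖) t ht (fun x y => by
      have h1 := H x y
      have h2 := (abs_le.1 (h.norm_coe_le_norm (x, y))).1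
      linarith)
    linarith
  have hbdd : ∀ h, BddBelow (prices μ ν p ε S h) := fun h => ⟨_, hb h⟩
  have hne : ∀ h, (prices μ ν p ε S h).Nonempty := by
    intro h
    refine ⟨_, 0, 0, ‖h‖, 0, by simp, by simp, le_rfl, fun x y => ?_, rfl⟩
    simpa using (abs_le.1 (h.norm_coe_le_norm (x, y))).2
  let N : C(X × X, ℝ) → ℝ := fun h => sInf (prices μ ν p ε S h)
  have hom_le : ∀ c : ℝ, 0 < c → ∀ x, N (c • x) ≤ c * N x := by
    intro c hc x
    have : c⁻¹ * N (c • x) ≤ N x := by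
      refine le_csInf (hne x) ?_
      rintro v ⟨φ, ψ, l, t, hφ, hψ, ht, H, rfl⟩
      rw [inv_mul_le_iff₀ hc]
      refine csInf_le (hbdd _) ⟨c • φ, c • ψ, c * l, c * t, fun x => mul_nonneg hc.le (hφ x),
        fun x => mul_nonneg hc.le (hψ x), mul_nonneg hc.le ht, fun a b => ?_, ?_⟩
      · have := mul_le_mul_of_nonneg_left (H a b) hc.le
        simp only [ContinuousMap.smul_apply, smul_eq_mul]
        linarith
      · simp only [ContinuousMap.smul_apply, smul_eq_mul, integral_const_mul]
        ring
    rwa [inv_mul_le_iff₀ hc] at this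
  obtain ⟨L, -, hL⟩ := exists_extension_of_le_sublinear (⊥ : C(X × X, ℝ) →ₗ.[ℝ] ℝ) N
    (by
      intro c hc x
      refine le_antisymm (hom_le c hc x) ?_
      have := hom_le c⁻¹ (inv_pos.2 hc) (c • x)
      rw [smul_smul, inv_mul_cancel₀ hc.ne', one_smul] at this
      rwa [← le_inv_mul_iff₀ hc])
    (by
      intro x y
      have : N (x + y) - N y ≤ N x := by
        refine le_csInf (hne x) ?_
        rintro v ⟨φ, ψ, l, t, hφ, hψ, ht, H, rfl⟩
        rw [sub_le_comm]
        refine le_csInf (hne y) ?_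
        rintro v ⟨φ', ψ', l', t', hφ', hψ', ht', H', rfl⟩
        rw [sub_le_iff_le_add]
        refine csInf_le (hbdd _) ⟨φ + φ', ψ + ψ', l + l', t + t',
          fun x => add_nonneg (hφ x) (hφ' x), fun x => add_nonneg (hψ x) (hψ' x),
          add_nonneg ht ht', fun a b => ?_, ?_⟩
        · have := H a b
          have := H' a b
          simp only [ContinuousMap.add_apply]
          linarith
        · simp only [ContinuousMap.add_apply]
          rw [integral_add (integrable_C μ φ) (integrable_C μ φ'),
            integral_add (integrable_C ν ψ) (integrable_C ν ψ')]
          ring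
      linarith)
    (by
      rintro ⟨x, hx⟩
      have hx' : x = 0 := (Submodule.mem_bot ℝ).1 hx
      subst hx'
      have e : (⊥ : C(X × X, ℝ) →ₗ.[ℝ] ℝ) ⟨0, hx⟩ = 0 := LinearPMap.map_zero _
      rw [e]
      refine le_csInf (hne 0) fun v hv => ?_
      simpa using hb 0 v hv)
  exact ⟨L, fun h v hv => (hL h).trans (csInf_le (hbdd h) hv)⟩

lemma exists_riesz {Y : Type*} [TopologicalSpace Y] [T2Space Y] [CompactSpace Y]
    [MeasurableSpace Y] [BorelSpace Y] (L : C(Y, ℝ) →ₗ[ℝ] ℝ)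
    (hL : ∀ f : C(Y, ℝ), (∀ y, 0 ≤ f y) → 0 ≤ L f) :
    ∃ m : Measure Y, IsFiniteMeasure m ∧ ∀ f : C(Y, ℝ), ∫ y, f y ∂m = L f := by
  let L' : CompactlySupportedContinuousMap Y ℝ →ₗ[ℝ] ℝ :=
    { toFun := fun f => L f.toContinuousMap
      map_add' := fun f g => L.map_add f.toContinuousMap g.toContinuousMap
      map_smul' := fun c f => L.map_smul c f.toContinuousMap }
  let Λ := PositiveLinearMap.mk₀ L' (fun f hf => hL _ hf)
  refine ⟨RealRMK.rieszMeasure Λ, inferInstance, fun f => ?_⟩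
  exact RealRMK.integral_rieszMeasure Λ (CompactlySupportedContinuousMap.continuousMapEquiv f)

lemma le_of_int (m m' : Measure X) [IsFiniteMeasure m] [IsFiniteMeasure m']
    (h : ∀ f : C(X, ℝ), (∀ x, 0 ≤ f x) → ∫ x, f x ∂m ≤ ∫ x, f x ∂m') : m ≤ m' := by
  have hc : ∀ F : Set X, IsClosed F → m F ≤ m' F := by
    intro F hF
    refine le_of_tendsto_of_tendsto' (HasOuterApproxClosed.tendsto_lintegral_apprSeq hF m)
      (HasOuterApproxClosed.tendsto_lintegral_apprSeq hF m') fun n => ?_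
    let f : C(X, ℝ) := ⟨fun x => (hF.apprSeq n x : ℝ), by fun_prop⟩
    have hf : ∀ x, 0 ≤ f x := fun x => NNReal.coe_nonneg _
    have e : ∀ k : Measure X, IsFiniteMeasure k →
        ∫⁻ x, (hF.apprSeq n x : ℝ≥0∞) ∂k = ENNReal.ofReal (∫ x, f x ∂k) := by
      intro k _
      rw [ofReal_integral_eq_lintegral_ofReal (integrable_C k f) (Eventually.of_forall hf)]
      refine lintegral_congr fun x => ?_
      simp [f]
    rw [e m inferInstance, e m' inferInstance]
    exact ENNReal.ofReal_le_ofReal (h f hf)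
  refine Measure.le_iff.2 fun A hA => ?_
  rw [hA.measure_eq_iSup_isClosed_of_ne_top (measure_ne_top m A)]
  exact iSup_le fun F => iSup_le fun hFA => iSup_le fun hF => (hc F hF).trans (measure_mono hFA)

lemma exists_plan (p : ℝ) (hp : 1 ≤ p) (ε : ℝ) (hε : 0 ≤ ε) (hε1 : ε ≤ 1) (S : ℝ)
    (hS : ∀ g, Jf p hp ε μ ν g ≤ S) :
    ∃ π : Measure (X × X), IsFiniteMeasure π ∧ π.map Prod.fst ≤ μ ∧ π.map Prod.snd ≤ ν ∧
      π Set.univ = ENNReal.ofReal (1 - ε) ∧ ∫ z, dist z.1 z.2 ^ p ∂π ≤ S := by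
  obtain ⟨L, hL⟩ := exists_lin μ ν p hp ε hε hε1 S hS
  obtain ⟨π, hπ, hi⟩ := exists_riesz L (by
    intro f hf
    have := hL (-f) _ ⟨0, 0, 0, 0, by simp, by simp, le_rfl, fun x y => by simpa using hf (x, y), rfl⟩
    simpa using this)
  refine ⟨π, hπ, ?_, ?_, ?_, ?_⟩
  · apply le_of_int
    intro φ hφ
    rw [integral_map measurable_fst.aemeasurable φ.continuous.aestronglyMeasurable]
    have := hi (φ.comp ⟨Prod.fst, continuous_fst⟩)
    simp only [ContinuousMap.comp_apply, ContinuousMap.coe_mk] at this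
    rw [this]
    have := hL (φ.comp ⟨Prod.fst, continuous_fst⟩) _
      ⟨φ, 0, 0, 0, hφ, by simp, le_rfl, fun x y => by simp, rfl⟩
    simpa using this
  · apply le_of_int
    intro φ hφ
    rw [integral_map measurable_snd.aemeasurable φ.continuous.aestronglyMeasurable]
    have := hi (φ.comp ⟨Prod.snd, continuous_snd⟩)
    simp only [ContinuousMap.comp_apply, ContinuousMap.coe_mk] at this
    rw [this]
    have := hL (φ.comp ⟨Prod.snd, continuous_snd⟩) _
      ⟨0, φ, 0, 0, by simp, hφ, le_rfl, fun x y => by simp, rfl⟩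
    simpa using this
  · have h1 := hL 1 _ ⟨0, 0, 1, 0, by simp, by simp, le_rfl, fun x y => by simp, rfl⟩
    have h2 := hL (-1) _ ⟨0, 0, -1, 0, by simp, by simp, le_rfl, fun x y => by simp, rfl⟩
    have h3 := hi 1
    simp only [map_neg, ContinuousMap.zero_apply, ContinuousMap.one_apply, integral_zero,
      integral_const, smul_eq_mul, mul_one, zero_mul] at h1 h2 h3
    rw [← ENNReal.ofReal_toReal (measure_ne_top π Set.univ)]
    congr 1
    change π.real Set.univ = _
    linarith
  · have := hL (costC p hp) _ ⟨0, 0, 0, 1, by simp, by simp, zero_le_one, fun x y => by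
      simp [costC], rfl⟩
    rw [← hi] at this
    simpa [costC] using this

lemma elp (p : ℝ) (hp : 1 ≤ p) (P : Measure (X × X)) [IsFiniteMeasure P] :
    eLpNorm (fun z : X × X => dist z.1 z.2) (ENNReal.ofReal p) P
      = ENNReal.ofReal ((∫ z, dist z.1 z.2 ^ p ∂P) ^ p⁻¹) := by
  have hc : Continuous fun z : X × X => dist z.1 z.2 := continuous_fst.dist continuous_snd
  have hm : MemLp (fun z : X × X => dist z.1 z.2) (ENNReal.ofReal p) P := by
    refine MemLp.of_bound hc.aestronglyMeasurable (Metric.diam (Set.univ : Set X))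
      (Eventually.of_forall fun z => ?_)
    rw [Real.norm_of_nonneg dist_nonneg]
    exact Metric.dist_le_diam_of_mem isCompact_univ.isBounded (Set.mem_univ _) (Set.mem_univ _)
  rw [hm.eLpNorm_eq_integral_rpow_norm (by simp; linarith) (by simp)]
  rw [ENNReal.toReal_ofReal (by linarith)]
  simp_rw [Real.norm_of_nonneg (dist_nonneg)]

lemma RWp_upper (p : ℝ) (hp : 1 ≤ p) (ε : ℝ) (hε : 0 ≤ ε) (hε1 : ε < 1) (S : ℝ)
    (hS : ∀ g, Jf p hp ε μ ν g ≤ S) :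
    RWp (ENNReal.ofReal p) ε μ ν ≤ ENNReal.ofReal ((S / (1 - ε)) ^ p⁻¹) := by
  obtain ⟨π, hπ, h1, h2, h3, h4⟩ := exists_plan μ ν p hp ε hε hε1.le S hS
  have hpos : 0 < 1 - ε := by linarith
  have m1 : π.map Prod.fst Set.univ = ENNReal.ofReal (1 - ε) := by
    rw [Measure.map_apply measurable_fst MeasurableSet.univ, Set.preimage_univ, h3]
  have m2 : π.map Prod.snd Set.univ = ENNReal.ofReal (1 - ε) := by
    rw [Measure.map_apply measurable_snd MeasurableSet.univ, Set.preimage_univ, h3]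
  have e1 : (1 : ℝ≥0∞) - ENNReal.ofReal (1 - ε) ≤ ENNReal.ofReal ε := by
    rw [← ENNReal.ofReal_one, ← ENNReal.ofReal_sub _ hpos.le]
    exact ENNReal.ofReal_le_ofReal (by linarith)
  unfold RWp
  refine iInf_le_of_le (π.map Prod.fst) <| iInf_le_of_le (π.map Prod.snd) <|
    iInf_le_of_le h1 <| iInf_le_of_le h2 <| iInf_le_of_le ?_ <| iInf_le_of_le ?_ ?_
  · rw [Measure.sub_apply MeasurableSet.univ h1, m1, measure_univ]; exact e1
  · rw [Measure.sub_apply MeasurableSet.univ h2, m2, measure_univ]; exact e1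
  rw [m1, m2]
  have hne : (ENNReal.ofReal (1 - ε))⁻¹ ≠ ⊤ := by simpa using hε1
  have : IsFiniteMeasure ((ENNReal.ofReal (1 - ε))⁻¹ • π) := Measure.smul_finite π hne
  unfold Wp
  refine iInf₂_le_of_le ((ENNReal.ofReal (1 - ε))⁻¹ • π) ⟨?_, ?_⟩ ?_
  · rw [Measure.map_smul]
  · rw [Measure.map_smul]
  rw [elp p hp]
  apply ENNReal.ofReal_le_ofReal
  have i0 : 0 ≤ ∫ z, dist z.1 z.2 ^ p ∂π :=
    integral_nonneg fun z => Real.rpow_nonneg dist_nonneg _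
  rw [integral_smul_measure, ENNReal.toReal_inv, ENNReal.toReal_ofReal hpos.le, smul_eq_mul]
  apply Real.rpow_le_rpow
  · positivity
  · rw [div_eq_inv_mul]
    exact mul_le_mul_of_nonneg_left h4 (by positivity)
  · positivity

lemma norm_mass (ε : ℝ) (hε1 : ε < 1) (μ' : Measure X) (h : μ' ≤ μ)
    (hm : (μ - μ') Set.univ ≤ ENNReal.ofReal ε) (hε : 0 ≤ ε) :
    IsProbabilityMeasure ((μ' Set.univ)⁻¹ • μ') ∧
    ∀ f : C(X, ℝ), ∀ s : ℝ, (∀ x, f x ≤ s) →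
      (1 - ε) * (s - ∫ x, f x ∂((μ' Set.univ)⁻¹ • μ')) ≤ s - ∫ x, f x ∂μ := by
  have : IsFiniteMeasure μ' := isFiniteMeasure_of_le μ h
  rw [Measure.sub_apply MeasurableSet.univ h, measure_univ] at hm
  have hr : 1 - ε ≤ μ'.real Set.univ := by
    have h1 : (1 : ℝ≥0∞) ≤ ENNReal.ofReal ε + μ' Set.univ := tsub_le_iff_right.1 hm
    have := ENNReal.toReal_mono (by simp) h1
    rw [ENNReal.toReal_add (by simp) (by simp), ENNReal.toReal_ofReal hε] at this
    simp only [ENNReal.toReal_one] at this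
    change 1 ≤ ε + μ'.real Set.univ at this
    linarith
  have hpos : 0 < μ'.real Set.univ := by linarith
  have h0 : μ' Set.univ ≠ 0 := by
    intro h0; simp [Measure.real, h0] at hpos
  refine ⟨⟨?_⟩, fun f s hs => ?_⟩
  · rw [Measure.smul_apply, smul_eq_mul, ENNReal.inv_mul_cancel h0 (by simp)]
  · have k1 : ∫ x, (s - f x) ∂μ' ≤ ∫ x, (s - f x) ∂μ :=
      integral_mono_measure h (Eventually.of_forall fun x => sub_nonneg.2 (hs x))
        ((integrable_const s).sub (integrable_C μ f))
    have k2 : ∫ x, (s - f x) ∂μ = s - ∫ x, f x ∂μ := by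
      rw [integral_sub (integrable_const s) (integrable_C μ f)]; simp
    have k3 : ∫ x, (s - f x) ∂μ' = μ'.real Set.univ * s - ∫ x, f x ∂μ' := by
      rw [integral_sub (integrable_const s) (integrable_C μ' f)]; simp
    have k4 : 0 ≤ ∫ x, (s - f x) ∂μ' := integral_nonneg fun x => sub_nonneg.2 (hs x)
    rw [integral_smul_measure, ENNReal.toReal_inv, smul_eq_mul]
    change (1 - ε) * (s - (μ'.real Set.univ)⁻¹ * ∫ x, f x ∂μ') ≤ _
    have k5 : s - (μ'.real Set.univ)⁻¹ * ∫ x, f x ∂μ'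
      = (μ'.real Set.univ)⁻¹ * ∫ x, (s - f x) ∂μ' := by rw [k3]; field_simp
    rw [k5, ← mul_assoc]
    have k6 : (1 - ε) * (μ'.real Set.univ)⁻¹ ≤ 1 := by
      rw [mul_inv_le_iff₀ hpos]; linarith
    have := mul_le_mul_of_nonneg_right k6 k4
    linarith

lemma ct_sup (p : ℝ) (hp : 1 ≤ p) (f : C(X, ℝ)) (y : X) : ctC p hp f y ≤ -(⨅ x, f x) := by
  linarith [ctC_le_neg p hp f y, inf_le_C f y]

lemma RWp_lower (p : ℝ) (hp : 1 ≤ p) (ε : ℝ) (hε : 0 ≤ ε) (hε1 : ε < 1) (f : C(X, ℝ))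
    (hJ : 0 ≤ Jf p hp ε μ ν f) :
    ENNReal.ofReal ((Jf p hp ε μ ν f / (1 - ε)) ^ p⁻¹) ≤ RWp (ENNReal.ofReal p) ε μ ν := by
  have hpos : 0 < 1 - ε := by linarith
  unfold RWp
  refine le_iInf fun μ' => le_iInf fun ν' => le_iInf fun h1 => le_iInf fun h2 =>
    le_iInf fun h3 => le_iInf fun h4 => ?_
  obtain ⟨P1, k1⟩ := norm_mass μ ε hε1 μ' h1 h3 hε
  obtain ⟨P2, k2⟩ := norm_mass ν ε hε1 ν' h2 h4 hε
  unfold Wp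
  refine le_iInf₂ fun π hπ => ?_
  obtain ⟨c1, c2⟩ := hπ
  have hπp : IsProbabilityMeasure π := by
    constructor
    have := P1.measure_univ
    rwa [← c1, Measure.map_apply measurable_fst MeasurableSet.univ, Set.preimage_univ] at this
  rw [elp p hp]
  apply ENNReal.ofReal_le_ofReal
  apply Real.rpow_le_rpow (by positivity) _ (by positivity)
  rw [div_le_iff₀' hpos]
  have a1 := k1 f _ (le_sup_C f)
  have a2 := k2 (ctC p hp f) _ (ct_sup p hp f)
  rw [← c1, integral_map measurable_fst.aemeasurable f.continuous.aestronglyMeasurable] at a1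
  rw [← c2, integral_map measurable_snd.aemeasurable
    (ctC p hp f).continuous.aestronglyMeasurable] at a2
  have i1 : Integrable (fun z : X × X => f z.1) π :=
    integrable_C π (f.comp ⟨Prod.fst, continuous_fst⟩)
  have i2 : Integrable (fun z : X × X => ctC p hp f z.2) π :=
    integrable_C π ((ctC p hp f).comp ⟨Prod.snd, continuous_snd⟩)
  have a3 : ∫ z, f z.1 ∂π + ∫ z, ctC p hp f z.2 ∂π ≤ ∫ z, dist z.1 z.2 ^ p ∂π := by
    rw [← integral_add i1 i2]
    refine integral_mono (i1.add i2) (integrable_C π (costC p hp)) fun z => ?_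
    have := ctC_le p hp f z.1 z.2
    simp only [Pi.add_apply]
    linarith
  have a4 := mul_le_mul_of_nonneg_left a3 hpos.le
  unfold Jf osc
  nlinarith

lemma J_le_zero (p : ℝ) (hp : 1 ≤ p) (f : C(X, ℝ)) : Jf p hp 1 μ ν f ≤ 0 := by
  have h1 := integral_mono_C μ f (ContinuousMap.const X (⨆ x, f x)) (le_sup_C f)
  have h2 := integral_mono_C ν (ctC p hp f) (ContinuousMap.const X (-(⨅ x, f x))) (ct_sup p hp f)
  simp only [ContinuousMap.const_apply, integral_const, probReal_univ, smul_eq_mul, one_mul]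
    at h1 h2
  unfold Jf osc
  linarith

lemma main_eq (p : ℝ) (hp : 1 ≤ p) (ε : ℝ) (hε : 0 ≤ ε) (hε1 : ε ≤ 1) (f : C(X, ℝ))
    (hf : ∀ g, Jf p hp ε μ ν g ≤ Jf p hp ε μ ν f) :
    (1 - ε) * (RWp (ENNReal.ofReal p) ε μ ν).toReal ^ p = Jf p hp ε μ ν f := by
  have h0 : 0 ≤ Jf p hp ε μ ν f := by rw [← J_zero μ ν p hp ε]; exact hf 0
  rcases hε1.eq_or_lt with rfl | hlt
  · rw [sub_self, zero_mul]
    exact le_antisymm h0 (J_le_zero μ ν p hp f)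
  have hpos : 0 < 1 - ε := by linarith
  rw [le_antisymm (RWp_upper μ ν p hp ε hε hlt _ hf) (RWp_lower μ ν p hp ε hε hlt f h0),
    ENNReal.toReal_ofReal (by positivity), Real.rpow_inv_rpow (by positivity) (by linarith)]
  field_simp

lemma osc_le_norm (f : C(X, ℝ)) : osc f ≤ 2 * ‖f‖ := by
  have := osc_le f (-‖f‖) ‖f‖ (fun x => (abs_le.1 (f.norm_coe_le_norm x)).1)
    (fun x => (abs_le.1 (f.norm_coe_le_norm x)).2)
  linarith

lemma norm_le_osc (f : C(X, ℝ)) :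
    2 * ‖f + ContinuousMap.const X (-((⨆ x, f x) + ⨅ x, f x) / 2)‖ ≤ osc f := by
  have h : ∀ x, |(f + ContinuousMap.const X (-((⨆ x, f x) + ⨅ x, f x) / 2)) x| ≤ osc f / 2 := by
    intro x
    rw [abs_le]
    simp only [ContinuousMap.add_apply, ContinuousMap.const_apply, osc]
    constructor <;> linarith [le_sup_C f x, inf_le_C f x]
  have := (ContinuousMap.norm_le_of_nonempty
    (f + ContinuousMap.const X (-((⨆ x, f x) + ⨅ x, f x) / 2))).2 h
  linarith

end aux

/-- dual form: on a compact metric space, for `p ∈ [1,∞)` and `ε ∈ [0,1]`,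
`(1−ε)·W_p^ε(μ,ν)^p = sup_f [∫ f dμ + ∫ f^c dν − 2ε‖f‖_∞]
                    = sup_f [∫ f dμ + ∫ f^c dν − ε·(sup f − inf f)]`,
with the suprema achieved by some continuous `f` with `f = (f^c)^c`. -/
theorem RWp_dual_form {X : Type*} [MetricSpace X] [CompactSpace X] [Nonempty X]
    [MeasurableSpace X] [BorelSpace X]
    (p : ℝ) (hp : 1 ≤ p) (ε : ℝ) (hε0 : 0 ≤ ε) (hε1 : ε ≤ 1)
    (μ ν : Measure X) [IsProbabilityMeasure μ] [IsProbabilityMeasure ν] :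
    (1 - ε) * (RWp (ENNReal.ofReal p) ε μ ν).toReal ^ p
        = (⨆ f : C(X, ℝ), (∫ x, f x ∂μ + ∫ y, ctrans p f y ∂ν - 2 * ε * ‖f‖)) ∧
    (1 - ε) * (RWp (ENNReal.ofReal p) ε μ ν).toReal ^ p
        = (⨆ f : C(X, ℝ),
            (∫ x, f x ∂μ + ∫ y, ctrans p f y ∂ν - ε * ((⨆ x, f x) - ⨅ x, f x))) ∧
    ∃ f : C(X, ℝ), ⇑f = ctrans p (ctrans p ⇑f) ∧
      (1 - ε) * (RWp (ENNReal.ofReal p) ε μ ν).toReal ^ p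
        = ∫ x, f x ∂μ + ∫ y, ctrans p f y ∂ν - ε * ((⨆ x, f x) - ⨅ x, f x) := by
  obtain ⟨f, hcc, hmax⟩ := exists_max μ ν p hp ε hε0
  have hval := main_eq μ ν p hp ε hε0 hε1 f hmax
  refine ⟨?_, ?_, f, ?_, hval⟩
  · rw [hval]
    have hle : ∀ g : C(X, ℝ), ∫ x, g x ∂μ + ∫ y, ctrans p g y ∂ν - 2 * ε * ‖g‖
        ≤ Jf p hp ε μ ν f := by
      intro g
      refine le_trans ?_ (hmax g)
      have := mul_le_mul_of_nonneg_left (osc_le_norm g) hε0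
      change _ ≤ ∫ x, g x ∂μ + ∫ y, ctrans p g y ∂ν - ε * osc g
      linarith
    refine le_antisymm ?_ (ciSup_le hle)
    refine le_ciSup_of_le ⟨_, Set.forall_mem_range.2 hle⟩
      (f + ContinuousMap.const X (-((⨆ x, f x) + ⨅ x, f x) / 2)) ?_
    have h1 := mul_le_mul_of_nonneg_left (norm_le_osc f) hε0
    have h2 := osc_le_norm (f + ContinuousMap.const X (-((⨆ x, f x) + ⨅ x, f x) / 2))
    have h4 : osc f ≤ osc (f + ContinuousMap.const X (-((⨆ x, f x) + ⨅ x, f x) / 2)) := by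
      set g := f + ContinuousMap.const X (-((⨆ x, f x) + ⨅ x, f x) / 2) with hg
      have e : ∀ x, g x = f x + (-((⨆ x, f x) + ⨅ x, f x) / 2) := fun x => rfl
      have := osc_le f ((⨅ x, g x) - (-((⨆ x, f x) + ⨅ x, f x) / 2))
        ((⨆ x, g x) - (-((⨆ x, f x) + ⨅ x, f x) / 2))
        (fun x => by linarith [inf_le_C g x, e x]) (fun x => by linarith [le_sup_C g x, e x])
      refine this.trans (le_of_eq ?_)
      unfold osc
      ring
    have h5 := mul_le_mul_of_nonneg_left h4 hε0
    rw [← J_const μ ν p hp ε hε0 f (-((⨆ x, f x) + ⨅ x, f x) / 2)]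
    set g := f + ContinuousMap.const X (-((⨆ x, f x) + ⨅ x, f x) / 2)
    change ∫ x, g x ∂μ + ∫ y, ctrans p g y ∂ν - ε * osc g ≤ _
    linarith
  · rw [hval]
    refine le_antisymm ?_ (ciSup_le hmax)
    exact le_ciSup (f := fun g => Jf p hp ε μ ν g) ⟨_, Set.forall_mem_range.2 hmax⟩ f
  · exact congrArg (fun g : C(X, ℝ) => (g : X → ℝ)) hcc.symm

end
end

section
/- (Loss trimming dual.) Let (X,d) be a compact metric space and p ∈ [1,∞). Let μ and ν be uniform distributions over n points each, and let ε ∈ [0,1] be a multiple of 1/n. Then W_p^ε(μ,ν)^p = sup over continuous bounded f : X → ℝ of [ min over subsets A ⊆ supp(μ) with |A| = (1−ε)n of (1/|A|)·Σ_{x∈A} f(x) + min over subsets B ⊆ supp(ν) with |B| = (1−ε)n of (1/|B|)·Σ_{y∈B} f^c(y) ], where f^c(y) = inf_{x∈X}(d(x,y)^p − f(x)). -/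
open MeasureTheory ENNReal Filter Topology

noncomputable section

variable {X : Type*} [MetricSpace X] [MeasurableSpace X] [BorelSpace X]

lemma aux_sep {ι I : Type*} [Fintype ι] [Fintype I] (a : ι → I → ℝ) (c : ι → ℝ) (R : ℝ)
    (h : ∀ w : ι → ℝ, (∀ i, 0 ≤ w i) → ∑ i, w i = 1 → (∀ x, ∑ i, w i * a i x = 0) →
      R < ∑ i, w i * c i) :
    ∃ (f : I → ℝ) (τ : ℝ), 0 ≤ τ ∧ ∀ i, τ * R < τ * c i - ∑ x, f x * a i x := by
  classical
  let Lm : (ι → ℝ) →ₗ[ℝ] ((I → ℝ) × ℝ) :=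
    { toFun := fun w => (fun x => ∑ i, w i * a i x, ∑ i, w i * c i)
      map_add' := by
        intro u v
        ext <;> simp [add_mul, Finset.sum_add_distrib]
      map_smul' := by
        intro r v
        ext <;> simp [mul_assoc, Finset.mul_sum] }
  have hLc : Continuous Lm := by
    refine Continuous.prodMk ?_ ?_
    · exact continuous_pi fun x => by fun_prop
    · fun_prop
  have hcomp : IsCompact (Lm '' stdSimplex ℝ ι) := (isCompact_stdSimplex ℝ ι).image hLc
  have hconv : Convex ℝ (Lm '' stdSimplex ℝ ι) := (convex_stdSimplex ℝ ι).linear_image Lm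
  have hD : Convex ℝ (({0} : Set (I → ℝ)) ×ˢ Set.Iic R) := (convex_singleton _).prod (convex_Iic R)
  have hDc : IsClosed (({0} : Set (I → ℝ)) ×ˢ Set.Iic R) := isClosed_singleton.prod isClosed_Iic
  have hdis : Disjoint (Lm '' stdSimplex ℝ ι) (({0} : Set (I → ℝ)) ×ˢ Set.Iic R) := by
    rw [Set.disjoint_left]
    rintro _ ⟨w, hw, rfl⟩ ⟨h1, h2⟩
    have := h w hw.1 hw.2 (fun x => congrFun h1 x)
    exact absurd this (not_lt.2 h2)
  obtain ⟨φ, u, v, h1, huv, h2⟩ := geometric_hahn_banach_compact_closed hconv hcomp hD hDc hdis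
  have hφ : ∀ (g : I → ℝ) (r : ℝ), φ (g, r) =
      ∑ x, g x * φ (fun j => if x = j then 1 else 0, 0) + r * φ (0, 1) := by
    intro g r
    have e1 : (g, r) = (g, (0:ℝ)) + r • ((0 : I → ℝ), (1:ℝ)) := by ext <;> simp
    rw [e1, map_add, map_smul]
    have := LinearMap.pi_apply_eq_sum_univ (φ.toLinearMap ∘ₗ LinearMap.inl ℝ (I → ℝ) ℝ) g
    simp at this
    rw [this]; simp
  have hτ : φ (0, 1) ≤ 0 := by
    by_contra hcon
    push Not at hcon
    have := h2 ((0 : I → ℝ), min R (v / φ (0,1))) ⟨rfl, Set.mem_Iic.2 (min_le_left _ _)⟩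
    rw [hφ] at this
    simp only [Pi.zero_apply, zero_mul, Finset.sum_const_zero, zero_add] at this
    have h3 : min R (v / φ (0,1)) * φ (0,1) ≤ v / φ (0,1) * φ (0,1) :=
      mul_le_mul_of_nonneg_right (min_le_right _ _) hcon.le
    rw [div_mul_cancel₀ _ hcon.ne'] at h3
    linarith
  refine ⟨fun x => φ (fun j => if x = j then 1 else 0, 0), - φ (0,1), by linarith, fun i => ?_⟩
  have h3 := h1 _ ⟨Pi.single i 1, single_mem_stdSimplex ℝ i, rfl⟩
  have h4 := h2 ((0 : I → ℝ), R) ⟨rfl, le_refl R⟩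
  have h5 : Lm (Pi.single i 1) = (a i, c i) := by
    ext <;> simp [Lm, Pi.single_apply]
  rw [h5, hφ] at h3
  rw [hφ] at h4
  simp only [Pi.zero_apply, zero_mul, Finset.sum_const_zero, zero_add] at h4
  have h6 : ∑ x, φ (fun j => if x = j then 1 else 0, 0) * a i x
    = ∑ x, a i x * φ (fun j => if x = j then 1 else 0, 0) :=
    Finset.sum_congr rfl fun _ _ => mul_comm _ _
  rw [h6]; linarith

lemma aux_lp {X : Type*} (S T : Finset X) (m : ℕ) (hm : 0 < m)
    (hS : m ≤ S.card) (hT : m ≤ T.card) (c : X → X → ℝ) (R : ℝ)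
    (h : ∀ w : (↥S × ↥T × ↥(S.powersetCard m) × ↥(T.powersetCard m)) → ℝ,
      (∀ i, 0 ≤ w i) → ∑ i, w i = 1 →
      (∀ g : X → ℝ, ∑ i, w i * (g i.1 - (m:ℝ)⁻¹ * ∑ x ∈ i.2.2.1.1, g x) = 0) →
      (∀ g : X → ℝ, ∑ i, w i * (g i.2.1 - (m:ℝ)⁻¹ * ∑ x ∈ i.2.2.2.1, g x) = 0) →
      R < ∑ i, w i * c i.1 i.2.1) :
    ∃ f g : X → ℝ, ∀ x ∈ S, ∀ y ∈ T, ∀ A ⊆ S, A.card = m → ∀ B ⊆ T, B.card = m →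
      R < c x y - f x - g y + (m:ℝ)⁻¹ * ∑ x ∈ A, f x + (m:ℝ)⁻¹ * ∑ x ∈ B, g x := by
  classical
  let aS : (Finset X) → X → X → ℝ := fun A x z =>
    (if z = x then 1 else 0) - (m:ℝ)⁻¹ * (if z ∈ A then 1 else 0)
  have key : ∀ (S A : Finset X) (x : X), A ⊆ S → x ∈ S → ∀ g : X → ℝ,
      ∑ z : S, g z * aS A x z = g x - (m:ℝ)⁻¹ * ∑ x ∈ A, g x := by
    intro S A x hA hx g
    rw [Finset.sum_coe_sort S (fun z => g z * aS A x z)]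
    simp only [aS, mul_sub, Finset.sum_sub_distrib, mul_ite, mul_one, mul_zero]
    rw [Finset.sum_ite_eq' S x]
    simp only [hx, if_true]
    congr 1
    rw [← Finset.sum_filter, Finset.mul_sum, Finset.filter_mem_eq_inter,
      Finset.inter_eq_right.2 hA]
    exact Finset.sum_congr rfl fun _ _ => mul_comm _ _
  obtain ⟨F, τ, hτ, hF⟩ := aux_sep (ι := ↥S × ↥T × ↥(S.powersetCard m) × ↥(T.powersetCard m))
    (I := ↥S ⊕ ↥T)
    (fun i => Sum.elim (fun z => aS i.2.2.1.1 i.1 z) (fun z => aS i.2.2.2.1 i.2.1 z))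
    (fun i => c i.1 i.2.1) R (by
      intro w hw0 hw1 hw
      refine h w hw0 hw1 ?_ ?_
      · intro g
        have : ∀ i : (↥S × ↥T × ↥(S.powersetCard m) × ↥(T.powersetCard m)),
          w i * (g i.1 - (m:ℝ)⁻¹ * ∑ x ∈ i.2.2.1.1, g x)
            = ∑ z : S, g z * (w i * aS i.2.2.1.1 i.1 z) := by
          intro i
          rw [← key S i.2.2.1.1 i.1 (Finset.mem_powersetCard.1 i.2.2.1.2).1 i.1.2, Finset.mul_sum]
          exact Finset.sum_congr rfl fun _ _ => by ring
        rw [Finset.sum_congr rfl fun i _ => this i, Finset.sum_comm]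
        refine Finset.sum_eq_zero fun z _ => ?_
        rw [← Finset.mul_sum]
        have := hw (Sum.inl z)
        simp only [Sum.elim_inl] at this
        rw [this, mul_zero]
      · intro g
        have : ∀ i : (↥S × ↥T × ↥(S.powersetCard m) × ↥(T.powersetCard m)),
          w i * (g i.2.1 - (m:ℝ)⁻¹ * ∑ x ∈ i.2.2.2.1, g x)
            = ∑ z : T, g z * (w i * aS i.2.2.2.1 i.2.1 z) := by
          intro i
          rw [← key T i.2.2.2.1 i.2.1 (Finset.mem_powersetCard.1 i.2.2.2.2).1 i.2.1.2,
            Finset.mul_sum]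
          exact Finset.sum_congr rfl fun _ _ => by ring
        rw [Finset.sum_congr rfl fun i _ => this i, Finset.sum_comm]
        refine Finset.sum_eq_zero fun z _ => ?_
        rw [← Finset.mul_sum]
        have := hw (Sum.inr z)
        simp only [Sum.elim_inr] at this
        rw [this, mul_zero])
  let f : X → ℝ := fun x => if hx : x ∈ S then F (Sum.inl ⟨x, hx⟩) else 0
  let g : X → ℝ := fun x => if hx : x ∈ T then F (Sum.inr ⟨x, hx⟩) else 0
  have hFf : ∀ z : S, F (Sum.inl z) = f z := fun z => by simp [f]
  have hFg : ∀ z : T, F (Sum.inr z) = g z := fun z => by simp [g]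
  have main : ∀ x ∈ S, ∀ y ∈ T, ∀ A ⊆ S, A.card = m → ∀ B ⊆ T, B.card = m →
      τ * R < τ * c x y - f x - g y + (m:ℝ)⁻¹ * ∑ x ∈ A, f x + (m:ℝ)⁻¹ * ∑ x ∈ B, g x := by
    intro x hx y hy A hA hAc B hB hBc
    have := hF (⟨x, hx⟩, ⟨y, hy⟩, ⟨A, Finset.mem_powersetCard.2 ⟨hA, hAc⟩⟩,
      ⟨B, Finset.mem_powersetCard.2 ⟨hB, hBc⟩⟩)
    simp only [Fintype.sum_sum_type, Sum.elim_inl, Sum.elim_inr, hFf, hFg] at this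
    rw [key S A x hA hx, key T B y hB hy] at this
    linarith
  have hτ0 : 0 < τ := by
    rcases hτ.lt_or_eq with h0 | h0
    · exact h0
    exfalso
    obtain ⟨A, hA, hAc⟩ := Finset.exists_subset_card_eq hS
    obtain ⟨B, hB, hBc⟩ := Finset.exists_subset_card_eq hT
    have hmR : (0:ℝ) < m := by exact_mod_cast hm
    have av : ∀ (A : Finset X) (f : X → ℝ), A.card = m →
        ∃ x ∈ A, (m:ℝ)⁻¹ * ∑ x ∈ A, f x ≤ f x := by
      intro A f hAc
      have hne : A.Nonempty := Finset.card_pos.1 (by omega)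
      obtain ⟨x, hx, hmax⟩ := Finset.exists_max_image A f hne
      refine ⟨x, hx, ?_⟩
      have := Finset.sum_le_card_nsmul A f (f x) hmax
      rw [hAc, nsmul_eq_mul] at this
      rw [inv_mul_le_iff₀ hmR]; exact this
    obtain ⟨x, hx, hx'⟩ := av A f hAc
    obtain ⟨y, hy, hy'⟩ := av B g hBc
    have := main x (hA hx) y (hB hy) A hA hAc B hB hBc
    rw [← h0] at this
    linarith
  refine ⟨fun x => τ⁻¹ * f x, fun x => τ⁻¹ * g x, ?_⟩
  intro x hx y hy A hA hAc B hB hBc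
  have := main x hx y hy A hA hAc B hB hBc
  simp only [← Finset.mul_sum]
  have h3 := mul_lt_mul_of_pos_left this (inv_pos.2 hτ0)
  rw [inv_mul_cancel_left₀ hτ0.ne'] at h3
  have h4 : τ⁻¹ * (τ * c x y) = c x y := inv_mul_cancel_left₀ hτ0.ne' _
  calc R < _ := h3
    _ = _ := by linear_combination h4

/-- there is a set of `m` smallest values -/
lemma aux_small {X : Type*} (S : Finset X) (f : X → ℝ) (m : ℕ) (hm : m ≤ S.card) :
    ∃ A ⊆ S, A.card = m ∧ ∀ x ∈ A, ∀ y ∈ S, y ∉ A → f x ≤ f y := by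
  classical
  induction m with
  | zero => exact ⟨∅, by simp, by simp, by simp⟩
  | succ m ih =>
    obtain ⟨A, hA, hAc, h⟩ := ih (by omega)
    have hne : (S \ A).Nonempty := by
      rw [← Finset.card_pos, Finset.card_sdiff_of_subset hA]; omega
    obtain ⟨z, hz, hmin⟩ := Finset.exists_min_image (S \ A) f hne
    rw [Finset.mem_sdiff] at hz
    refine ⟨insert z A, Finset.insert_subset hz.1 hA, by simp [hz.2, hAc], ?_⟩
    intro x hx y hy hyA
    rw [Finset.mem_insert, not_or] at hyA
    rcases Finset.mem_insert.1 hx with rfl | hx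
    · exact hmin y (Finset.mem_sdiff.2 ⟨hy, hyA.2⟩)
    · exact h x hx y hy hyA.2

lemma aux_trim {X : Type*} (S : Finset X) (f a : X → ℝ) (m : ℕ) (hm0 : 0 < m) (hm : m ≤ S.card)
    (ha0 : ∀ x ∈ S, 0 ≤ a x) (ha1 : ∀ x ∈ S, a x ≤ (m:ℝ)⁻¹) (hsum : ∑ x ∈ S, a x = 1) :
    (⨅ A : {A : Finset X // A ⊆ S ∧ A.card = m}, (A.1.card : ℝ)⁻¹ * ∑ x ∈ A.1, f x)
      ≤ ∑ x ∈ S, a x * f x := by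
  classical
  obtain ⟨A, hA, hAc, hsm⟩ := aux_small S f m hm
  have hfin : Finite {A : Finset X // A ⊆ S ∧ A.card = m} :=
    Finite.of_injective (fun A => (⟨A.1, Finset.mem_powerset.2 A.2.1⟩ : ↥S.powerset))
      (fun A B h => Subtype.ext (by simpa using h))
  refine (ciInf_le (Set.finite_range _).bddBelow ⟨A, hA, hAc⟩).trans ?_
  have hne : A.Nonempty := Finset.card_pos.1 (by omega)
  obtain ⟨z, hz, hmax⟩ := Finset.exists_max_image A f hne
  have hmR : (0:ℝ) < m := by exact_mod_cast hm0
  have h1 : ∑ x ∈ S, a x * (f x - f z) = ∑ x ∈ S, a x * f x - f z := by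
    simp only [mul_sub, Finset.sum_sub_distrib, ← Finset.sum_mul, hsum, one_mul]
  have h2 : ∑ x ∈ A, (m:ℝ)⁻¹ * (f x - f z) = (m:ℝ)⁻¹ * ∑ x ∈ A, f x - f z := by
    simp only [← Finset.mul_sum, Finset.sum_sub_distrib, Finset.sum_const, hAc, nsmul_eq_mul]
    field_simp
  have h3 : ∑ x ∈ A, (m:ℝ)⁻¹ * (f x - f z) ≤ ∑ x ∈ A, a x * (f x - f z) :=
    Finset.sum_le_sum fun x hx =>
      mul_le_mul_of_nonpos_right (ha1 x (hA hx)) (by linarith [hmax x hx])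
  have h4 : ∑ x ∈ A, a x * (f x - f z) ≤ ∑ x ∈ S, a x * (f x - f z) := by
    refine Finset.sum_le_sum_of_subset_of_nonneg hA fun x hx hxA => ?_
    exact mul_nonneg (ha0 x hx) (by linarith [hsm z hz x hx hxA])
  simp only [hAc]
  linarith

lemma aux_mu_univ {X : Type*} [MeasurableSpace X] (S : Finset X) (n : ℕ) (hn : 0 < n)
    (hS : S.card = n) (μ : Measure X)
    (hμ : μ = (n : ℝ≥0∞)⁻¹ • ∑ x ∈ S, Measure.dirac x) : μ Set.univ = 1 := by
  rw [hμ]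
  simp [hS]
  exact ENNReal.inv_mul_cancel (by exact_mod_cast hn.ne') (by simp)

lemma aux_side {X : Type*} [MeasurableSpace X] (n m k : ℕ) (hm : 0 < m) (hnm : n = m + k)
    (S : Finset X) (hS : S.card = n) (μ : Measure X)
    (hμ : μ = (n : ℝ≥0∞)⁻¹ • ∑ x ∈ S, Measure.dirac x) (ε : ℝ) (hε : ε = (k : ℝ) / n)
    {ι : Type*} [Fintype ι] (w : ι → ℝ) (hw0 : ∀ i, 0 ≤ w i) (hw1 : ∑ i, w i = 1)
    (A : ι → Finset X) (hA : ∀ i, A i ⊆ S) (hAc : ∀ i, (A i).card = m) (x : ι → X)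
    (hw : ∀ g : X → ℝ, ∑ i, w i * (g (x i) - (m:ℝ)⁻¹ * ∑ x ∈ A i, g x) = 0) :
    ∃ μ' : Measure X, μ' ≤ μ ∧ (μ - μ') Set.univ ≤ ENNReal.ofReal ε ∧
      (μ' Set.univ)⁻¹ • μ' = ∑ i, ENNReal.ofReal (w i) • Measure.dirac (x i) := by
  classical
  have hn : 0 < n := by omega
  have hmR : (0:ℝ) < m := by exact_mod_cast hm
  have hnR : (0:ℝ) < n := by exact_mod_cast hn
  have hn0 : (n:ℝ≥0∞) ≠ 0 := by exact_mod_cast hn.ne'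
  have hm0 : (m:ℝ≥0∞) ≠ 0 := by exact_mod_cast hm.ne'
  have hwE : ∑ i, ENNReal.ofReal (w i) = 1 := by
    rw [← ENNReal.ofReal_sum_of_nonneg fun i _ => hw0 i, hw1, ENNReal.ofReal_one]
  let μ' : Measure X := ∑ i, ENNReal.ofReal (w i) • ((n:ℝ≥0∞)⁻¹ • ∑ z ∈ A i, Measure.dirac z)
  have hμ'univ : μ' Set.univ = m * (n:ℝ≥0∞)⁻¹ := by
    simp only [μ', Measure.coe_finsetSum, Finset.sum_apply, Measure.smul_apply, measure_univ,
      smul_eq_mul, Finset.sum_const, hAc, nsmul_eq_mul, mul_one]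
    rw [← Finset.sum_mul, hwE, one_mul, mul_comm]
  have hle : μ' ≤ μ := by
    have h1 : μ = ∑ i, ENNReal.ofReal (w i) • μ := by
      rw [← Finset.sum_smul, hwE, one_smul]
    rw [h1]
    refine Finset.sum_le_sum fun i _ => ?_
    rw [hμ]
    intro s
    simp only [Measure.coe_finsetSum, Finset.sum_apply, Measure.smul_apply, smul_eq_mul]
    gcongr
    exact hA i
  have hfin : IsFiniteMeasure μ' := ⟨by
    rw [hμ'univ]
    exact ENNReal.mul_lt_top (by simp) (by simpa using hn)⟩
  refine ⟨μ', hle, ?_, ?_⟩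
  · rw [Measure.sub_apply MeasurableSet.univ hle, hμ'univ, aux_mu_univ S n hn hS μ hμ]
    rw [tsub_le_iff_right, hε, ENNReal.ofReal_div_of_pos hnR, ENNReal.ofReal_natCast,
      ENNReal.ofReal_natCast, ENNReal.div_eq_inv_mul, mul_comm, ← add_mul]
    have : (k:ℝ≥0∞) + m = n := by rw [hnm]; push_cast; ring
    rw [mul_comm, this, ENNReal.inv_mul_cancel hn0 (by simp)]
  · have hinv : (μ' Set.univ)⁻¹ * (n:ℝ≥0∞)⁻¹ = (m:ℝ≥0∞)⁻¹ := by
      rw [hμ'univ, ENNReal.mul_inv (Or.inl hm0) (Or.inl (by simp)), inv_inv, mul_assoc,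
        ENNReal.mul_inv_cancel hn0 (by simp), mul_one]
    ext s hs
    have hg := hw (s.indicator 1)
    have e1 : ∀ z : X, Measure.dirac z s = ENNReal.ofReal (s.indicator (1 : X → ℝ) z) := by
      intro z
      rw [Measure.dirac_apply' _ hs]
      by_cases hz : z ∈ s <;> simp [hz]
    have hnn : ∀ z : X, 0 ≤ s.indicator (1 : X → ℝ) z := fun z =>
      Set.indicator_nonneg (fun _ _ => zero_le_one) z
    have hmE : (m:ℝ≥0∞)⁻¹ = ENNReal.ofReal ((m:ℝ)⁻¹) := by
      rw [ENNReal.ofReal_inv_of_pos hmR, ENNReal.ofReal_natCast]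
    have l1 : ((μ' Set.univ)⁻¹ • μ') s =
        ENNReal.ofReal (∑ i, w i * ((m:ℝ)⁻¹ * ∑ z ∈ A i, s.indicator (1 : X → ℝ) z)) := by
      rw [ENNReal.ofReal_sum_of_nonneg (fun i _ => mul_nonneg (hw0 i) (mul_nonneg
        (inv_nonneg.2 hmR.le) (Finset.sum_nonneg fun z _ => hnn z)))]
      rw [Measure.smul_apply]
      conv_lhs => rw [show μ' s = ∑ i, ENNReal.ofReal (w i) *
        ((n:ℝ≥0∞)⁻¹ * ∑ z ∈ A i, Measure.dirac z s) by
          simp only [μ', Measure.coe_finsetSum, Finset.sum_apply, Measure.smul_apply,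
            smul_eq_mul]]
      rw [smul_eq_mul, Finset.mul_sum]
      refine Finset.sum_congr rfl fun i _ => ?_
      rw [ENNReal.ofReal_mul (hw0 i), ENNReal.ofReal_mul (inv_nonneg.2 hmR.le),
        ENNReal.ofReal_sum_of_nonneg (fun z _ => hnn z), ← hmE, ← hinv]
      simp only [e1]
      ring
    have l2 : (∑ i, ENNReal.ofReal (w i) • Measure.dirac (x i)) s =
        ENNReal.ofReal (∑ i, w i * s.indicator (1 : X → ℝ) (x i)) := by
      rw [ENNReal.ofReal_sum_of_nonneg (fun i _ => mul_nonneg (hw0 i) (hnn _))]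
      simp only [Measure.coe_finsetSum, Finset.sum_apply, Measure.smul_apply, smul_eq_mul, e1]
      exact Finset.sum_congr rfl fun i _ => (ENNReal.ofReal_mul (hw0 i)).symm
    rw [l1, l2]
    congr 1
    simp only [mul_sub, Finset.sum_sub_distrib] at hg
    linarith

lemma aux_cost (p : ℝ) (hp : 1 ≤ p) {X : Type*} [MetricSpace X] [MeasurableSpace X]
    (π : Measure (X × X)) :
    eLpNorm (fun z : X × X => dist z.1 z.2) (ENNReal.ofReal p) π
      = (∫⁻ z, ENNReal.ofReal (dist z.1 z.2 ^ p) ∂π) ^ (1 / p) := by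
  have hp0 : 0 < p := by linarith
  rw [eLpNorm_eq_lintegral_rpow_enorm_toReal (by simpa using hp0) (by simp),
    ENNReal.toReal_ofReal hp0.le]
  congr 1
  refine lintegral_congr fun z => ?_
  rw [Real.enorm_eq_ofReal dist_nonneg, ENNReal.ofReal_rpow_of_nonneg dist_nonneg hp0.le]

lemma aux_upper {X : Type*} [MetricSpace X] [MeasurableSpace X] [BorelSpace X]
    (p : ℝ) (hp : 1 ≤ p) (n m k : ℕ) (hm : 0 < m) (hnm : n = m + k)
    (S T : Finset X) (hS : S.card = n) (hT : T.card = n) (μ ν : Measure X)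
    (hμ : μ = (n : ℝ≥0∞)⁻¹ • ∑ x ∈ S, Measure.dirac x)
    (hν : ν = (n : ℝ≥0∞)⁻¹ • ∑ x ∈ T, Measure.dirac x) (ε : ℝ) (hε : ε = (k : ℝ) / n)
    (w : (↥S × ↥T × ↥(S.powersetCard m) × ↥(T.powersetCard m)) → ℝ)
    (hw0 : ∀ i, 0 ≤ w i) (hw1 : ∑ i, w i = 1)
    (hwS : ∀ g : X → ℝ, ∑ i, w i * (g i.1 - (m:ℝ)⁻¹ * ∑ x ∈ i.2.2.1.1, g x) = 0)
    (hwT : ∀ g : X → ℝ, ∑ i, w i * (g i.2.1 - (m:ℝ)⁻¹ * ∑ x ∈ i.2.2.2.1, g x) = 0) :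
    RWp (ENNReal.ofReal p) ε μ ν ≤
      ENNReal.ofReal (∑ i, w i * dist (i.1 : X) (i.2.1 : X) ^ p) ^ (1 / p) := by
  obtain ⟨μ', h1, h2, h3⟩ := aux_side n m k hm hnm S hS μ hμ ε hε w hw0 hw1 (fun i => i.2.2.1.1)
    (fun i => (Finset.mem_powersetCard.1 i.2.2.1.2).1)
    (fun i => (Finset.mem_powersetCard.1 i.2.2.1.2).2) (fun i => i.1) hwS
  obtain ⟨ν', h4, h5, h6⟩ := aux_side n m k hm hnm T hT ν hν ε hε w hw0 hw1 (fun i => i.2.2.2.1)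
    (fun i => (Finset.mem_powersetCard.1 i.2.2.2.2).1)
    (fun i => (Finset.mem_powersetCard.1 i.2.2.2.2).2) (fun i => i.2.1) hwT
  refine (iInf_le_of_le μ' <| iInf_le_of_le ν' <| iInf_le_of_le h1 <| iInf_le_of_le h4 <|
    iInf_le_of_le h2 <| iInf_le_of_le h5 le_rfl).trans ?_
  rw [h3, h6]
  let π : Measure (X × X) := ∑ i, ENNReal.ofReal (w i) • Measure.dirac ((i.1 : X), (i.2.1 : X))
  have hπ : π ∈ couplings (∑ i, ENNReal.ofReal (w i) • Measure.dirac (i.1 : X))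
      (∑ i, ENNReal.ofReal (w i) • Measure.dirac (i.2.1 : X)) := by
    constructor
    · ext s hs
      rw [Measure.map_apply measurable_fst hs]
      simp only [π, Measure.coe_finsetSum, Finset.sum_apply, Measure.smul_apply, smul_eq_mul]
      refine Finset.sum_congr rfl fun i _ => ?_
      rw [Measure.dirac_apply' _ hs, Measure.dirac_apply' _ (measurable_fst hs)]
      rfl
    · ext s hs
      rw [Measure.map_apply measurable_snd hs]
      simp only [π, Measure.coe_finsetSum, Finset.sum_apply, Measure.smul_apply, smul_eq_mul]
      refine Finset.sum_congr rfl fun i _ => ?_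
      rw [Measure.dirac_apply' _ hs, Measure.dirac_apply' _ (measurable_snd hs)]
      rfl
  refine (iInf₂_le π hπ).trans ?_
  rw [aux_cost p hp]
  refine le_of_eq ?_
  congr 1
  simp only [π, lintegral_finsetSum_measure, lintegral_smul_measure, lintegral_dirac]
  rw [ENNReal.ofReal_sum_of_nonneg fun i _ =>
    mul_nonneg (hw0 i) (Real.rpow_nonneg dist_nonneg _)]
  exact Finset.sum_congr rfl fun i _ => (ENNReal.ofReal_mul (hw0 i)).symm

lemma aux_low {X : Type*} [MeasurableSpace X] [MeasurableSingletonClass X]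
    (n m k : ℕ) (hm : 0 < m) (hnm : n = m + k)
    (S : Finset X) (hS : S.card = n) (μ : Measure X)
    (hμ : μ = (n : ℝ≥0∞)⁻¹ • ∑ x ∈ S, Measure.dirac x) (ε : ℝ) (hε : ε = (k : ℝ) / n)
    (μ' : Measure X) (hle : μ' ≤ μ) (hsub : (μ - μ') Set.univ ≤ ENNReal.ofReal ε) :
    ((μ' Set.univ)⁻¹ • μ') Set.univ = 1 ∧ ((μ' Set.univ)⁻¹ • μ') (↑S)ᶜ = 0 ∧
      ∀ x, ((μ' Set.univ)⁻¹ • μ') {x} ≤ (m : ℝ≥0∞)⁻¹ := by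
  classical
  have hn : 0 < n := by omega
  have hnR : (0:ℝ) < n := by exact_mod_cast hn
  have hn0 : (n:ℝ≥0∞) ≠ 0 := by exact_mod_cast hn.ne'
  have hm0 : (m:ℝ≥0∞) ≠ 0 := by exact_mod_cast hm.ne'
  have hu := aux_mu_univ S n hn hS μ hμ
  have hu' : μ' Set.univ ≤ 1 := hu ▸ hle Set.univ
  have hfin : IsFiniteMeasure μ' := ⟨hu'.trans_lt (by simp)⟩
  rw [Measure.sub_apply MeasurableSet.univ hle, hu, tsub_le_iff_right] at hsub
  have hkE : ENNReal.ofReal ε = k * (n:ℝ≥0∞)⁻¹ := by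
    rw [hε, ENNReal.ofReal_div_of_pos hnR, ENNReal.ofReal_natCast, ENNReal.ofReal_natCast,
      ENNReal.div_eq_inv_mul, mul_comm]
  have hmass : (m:ℝ≥0∞) * (n:ℝ≥0∞)⁻¹ ≤ μ' Set.univ := by
    have h1 : (1:ℝ≥0∞) = k * (n:ℝ≥0∞)⁻¹ + m * (n:ℝ≥0∞)⁻¹ := by
      have : (k:ℝ≥0∞) + m = n := by rw [hnm]; push_cast; ring
      rw [← add_mul, this, ENNReal.mul_inv_cancel hn0 (by simp)]
    rw [hkE, h1] at hsub
    refine (ENNReal.add_le_add_iff_left ?_).1 hsub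
    exact (ENNReal.mul_lt_top (by simp) (by simpa using hn)).ne
  have hpos : μ' Set.univ ≠ 0 := by
    intro h0
    rw [h0] at hmass
    have := le_zero_iff.1 hmass
    rw [mul_eq_zero] at this
    rcases this with h | h
    · exact hm0 h
    · simp at h
  refine ⟨?_, ?_, fun x => ?_⟩
  · rw [Measure.smul_apply, smul_eq_mul, ENNReal.inv_mul_cancel hpos (measure_ne_top _ _)]
  · have : μ (↑S)ᶜ = 0 := by
      rw [hμ]
      simp only [Measure.smul_apply, Measure.coe_finsetSum, Finset.sum_apply, smul_eq_mul]
      rw [Finset.sum_eq_zero, mul_zero]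
      intro x hx
      simp [hx]
    have h0 : μ' (↑S)ᶜ = 0 := le_zero_iff.1 (this ▸ hle _)
    rw [Measure.smul_apply, h0, smul_zero]
  · have : μ {x} ≤ (n:ℝ≥0∞)⁻¹ := by
      rw [hμ]
      simp only [Measure.smul_apply, Measure.coe_finsetSum, Finset.sum_apply, smul_eq_mul]
      refine mul_le_of_le_one_right' ?_
      simp only [Measure.dirac_apply, Set.indicator, Set.mem_singleton_iff, Pi.one_apply]
      rw [Finset.sum_ite_eq' S x]
      split_ifs <;> simp
    rw [Measure.smul_apply, smul_eq_mul]
    calc (μ' Set.univ)⁻¹ * μ' {x} ≤ (m * (n:ℝ≥0∞)⁻¹)⁻¹ * (n:ℝ≥0∞)⁻¹ := by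
          gcongr
          exact (hle _).trans this
      _ = (m:ℝ≥0∞)⁻¹ := by
        rw [ENNReal.mul_inv (Or.inl hm0) (Or.inl (by simp)), inv_inv, mul_assoc,
          ENNReal.mul_inv_cancel hn0 (by simp), mul_one]

lemma aux_ctrans {X : Type*} [MetricSpace X] [CompactSpace X] (p : ℝ) (hp : 1 ≤ p)
    (f : C(X, ℝ)) (x y : X) :
    f x + ctrans p f y ≤ dist x y ^ p := by
  have hbd : BddBelow (Set.range fun x : X => dist x y ^ p - f x) := by
    have hc : Continuous fun x : X => dist x y ^ p - f x := by
      refine Continuous.sub ?_ f.continuous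
      exact (continuous_id.dist continuous_const).rpow_const fun _ => Or.inr (by linarith)
    exact (isCompact_range hc).bddBelow
  have := ciInf_le hbd x
  unfold ctrans
  linarith

lemma aux_weak {X : Type*} [MetricSpace X] [CompactSpace X] [MeasurableSpace X] [BorelSpace X]
    (p : ℝ) (hp : 1 ≤ p) (m : ℕ) (hm : 0 < m)
    (S T : Finset X) (hS : m ≤ S.card) (hT : m ≤ T.card) (α β : Measure X)
    (hα1 : α Set.univ = 1) (hα2 : α (↑S)ᶜ = 0) (hα3 : ∀ x, α {x} ≤ (m : ℝ≥0∞)⁻¹)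
    (hβ2 : β (↑T)ᶜ = 0) (hβ3 : ∀ x, β {x} ≤ (m : ℝ≥0∞)⁻¹)
    (π : Measure (X × X)) (hπ : π ∈ couplings α β) (f : C(X, ℝ)) :
    ENNReal.ofReal ((⨅ A : {A : Finset X // A ⊆ S ∧ A.card = m},
              (A.1.card : ℝ)⁻¹ * ∑ x ∈ A.1, f x) +
           (⨅ B : {B : Finset X // B ⊆ T ∧ B.card = m},
              (B.1.card : ℝ)⁻¹ * ∑ y ∈ B.1, ctrans p f y))
      ≤ ∫⁻ z, ENNReal.ofReal (dist z.1 z.2 ^ p) ∂π := by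
  classical
  obtain ⟨hπ1, hπ2⟩ := hπ
  have hmR : (0:ℝ) < m := by exact_mod_cast hm
  have hpu : π Set.univ = 1 := by
    rw [← hα1, ← hπ1, Measure.map_apply measurable_fst MeasurableSet.univ, Set.preimage_univ]
  have hprob : IsProbabilityMeasure π := ⟨hpu⟩
  have hae : ∀ᵐ z ∂π, z ∈ ((S ×ˢ T : Finset (X × X)) : Set (X × X)) := by
    have a1 : ∀ᵐ z ∂π, z.1 ∈ (S : Set X) := by
      rw [ae_iff]
      rw [← hπ1, Measure.map_apply measurable_fst S.measurableSet.compl] at hα2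
      exact hα2
    have a2 : ∀ᵐ z ∂π, z.2 ∈ (T : Set X) := by
      rw [ae_iff]
      rw [← hπ2, Measure.map_apply measurable_snd T.measurableSet.compl] at hβ2
      exact hβ2
    filter_upwards [a1, a2] with z h1 h2
    simpa using ⟨h1, h2⟩
  have hL : ∀ F : X × X → ℝ≥0∞, ∫⁻ z, F z ∂π = ∑ z ∈ S ×ˢ T, F z * π {z} := by
    intro F
    rw [← lintegral_finset, Measure.restrict_eq_self_of_ae_mem hae]
  let q : X × X → ℝ := fun z => (π {z}).toReal
  have hq0 : ∀ z, 0 ≤ q z := fun z => ENNReal.toReal_nonneg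
  have hqE : ∀ z, π {z} = ENNReal.ofReal (q z) := fun z =>
    (ENNReal.ofReal_toReal (measure_ne_top _ _)).symm
  have hmeas : ∀ s, MeasurableSet s → π s = ENNReal.ofReal (∑ z ∈ S ×ˢ T, if z ∈ s then q z else 0) := by
    intro s hs
    rw [← lintegral_indicator_one hs, hL, ENNReal.ofReal_sum_of_nonneg]
    · refine Finset.sum_congr rfl fun z _ => ?_
      by_cases hz : z ∈ s <;> simp [hz, hqE]
    · intro z _
      split_ifs
      · exact hq0 z
      · rfl
  have hmI : (m:ℝ≥0∞)⁻¹ = ENNReal.ofReal ((m:ℝ)⁻¹) := by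
    rw [ENNReal.ofReal_inv_of_pos hmR, ENNReal.ofReal_natCast]
  have hrow : ∀ x ∈ S, ∑ y ∈ T, q (x, y) ≤ (m:ℝ)⁻¹ := by
    intro x hx
    have h1 := hα3 x
    rw [← hπ1, Measure.map_apply measurable_fst (measurableSet_singleton x),
      hmeas _ (measurable_fst (measurableSet_singleton x)), hmI,
      ENNReal.ofReal_le_ofReal_iff (inv_nonneg.2 hmR.le), Finset.sum_product] at h1
    refine le_trans (le_of_eq ?_) h1
    symm
    refine (Finset.sum_eq_single x ?_ ?_).trans ?_
    rotate_left 2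
    · simp
    · intro b _ hb; simp [hb]
    · intro h; exact absurd hx h
  have hcol : ∀ y ∈ T, ∑ x ∈ S, q (x, y) ≤ (m:ℝ)⁻¹ := by
    intro y hy
    have h1 := hβ3 y
    rw [← hπ2, Measure.map_apply measurable_snd (measurableSet_singleton y),
      hmeas _ (measurable_snd (measurableSet_singleton y)), hmI,
      ENNReal.ofReal_le_ofReal_iff (inv_nonneg.2 hmR.le), Finset.sum_product_right] at h1
    refine le_trans (le_of_eq ?_) h1
    symm
    refine (Finset.sum_eq_single y ?_ ?_).trans ?_
    rotate_left 2
    · simp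
    · intro b _ hb; simp [hb]
    · intro h; exact absurd hy h
  have htot : ∑ z ∈ S ×ˢ T, q z = 1 := by
    have h1 := hmeas Set.univ MeasurableSet.univ
    rw [hpu] at h1
    simp only [Set.mem_univ, if_true] at h1
    rw [eq_comm, ENNReal.ofReal_eq_one] at h1
    exact h1
  have hA := aux_trim S f (fun x => ∑ y ∈ T, q (x, y)) m hm hS
    (fun x _ => Finset.sum_nonneg fun y _ => hq0 _) hrow (by rw [← Finset.sum_product]; exact htot)
  have hB := aux_trim T (ctrans p f) (fun y => ∑ x ∈ S, q (x, y)) m hm hT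
    (fun x _ => Finset.sum_nonneg fun y _ => hq0 _) hcol
    (by rw [← Finset.sum_product_right]; exact htot)
  rw [hL]
  have : ∑ z ∈ S ×ˢ T, ENNReal.ofReal (dist z.1 z.2 ^ p) * π {z}
      = ENNReal.ofReal (∑ z ∈ S ×ˢ T, dist z.1 z.2 ^ p * q z) := by
    rw [ENNReal.ofReal_sum_of_nonneg fun z _ =>
      mul_nonneg (Real.rpow_nonneg dist_nonneg _) (hq0 z)]
    refine Finset.sum_congr rfl fun z _ => ?_
    rw [ENNReal.ofReal_mul (Real.rpow_nonneg dist_nonneg _), hqE]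
  rw [this]
  refine ENNReal.ofReal_le_ofReal ((add_le_add hA hB).trans ?_)
  have e1 : ∑ x ∈ S, (∑ y ∈ T, q (x, y)) * f x = ∑ z ∈ S ×ˢ T, f z.1 * q z := by
    rw [Finset.sum_product]
    refine Finset.sum_congr rfl fun x _ => ?_
    rw [Finset.sum_mul]
    exact Finset.sum_congr rfl fun _ _ => mul_comm _ _
  have e2 : ∑ y ∈ T, (∑ x ∈ S, q (x, y)) * ctrans p f y
      = ∑ z ∈ S ×ˢ T, ctrans p f z.2 * q z := by
    rw [Finset.sum_product_right]
    refine Finset.sum_congr rfl fun x _ => ?_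
    rw [Finset.sum_mul]
    exact Finset.sum_congr rfl fun _ _ => mul_comm _ _
  rw [e1, e2, ← Finset.sum_add_distrib]
  refine Finset.sum_le_sum fun z _ => ?_
  rw [← add_mul]
  exact mul_le_mul_of_nonneg_right (aux_ctrans p hp f z.1 z.2) (hq0 z)

lemma aux_le_inf {X : Type*} (S : Finset X) (m : ℕ) (hm : 0 < m) (hS : m ≤ S.card)
    (f g : X → ℝ) (hfg : ∀ x ∈ S, g x ≤ f x) :
    ∃ A ⊆ S, A.card = m ∧ (m : ℝ)⁻¹ * ∑ x ∈ A, g x ≤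
      (⨅ A : {A : Finset X // A ⊆ S ∧ A.card = m}, (A.1.card : ℝ)⁻¹ * ∑ x ∈ A.1, f x) := by
  have hfin : Finite {A : Finset X // A ⊆ S ∧ A.card = m} :=
    Finite.of_injective (fun A => (⟨A.1, Finset.mem_powerset.2 A.2.1⟩ : ↥S.powerset))
      (fun A B h => Subtype.ext (by simpa using h))
  obtain ⟨A0, hA0, hA0c⟩ := Finset.exists_subset_card_eq hS
  have hne : Nonempty {A : Finset X // A ⊆ S ∧ A.card = m} := ⟨⟨A0, hA0, hA0c⟩⟩
  obtain ⟨A, hA⟩ := exists_eq_ciInf_of_finite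
    (f := fun A : {A : Finset X // A ⊆ S ∧ A.card = m} => (A.1.card : ℝ)⁻¹ * ∑ x ∈ A.1, f x)
  refine ⟨A.1, A.2.1, A.2.2, ?_⟩
  rw [← hA]
  simp only [A.2.2]
  gcongr with x hx
  exact hfg x (A.2.1 hx)

lemma aux_strong {X : Type*} [MetricSpace X] [CompactSpace X] [Nonempty X]
    (p : ℝ) (hp : 1 ≤ p) (m : ℕ) (hm : 0 < m)
    (S T : Finset X) (hS : m ≤ S.card) (hT : m ≤ T.card) (R : ℝ) (f g : X → ℝ)
    (h : ∀ x ∈ S, ∀ y ∈ T, ∀ A ⊆ S, A.card = m → ∀ B ⊆ T, B.card = m →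
      R < dist x y ^ p - f x - g y + (m:ℝ)⁻¹ * ∑ x ∈ A, f x + (m:ℝ)⁻¹ * ∑ x ∈ B, g x) :
    ∃ F : C(X, ℝ), R ≤ (⨅ A : {A : Finset X // A ⊆ S ∧ A.card = m},
              (A.1.card : ℝ)⁻¹ * ∑ x ∈ A.1, F x) +
           (⨅ B : {B : Finset X // B ⊆ T ∧ B.card = m},
              (B.1.card : ℝ)⁻¹ * ∑ y ∈ B.1, ctrans p F y) := by
  have hmR : (0:ℝ) < m := by exact_mod_cast hm
  have hSne : S.Nonempty := Finset.card_pos.1 (by omega)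
  have hTne : T.Nonempty := Finset.card_pos.1 (by omega)
  obtain ⟨z, hz, hmin⟩ := Finset.exists_min_image (S ×ˢ T)
    (fun z : X × X => dist z.1 z.2 ^ p - f z.1 - g z.2) (hSne.product hTne)
  rw [Finset.mem_product] at hz
  set t := dist z.1 z.2 ^ p - f z.1 - g z.2 with ht
  let F : C(X, ℝ) := ⟨fun x => T.inf' hTne fun y => dist x y ^ p - (g y + t), by
    refine Continuous.finset_inf'_apply hTne fun y _ => Continuous.sub ?_ continuous_const
    exact (continuous_id.dist continuous_const).rpow_const fun _ => Or.inr (by linarith)⟩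
  have hF1 : ∀ x ∈ S, f x ≤ F x := by
    intro x hx
    refine Finset.le_inf' hTne _ fun y hy => ?_
    have := hmin (x, y) (Finset.mem_product.2 ⟨hx, hy⟩)
    simp only at this
    linarith
  have hF2 : ∀ y ∈ T, g y + t ≤ ctrans p F y := by
    intro y hy
    refine le_ciInf fun x => ?_
    have : F x ≤ dist x y ^ p - (g y + t) :=
      Finset.inf'_le (fun y => dist x y ^ p - (g y + t)) hy
    linarith
  obtain ⟨A, hA, hAc, hA'⟩ := aux_le_inf S m hm hS F f hF1
  obtain ⟨B, hB, hBc, hB'⟩ := aux_le_inf T m hm hT (ctrans p F) (fun y => g y + t) hF2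
  refine ⟨F, ?_⟩
  have h1 := h z.1 hz.1 z.2 hz.2 A hA hAc B hB hBc
  rw [← ht] at h1
  have h2 : (m:ℝ)⁻¹ * ∑ x ∈ B, (g x + t) = (m:ℝ)⁻¹ * ∑ x ∈ B, g x + t := by
    rw [Finset.sum_add_distrib, Finset.sum_const, hBc, nsmul_eq_mul, mul_add,
      inv_mul_cancel_left₀ hmR.ne']
  rw [h2] at hB'
  linarith

lemma aux_fin {X : Type*} [MetricSpace X] [CompactSpace X] [MeasurableSpace X] [BorelSpace X]
    (p ε : ℝ) (μ ν : Measure X) (hμ : μ Set.univ = 1) (hν : ν Set.univ = 1) :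
    RWp (ENNReal.ofReal p) ε μ ν ≠ ⊤ := by
  have i1 : IsProbabilityMeasure μ := ⟨hμ⟩
  have i2 : IsProbabilityMeasure ν := ⟨hν⟩
  have h0 : ∀ μ : Measure X, IsProbabilityMeasure μ → (μ - μ) Set.univ ≤ ENNReal.ofReal ε := by
    intro μ _
    rw [Measure.sub_apply MeasurableSet.univ le_rfl]; simp
  refine ne_top_of_le_ne_top ?_ (iInf_le_of_le μ <| iInf_le_of_le ν <| iInf_le_of_le le_rfl <|
    iInf_le_of_le le_rfl <| iInf_le_of_le (h0 μ i1) <| iInf_le_of_le (h0 ν i2) le_rfl)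
  rw [hμ, hν, inv_one, one_smul, one_smul]
  refine ne_top_of_le_ne_top ?_ (iInf₂_le (μ.prod ν) ⟨by simp, by simp⟩)
  refine ne_top_of_le_ne_top ?_ (eLpNorm_le_of_ae_bound (C := Metric.diam (Set.univ : Set X)) ?_)
  · simp
  · refine Filter.Eventually.of_forall fun z => ?_
    rw [Real.norm_of_nonneg dist_nonneg]
    exact Metric.dist_le_diam_of_mem isCompact_univ.isBounded trivial trivial

/-- loss trimming dual: on a compact metric space, for `p ∈ [1,∞)`, if
`μ, ν` are uniform over `n` points each and `ε = k/n`, then `W_p^ε(μ,ν)^p` equals the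
supremum over continuous `f` of the sum of the trimmed means of `f` over `supp μ` and of
`f^c` over `supp ν`, each over subsets of `(1−ε)n` points. -/
theorem loss_trimming_dual {X : Type*} [MetricSpace X] [CompactSpace X] [Nonempty X]
    [MeasurableSpace X] [BorelSpace X]
    (p : ℝ) (hp : 1 ≤ p) (n : ℕ) (hn : 0 < n)
    (S T : Finset X) (hS : S.card = n) (hT : T.card = n)
    (k : ℕ) (hk : k ≤ n) (ε : ℝ) (hε : ε = (k : ℝ) / n)
    (μ ν : Measure X)
    (hμ : μ = (n : ℝ≥0∞)⁻¹ • ∑ x ∈ S, Measure.dirac x)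
    (hν : ν = (n : ℝ≥0∞)⁻¹ • ∑ y ∈ T, Measure.dirac y) :
    (RWp (ENNReal.ofReal p) ε μ ν).toReal ^ p
      = ⨆ f : C(X, ℝ),
          ((⨅ A : {A : Finset X // A ⊆ S ∧ A.card = n - k},
              (A.1.card : ℝ)⁻¹ * ∑ x ∈ A.1, f x) +
           (⨅ B : {B : Finset X // B ⊆ T ∧ B.card = n - k},
              (B.1.card : ℝ)⁻¹ * ∑ y ∈ B.1, ctrans p f y)) := by
  have hp0 : 0 < p := by linarith
  have hnR : (0:ℝ) < n := by exact_mod_cast hn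
  rcases hk.lt_or_eq with hkn | hkn
  swap
  · -- the degenerate case
    have hε1 : ε = 1 := by rw [hε, hkn, div_self hnR.ne']
    have hsub : ∀ μ : Measure X, μ Set.univ = 1 → (μ - 0) Set.univ ≤ ENNReal.ofReal ε := by
      intro μ h
      rw [Measure.sub_apply MeasurableSet.univ (Measure.zero_le _)]
      simp [h, hε1]
    have hR0 : RWp (ENNReal.ofReal p) ε μ ν = 0 := by
      refine le_zero_iff.1 ?_
      refine (iInf_le_of_le (0 : Measure X) <| iInf_le_of_le (0 : Measure X) <| iInf_le_of_le (Measure.zero_le _) <|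
        iInf_le_of_le (Measure.zero_le _) <|
        iInf_le_of_le (hsub μ (aux_mu_univ S n hn hS μ hμ)) <|
        iInf_le_of_le (hsub ν (aux_mu_univ T n hn hT ν hν)) le_rfl).trans ?_
      refine (iInf₂_le 0 ⟨by simp, by simp⟩).trans ?_
      simp
    rw [hR0, ENNReal.toReal_zero, Real.zero_rpow hp0.ne']
    have hz : ∀ (S : Finset X) (f : X → ℝ), (⨅ A : {A : Finset X // A ⊆ S ∧ A.card = n - k},
              (A.1.card : ℝ)⁻¹ * ∑ x ∈ A.1, f x) = 0 := by
      intro S f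
      have : ∀ A : {A : Finset X // A ⊆ S ∧ A.card = n - k},
          (A.1.card : ℝ)⁻¹ * ∑ x ∈ A.1, f x = 0 := by
        intro A
        have h0 : A.1.card = 0 := by rw [A.2.2, hkn]; simp
        rw [h0]; simp
      simp only [this]
      exact Real.iInf_const_zero
    simp only [hz, add_zero]
    exact (ciSup_const).symm
  obtain ⟨m, hm⟩ : ∃ m, m = n - k := ⟨_, rfl⟩
  rw [← hm]
  have hm0 : 0 < m := by omega
  have hnm : n = m + k := by omega
  have hSm : m ≤ S.card := by omega
  have hTm : m ≤ T.card := by omega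
  have hfin : RWp (ENNReal.ofReal p) ε μ ν ≠ ⊤ :=
    aux_fin p ε μ ν (aux_mu_univ S n hn hS μ hμ) (aux_mu_univ T n hn hT ν hν)
  have hweak : ∀ f : C(X, ℝ), ((⨅ A : {A : Finset X // A ⊆ S ∧ A.card = m},
              (A.1.card : ℝ)⁻¹ * ∑ x ∈ A.1, f x) +
           (⨅ B : {B : Finset X // B ⊆ T ∧ B.card = m},
              (B.1.card : ℝ)⁻¹ * ∑ y ∈ B.1, ctrans p f y)) ≤
        (RWp (ENNReal.ofReal p) ε μ ν).toReal ^ p := by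
    intro f
    generalize hΦ : ((⨅ A : {A : Finset X // A ⊆ S ∧ A.card = m},
              (A.1.card : ℝ)⁻¹ * ∑ x ∈ A.1, f x) +
           (⨅ B : {B : Finset X // B ⊆ T ∧ B.card = m},
              (B.1.card : ℝ)⁻¹ * ∑ y ∈ B.1, ctrans p f y)) = Φ
    have h1 : ENNReal.ofReal Φ ^ (1 / p) ≤ RWp (ENNReal.ofReal p) ε μ ν := by
      refine le_iInf fun μ' => le_iInf fun ν' => le_iInf fun h1 => le_iInf fun h2 =>
        le_iInf fun h3 => le_iInf fun h4 => le_iInf fun π => le_iInf fun hπ => ?_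
      rw [aux_cost p hp]
      refine ENNReal.rpow_le_rpow ?_ (by positivity)
      obtain ⟨a1, a2, a3⟩ := aux_low n m k hm0 hnm S hS μ hμ ε hε μ' h1 h3
      obtain ⟨b1, b2, b3⟩ := aux_low n m k hm0 hnm T hT ν hν ε hε ν' h2 h4
      rw [← hΦ]
      exact aux_weak p hp m hm0 S T hSm hTm _ _ a1 a2 a3 b2 b3 π hπ f
    rw [one_div, ENNReal.rpow_inv_le_iff hp0] at h1
    rw [ENNReal.toReal_rpow]
    exact (ENNReal.ofReal_le_iff_le_toReal (ENNReal.rpow_ne_top_of_nonneg hp0.le hfin)).1 h1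
  refine le_antisymm ?_ (ciSup_le hweak)
  refine le_of_forall_lt fun R hR => ?_
  obtain ⟨R', hRR, hR'⟩ := exists_between hR
  refine hRR.trans_le ?_
  obtain ⟨f, g, hfg⟩ := aux_lp S T m hm0 hSm hTm (fun x y => dist x y ^ p) R' (by
    intro w hw0 hw1 hwS hwT
    have hu := aux_upper p hp n m k hm0 hnm S T hS hT μ ν hμ hν ε hε w hw0 hw1 hwS hwT
    refine hR'.trans_le ?_
    rw [one_div, ENNReal.le_rpow_inv_iff hp0] at hu
    rw [ENNReal.toReal_rpow]
    exact ENNReal.toReal_le_of_le_ofReal (Finset.sum_nonneg fun i _ =>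
      mul_nonneg (hw0 i) (Real.rpow_nonneg dist_nonneg _)) hu)
  obtain ⟨F, hF⟩ := aux_strong p hp m hm0 S T hSm hTm R' f g hfg
  refine hF.trans (le_ciSup (f := fun f : C(X, ℝ) => ((⨅ A : {A : Finset X // A ⊆ S ∧ A.card = m},
              (A.1.card : ℝ)⁻¹ * ∑ x ∈ A.1, f x) +
           (⨅ B : {B : Finset X // B ⊆ T ∧ B.card = m},
              (B.1.card : ℝ)⁻¹ * ∑ y ∈ B.1, ctrans p f y))) ?_ F)
  exact ⟨_, by rintro _ ⟨f, rfl⟩; exact hweak f⟩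

end
end
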